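/- There are exactly 1249 isomorphism classes of combinatorial surfaces on the vertex set Fin 11 with Euler characteristic 2 (triangulated 2-spheres with 11 vertices), and exactly 7595 isomorphism classes of combinatorial surfaces on the vertex set Fin 12 with Euler characteristic 2 (triangulated 2-spheres with 12 vertices). -/

import Mathlib

open Finset

section Defs

variable {α : Type*} [DecidableEq α]

/-- The 1-skeleton graph of a set of faces: two vertices are adjacent
if they lie together in a common face of `S`. -/
def skeletonGraph (S : Finset (Finset α)) : SimpleGraph α where
  Adj a b := a ≠ b ∧ ∃ T ∈ S, a ∈ T ∧ b ∈ T
  symm := by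
    refine ⟨?_⟩
    rintro a b ⟨hab, T, hT, ha, hb⟩
    exact ⟨hab.symm, T, hT, hb, ha⟩
  loopless := by refine ⟨?_⟩; rintro a ⟨h, -⟩; exact h rfl

/-- The link graph of a vertex `v`: `a` and `b` are adjacent
if `{v, a, b}` is a triangle of `S`. -/
def linkGraph (S : Finset (Finset α)) (v : α) : SimpleGraph α where
  Adj a b := a ≠ b ∧ ({v, a, b} : Finset α) ∈ S
  symm := by
    refine ⟨?_⟩
    rintro a b ⟨hab, h⟩
    refine ⟨hab.symm, ?_⟩
    rwa [Finset.pair_comm b a]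
  loopless := by refine ⟨?_⟩; rintro a ⟨h, -⟩; exact h rfl

/-- The set of neighbors of the vertex `v` in `S`. -/
def nbrSet (S : Finset (Finset α)) (v : α) : Set α :=
  {a | a ≠ v ∧ ∃ T ∈ S, v ∈ T ∧ a ∈ T}

/-- The edges of `S`: the 2-element subsets of `V` contained in some face of `S`. -/
def edgesOn (V : Finset α) (S : Finset (Finset α)) : Finset (Finset α) :=
  V.powerset.filter fun e => e.card = 2 ∧ ∃ T ∈ S, e ⊆ T

/-- `S` is a combinatorial surface on the vertex set `V`: all faces are triangles
on `V`, every vertex of `V` lies in a triangle, every edge lies in exactly two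
triangles, the link graph of every vertex (induced on the neighbors of the
vertex) is connected, and the 1-skeleton (induced on `V`) is connected. -/
def IsCombSurfaceOn (V : Finset α) (S : Finset (Finset α)) : Prop :=
  (∀ T ∈ S, T.card = 3 ∧ T ⊆ V) ∧
  (∀ v ∈ V, ∃ T ∈ S, v ∈ T) ∧
  (∀ e : Finset α, e.card = 2 → (∃ T ∈ S, e ⊆ T) →
    (S.filter fun T => e ⊆ T).card = 2) ∧
  (∀ v ∈ V, ((linkGraph S v).induce (nbrSet S v)).Connected) ∧
  ((skeletonGraph S).induce (V : Set α)).Connected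

/-- The Euler characteristic `χ = |V| - f₁ + f₂` of `S` on the vertex set `V`. -/
def eulerCharOn (V : Finset α) (S : Finset (Finset α)) : ℤ :=
  (V.card : ℤ) - ((edgesOn V S).card : ℤ) + (S.card : ℤ)

/-- `S` is equivelar (degree-regular): all vertices of `V` lie in the same
number `q` of triangles. -/
def IsEquivelarOn (V : Finset α) (S : Finset (Finset α)) : Prop :=
  ∃ q : ℕ, ∀ v ∈ V, (S.filter fun T => v ∈ T).card = q

/-- The directed edges of the cyclic ordering given by an ordered triple. -/
def dirEdges (t : α × α × α) : Finset (α × α) :=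
  {(t.1, t.2.1), (t.2.1, t.2.2), (t.2.2, t.1)}

/-- `S` is orientable: one can choose a cyclic ordering of each triangle so that
for every edge `{a, b}` lying in two triangles, the two chosen cyclic orderings
traverse the edge in opposite directions. -/
def IsOrientable (S : Finset (Finset α)) : Prop :=
  ∃ o : Finset α → α × α × α,
    (∀ T ∈ S, ({(o T).1, (o T).2.1, (o T).2.2} : Finset α) = T) ∧
    (∀ T ∈ S, ∀ T' ∈ S, T ≠ T' → ∀ x y : α,
      (x, y) ∈ dirEdges (o T) → ({x, y} : Finset α) ⊆ T' →
      (y, x) ∈ dirEdges (o T'))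

/-- The link of a vertex `v` in a 3-dimensional complex `S`:
the triangles `{a,b,c}` with `{v,a,b,c} ∈ S`. -/
def linkOf (S : Finset (Finset α)) (v : α) : Finset (Finset α) :=
  (S.filter fun T => v ∈ T).image fun T => T.erase v

end Defs

/-- `S` is a combinatorial surface on the vertex set `Fin n`. -/
def IsCombSurface (n : ℕ) (S : Finset (Finset (Fin n))) : Prop :=
  IsCombSurfaceOn Finset.univ S

/-- The Euler characteristic of a complex on the vertex set `Fin n`. -/
def eulerChar (n : ℕ) (S : Finset (Finset (Fin n))) : ℤ :=
  eulerCharOn Finset.univ S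

/-- `S` is equivelar on `Fin n`. -/
def IsEquivelar (n : ℕ) (S : Finset (Finset (Fin n))) : Prop :=
  IsEquivelarOn Finset.univ S

/-- `S` is neighborly: every 2-element subset of `Fin n` is an edge. -/
def IsNeighborly (n : ℕ) (S : Finset (Finset (Fin n))) : Prop :=
  ∀ e : Finset (Fin n), e.card = 2 → ∃ T ∈ S, e ⊆ T

/-- Two labeled complexes on `Fin n` are isomorphic if a permutation of the
vertices maps the faces of one onto the faces of the other. -/
def IsoComplex (n : ℕ) (S S' : Finset (Finset (Fin n))) : Prop :=
  ∃ σ : Equiv.Perm (Fin n), S.image (fun T => T.image σ) = S'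

/-- The number of isomorphism classes (orbits under the symmetric group)
of complexes on `Fin n` satisfying `P`. -/
noncomputable def numClasses (n : ℕ) (P : Finset (Finset (Fin n)) → Prop) : ℕ :=
  Nat.card (Quot fun A B : {S : Finset (Finset (Fin n)) // P S} => IsoComplex n A.1 B.1)

/-- The neighbors of a vertex `v` in a complex `S` on `Fin n`. -/
def vertexNbrs (n : ℕ) (S : Finset (Finset (Fin n))) (v : Fin n) : Finset (Fin n) :=
  Finset.univ.filter fun a => a ≠ v ∧ ∃ T ∈ S, v ∈ T ∧ a ∈ T

/-- `S` is a combinatorial 3-manifold on the vertex set `Fin n`: all faces are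
tetrahedra, every vertex lies in a tetrahedron, every triangle contained in a
tetrahedron lies in exactly two tetrahedra, the link of every vertex is a
combinatorial surface (on the neighbors of the vertex) with Euler
characteristic 2, and the 1-skeleton is connected. -/
def IsComb3Manifold (n : ℕ) (S : Finset (Finset (Fin n))) : Prop :=
  (∀ T ∈ S, T.card = 4) ∧
  (∀ v : Fin n, ∃ T ∈ S, v ∈ T) ∧
  (∀ F : Finset (Fin n), F.card = 3 → (∃ T ∈ S, F ⊆ T) →
    (S.filter fun T => F ⊆ T).card = 2) ∧
  (∀ v : Fin n, IsCombSurfaceOn (vertexNbrs n S v) (linkOf S v) ∧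
    eulerCharOn (vertexNbrs n S v) (linkOf S v) = 2) ∧
  (skeletonGraph S).Connected

set_option linter.all false

open scoped symmDiff

/-! ### Triangulated spheres -/

section Spheres

variable {α : Type*} [DecidableEq α]

/-- The number of faces containing `e`. -/
def cnt (S : Finset (Finset α)) (e : Finset α) : ℕ := (S.filter fun T => e ⊆ T).card

/-- Triangulated spheres; a more convenient version. -/
structure Sp (V : Finset α) (S : Finset (Finset α)) : Prop where
  tri : ∀ T ∈ S, T.card = 3
  sub : ∀ T ∈ S, T ⊆ V
  cov : ∀ v ∈ V, ∃ T ∈ S, v ∈ T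
  two : ∀ e : Finset α, e.card = 2 → (∃ T ∈ S, e ⊆ T) → cnt S e = 2
  lnk : ∀ v ∈ V, ∀ q : Finset α → Prop,
    (∀ T ∈ S, ∀ T' ∈ S, v ∈ T → v ∈ T' → ∀ a, a ≠ v → a ∈ T → a ∈ T' → q T → q T') →
    ∀ T ∈ S, ∀ T' ∈ S, v ∈ T → v ∈ T' → q T → q T'
  con : ∀ p : α → Prop, (∀ T ∈ S, ∀ a ∈ T, ∀ b ∈ T, p a → p b) →
    ∀ a ∈ V, ∀ b ∈ V, p a → p b
  chi : S.card + 4 = 2 * V.card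

lemma connected_induce_iff {β : Type*} (G : SimpleGraph β) (s : Set β) :
    (G.induce s).Connected ↔ s.Nonempty ∧ ∀ p : β → Prop,
      (∀ a ∈ s, ∀ b ∈ s, G.Adj a b → p a → p b) → ∀ a ∈ s, ∀ b ∈ s, p a → p b := by
  constructor
  · intro h
    have hne := h.nonempty
    refine ⟨⟨_, hne.some.2⟩, fun p hp a ha b hb hpa => ?_⟩
    obtain ⟨w⟩ := h.preconnected ⟨a, ha⟩ ⟨b, hb⟩
    have key : ∀ x y : s, (G.induce s).Walk x y → p x → p y := by
      intro x y w
      induction w with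
      | nil => exact id
      | cons hadj _ ih => intro hx; exact ih (hp _ (Subtype.coe_prop _) _ (Subtype.coe_prop _) hadj hx)
    exact key _ _ w hpa
  · rintro ⟨⟨x, hx⟩, h⟩
    haveI : Nonempty s := ⟨⟨x, hx⟩⟩
    refine SimpleGraph.Connected.mk fun a b => ?_
    obtain ⟨a, ha⟩ := a
    obtain ⟨b, hb⟩ := b
    have := h (fun y => ∃ hy : y ∈ s, (G.induce s).Reachable ⟨a, ha⟩ ⟨y, hy⟩) ?_ a ha b hb ⟨ha, .rfl⟩
    · exact this.2
    · rintro c hc d hd hcd ⟨_, hr⟩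
      exact ⟨hd, hr.trans (SimpleGraph.Adj.reachable (by simpa using hcd))⟩

lemma eq_triple {T : Finset α} (h : T.card = 3) {v a : α} (hv : v ∈ T) (ha : a ∈ T) (hne : a ≠ v) :
    ∃ b, b ≠ v ∧ b ≠ a ∧ T = {v, a, b} := by
  have h1 : ((T.erase v).erase a).card = 1 := by
    rw [card_erase_of_mem (by simp [hne, ha]), card_erase_of_mem hv, h]
  obtain ⟨b, hb⟩ := card_eq_one.1 h1
  have hb' : b ∈ (T.erase v).erase a := by simp [hb]
  simp only [mem_erase] at hb'
  refine ⟨b, hb'.2.1, hb'.1, ?_⟩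
  rw [← insert_erase hv, ← insert_erase (show a ∈ T.erase v by simp [hne, ha]), hb]

lemma lnk_iff {S : Finset (Finset α)} (h3 : ∀ T ∈ S, T.card = 3) {v : α} (hv : ∃ T ∈ S, v ∈ T) :
    ((linkGraph S v).induce (nbrSet S v)).Connected ↔ ∀ q : Finset α → Prop,
    (∀ T ∈ S, ∀ T' ∈ S, v ∈ T → v ∈ T' → ∀ a, a ≠ v → a ∈ T → a ∈ T' → q T → q T') →
    ∀ T ∈ S, ∀ T' ∈ S, v ∈ T → v ∈ T' → q T → q T' := by
  have hex : ∀ T ∈ S, v ∈ T → ∃ a ∈ T, a ≠ v := fun T hT _ => by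
    obtain ⟨a, ha, hne⟩ := exists_mem_ne (by rw [h3 T hT]; norm_num) v
    exact ⟨a, ha, hne⟩
  rw [connected_induce_iff]
  constructor
  · rintro ⟨_, h⟩ q hq T hT T' hT' hvT hvT' hqT
    obtain ⟨a, ha, hav⟩ := hex T hT hvT
    obtain ⟨b, hb, hbv⟩ := hex T' hT' hvT'
    obtain ⟨U, hU, hvU, hbU, hqU⟩ := h (fun x => ∃ U ∈ S, v ∈ U ∧ x ∈ U ∧ q U) (by
      rintro x hx y hy ⟨hxy, hxyS⟩ ⟨U, hU, hvU, hxU, hqU⟩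
      exact ⟨_, hxyS, by simp, by simp, hq U hU _ hxyS hvU (by simp) x hx.1 hxU (by simp) hqU⟩)
      a ⟨hav, T, hT, hvT, ha⟩ b ⟨hbv, T', hT', hvT', hb⟩ ⟨T, hT, hvT, ha, hqT⟩
    exact hq U hU T' hT' hvU hvT' b hbv hbU hb hqU
  · intro h
    refine ⟨?_, ?_⟩
    · obtain ⟨T, hT, hvT⟩ := hv
      obtain ⟨a, ha, hav⟩ := hex T hT hvT
      exact ⟨a, hav, T, hT, hvT, ha⟩
    · rintro p hp a ⟨hav, T, hT, hvT, ha⟩ b ⟨hbv, T', hT', hvT', hb⟩ hpa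
      have hT2 : ∀ U ∈ S, v ∈ U → ∀ x ∈ U, x ≠ v → p x → ∀ y ∈ U, y ≠ v → p y := by
        intro U hU hvU x hx hxv hpx y hy hyv
        by_cases hxy : y = x
        · rwa [hxy]
        obtain ⟨z, hz, hzx, rfl⟩ := eq_triple (h3 U hU) hvU hx hxv
        have : y = z := by simpa [hyv, hxy] using hy
        subst this
        exact hp x ⟨hxv, _, hU, hvU, hx⟩ y ⟨hyv, _, hU, hvU, hy⟩ ⟨Ne.symm hxy, hU⟩ hpx
      refine h (fun U => ∀ x ∈ U, x ≠ v → p x) ?_ T hT T' hT' hvT hvT' ?_ b hb hbv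
      · intro U hU U' hU' hvU hvU' x hxv hxU hxU' hq
        exact hT2 U' hU' hvU' x hxU' hxv (hq x hxU hxv)
      · exact hT2 T hT hvT a ha hav hpa

lemma con_iff {V : Finset α} {S : Finset (Finset α)} (hS : ∀ T ∈ S, T ⊆ V) :
    ((skeletonGraph S).induce (V : Set α)).Connected ↔ V.Nonempty ∧
      ∀ p : α → Prop, (∀ T ∈ S, ∀ a ∈ T, ∀ b ∈ T, p a → p b) → ∀ a ∈ V, ∀ b ∈ V, p a → p b := by
  rw [connected_induce_iff]
  refine and_congr (by simp) (forall_congr' fun p => ?_)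
  refine ⟨fun h hp => h ?_, fun h hp => h ?_⟩
  · rintro a _ b _ ⟨_, T, hT, ha, hb⟩
    exact hp T hT a ha b hb
  · intro T hT a ha b hb hpa
    by_cases hab : a = b
    · rwa [← hab]
    · exact hp a (hS T hT ha) b (hS T hT hb) ⟨hab, T, hT, ha, hb⟩ hpa

lemma card_edges {V : Finset α} {S : Finset (Finset α)} (h3 : ∀ T ∈ S, T.card = 3)
    (hS : ∀ T ∈ S, T ⊆ V)
    (two : ∀ e : Finset α, e.card = 2 → (∃ T ∈ S, e ⊆ T) → cnt S e = 2) :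
    3 * S.card = 2 * (edgesOn V S).card := by
  have h := sum_card_bipartiteAbove_eq_sum_card_bipartiteBelow (s := S) (t := edgesOn V S)
    (fun T e => e ⊆ T)
  have h1 : ∀ T ∈ S, (bipartiteAbove (fun T e => e ⊆ T) (edgesOn V S) T).card = 3 := by
    intro T hT
    have : bipartiteAbove (fun T e => e ⊆ T) (edgesOn V S) T = T.powersetCard 2 := by
      ext e
      simp only [bipartiteAbove, edgesOn, mem_filter, mem_powerset, mem_powersetCard]
      constructor
      · rintro ⟨⟨_, h, _⟩, h'⟩; exact ⟨h', h⟩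
      · rintro ⟨h, h'⟩; exact ⟨⟨h.trans (hS T hT), h', T, hT, h⟩, h⟩
    rw [this, card_powersetCard, h3 T hT]; rfl
  have h2 : ∀ e ∈ edgesOn V S, (bipartiteBelow (fun T e => e ⊆ T) S e).card = 2 := by
    intro e he
    simp only [edgesOn, mem_filter] at he
    exact two e he.2.1 he.2.2
  rw [sum_const_nat h1, sum_const_nat h2] at h
  omega

lemma sp_iff (V : Finset α) (S : Finset (Finset α)) :
    Sp V S ↔ IsCombSurfaceOn V S ∧ eulerCharOn V S = 2 := by
  constructor
  · intro h
    have h1 := card_edges h.tri h.sub h.two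
    have h2 := h.chi
    refine ⟨⟨fun T hT => ⟨h.tri T hT, h.sub T hT⟩, h.cov, h.two, fun v hv => ?_, ?_⟩, ?_⟩
    · exact (lnk_iff h.tri (h.cov v hv)).2 (h.lnk v hv)
    · exact (con_iff h.sub).2 ⟨card_pos.1 (by omega), h.con⟩
    · unfold eulerCharOn; omega
  · rintro ⟨⟨h1, h2, h3, h4, h5⟩, h6⟩
    have h7 := card_edges (fun T hT => (h1 T hT).1) (fun T hT => (h1 T hT).2) h3
    refine ⟨fun T hT => (h1 T hT).1, fun T hT => (h1 T hT).2, h2, h3, fun v hv => ?_, ?_, ?_⟩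
    · exact (lnk_iff (fun T hT => (h1 T hT).1) (h2 v hv)).1 (h4 v hv)
    · exact ((con_iff (fun T hT => (h1 T hT).2)).1 h5).2
    · unfold eulerCharOn at h6; omega

end Spheres


section Moves

variable {α : Type*} [DecidableEq α]

/-- The boundary of a tetrahedron. -/
def tet (X : Finset α) : Finset (Finset α) := X.powersetCard 3

lemma cnt_symmDiff (S D : Finset (Finset α)) (e : Finset α) :
    cnt (S ∆ D) e + 2 * cnt (S ∩ D) e = cnt S e + cnt D e := by
  unfold cnt
  have h1 : (S ∆ D).filter (fun T => e ⊆ T) = (S.filter (e ⊆ ·)) ∆ (D.filter (e ⊆ ·)) := by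
    ext T; simp only [mem_filter, mem_symmDiff]; tauto
  have h2 : (S ∩ D).filter (fun T => e ⊆ T) = (S.filter (e ⊆ ·)) ∩ (D.filter (e ⊆ ·)) := by
    ext T; simp only [mem_filter, mem_inter]; tauto
  rw [h1, h2]
  generalize S.filter (e ⊆ ·) = A
  generalize D.filter (e ⊆ ·) = B
  have h3 : A ∆ B = A \ B ∪ B \ A := rfl
  have h4 : Disjoint (A \ B) (B \ A) := by
    rw [disjoint_left]; intro x; simp only [mem_sdiff]; tauto
  rw [h3, card_union_of_disjoint h4]
  have h5 := card_sdiff_add_card_inter A B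
  have h6 := card_sdiff_add_card_inter B A
  rw [inter_comm] at h6
  omega

lemma card_symmDiff' (S D : Finset (Finset α)) :
    (S ∆ D).card + 2 * (S ∩ D).card = S.card + D.card := by
  simpa [cnt] using cnt_symmDiff S D ∅

lemma mem_tet {X T : Finset α} : T ∈ tet X ↔ T ⊆ X ∧ T.card = 3 := mem_powersetCard

lemma cnt_pos {S : Finset (Finset α)} {e : Finset α} : 0 < cnt S e ↔ ∃ T ∈ S, e ⊆ T := by
  simp [cnt, card_pos, Finset.Nonempty, mem_filter]

lemma cnt_tet {X e : Finset α} (hX : X.card = 4) (he : e.card = 2) (heX : e ⊆ X) :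
    cnt (tet X) e = 2 := by
  have h : (tet X).filter (fun T => e ⊆ T) = (X \ e).image (fun x => insert x e) := by
    ext T
    simp only [mem_filter, mem_tet, mem_image, mem_sdiff]
    constructor
    · rintro ⟨⟨h1, h2⟩, h3⟩
      have : (T \ e).card = 1 := by rw [card_sdiff_of_subset h3]; omega
      obtain ⟨x, hx⟩ := card_eq_one.1 this
      have hx' : x ∈ T \ e := by simp [hx]
      refine ⟨x, ⟨h1 (mem_sdiff.1 hx').1, (mem_sdiff.1 hx').2⟩, ?_⟩
      rw [insert_eq, ← hx, sdiff_union_of_subset h3]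
    · rintro ⟨x, ⟨h1, h2⟩, rfl⟩
      refine ⟨⟨insert_subset h1 heX, ?_⟩, subset_insert _ _⟩
      rw [card_insert_of_notMem h2, he]
  unfold cnt
  rw [h, card_image_of_injOn, card_sdiff_of_subset heX]
  · omega
  · intro x hx y hy hxy
    simp only [coe_sdiff, Set.mem_diff, mem_coe] at hx hy hxy
    have : x ∈ insert y e := hxy ▸ mem_insert_self x e
    exact (mem_insert.1 this).resolve_right hx.2

lemma cnt_tet_zero {X e : Finset α} (heX : ¬ e ⊆ X) : cnt (tet X) e = 0 := by
  unfold cnt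
  rw [card_eq_zero, filter_eq_empty_iff]
  intro T hT h
  exact heX (h.trans (mem_tet.1 hT).1)

lemma cnt_mono {S S' : Finset (Finset α)} (h : S ⊆ S') (e : Finset α) : cnt S e ≤ cnt S' e :=
  card_le_card (filter_subset_filter _ h)

/-- If the edge count in `S` agrees and `T` is a face of `S` outside of the tetrahedron. -/
lemma Sp.other {V : Finset α} {S : Finset (Finset α)} (h : Sp V S) {X : Finset α} (hX : X.card = 4)
    {e : Finset α} (he : e.card = 2) {T T0 : Finset α} (hT : T ∈ S) (hTX : T ∉ tet X) (heT : e ⊆ T)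
    (hT0 : T0 ∈ S) (hT0X : T0 ∈ tet X) (heT0 : e ⊆ T0) :
    ∃ T1 ∈ S ∆ tet X, T1 ∈ tet X ∧ e ⊆ T1 := by
  by_contra hcon
  push Not at hcon
  have h1 : (tet X).filter (fun T => e ⊆ T) ⊆ (S.filter (fun T => e ⊆ T)).erase T := by
    intro U hU
    rw [mem_filter] at hU
    rw [mem_erase, mem_filter]
    refine ⟨?_, ?_, hU.2⟩
    · rintro rfl; exact hTX hU.1
    · by_contra hUS
      exact hcon U (mem_symmDiff.2 (Or.inr ⟨hU.1, hUS⟩)) hU.1 hU.2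
  have h2 := card_le_card h1
  rw [card_erase_of_mem (by simp [hT, heT])] at h2
  have h3 := cnt_tet hX he (heT0.trans (mem_tet.1 hT0X).1)
  have h4 := h.two e he ⟨T, hT, heT⟩
  unfold cnt at h3 h4
  omega

lemma two_move {V : Finset α} {S : Finset (Finset α)} (h : Sp V S) {X : Finset α}
    (hX : X.card = 4)
    (hedge : ∀ e ⊆ X, e.card = 2 → (∃ T ∈ S, e ⊆ T) → ∃ T ∈ S, T ∈ tet X ∧ e ⊆ T)
    (e : Finset α) (he : e.card = 2) (hT : ∃ T ∈ S ∆ tet X, e ⊆ T) : cnt (S ∆ tet X) e = 2 := by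
  have h1 := cnt_symmDiff S (tet X) e
  have h0 : 0 < cnt (S ∆ tet X) e := cnt_pos.2 hT
  have hS : cnt S e = 0 ∨ cnt S e = 2 := by
    by_cases hh : ∃ T ∈ S, e ⊆ T
    · exact Or.inr (h.two e he hh)
    · left; have := mt cnt_pos.1 hh; omega
  have hle : cnt (S ∩ tet X) e ≤ cnt S e := cnt_mono inter_subset_left e
  have hle' : cnt (S ∩ tet X) e ≤ cnt (tet X) e := cnt_mono inter_subset_right e
  by_cases heX : e ⊆ X
  · have h2 := cnt_tet hX he heX
    have h3 : 0 < cnt S e → 0 < cnt (S ∩ tet X) e := by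
      intro hp
      obtain ⟨T, hTS, hTX, heT⟩ := hedge e heX he (cnt_pos.1 hp)
      exact cnt_pos.2 ⟨T, mem_inter.2 ⟨hTS, hTX⟩, heT⟩
    omega
  · have h2 := cnt_tet_zero heX
    omega

lemma tet_meet {X T T' : Finset α} (hX : X.card = 4) {u : α} (hT : T ∈ tet X) (hT' : T' ∈ tet X)
    (hu : u ∈ T) (hu' : u ∈ T') : ∃ a, a ≠ u ∧ a ∈ T ∧ a ∈ T' := by
  obtain ⟨h1, h2⟩ := mem_tet.1 hT
  obtain ⟨h3, h4⟩ := mem_tet.1 hT'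
  have h5 := card_union_add_card_inter T T'
  have h6 := card_le_card (union_subset h1 h3)
  obtain ⟨a, ha, hau⟩ := exists_mem_ne (s := T ∩ T') (by omega) u
  exact ⟨a, hau, (mem_inter.1 ha).1, (mem_inter.1 ha).2⟩

lemma move {V V' : Finset α} {S : Finset (Finset α)} (h : Sp V S) {X : Finset α}
    (hX : X.card = 4)
    (hedge : ∀ e ⊆ X, e.card = 2 → (∃ T ∈ S, e ⊆ T) → ∃ T ∈ S, T ∈ tet X ∧ e ⊆ T)
    (hsub : ∀ T ∈ S ∆ tet X, T ⊆ V') (hcov : ∀ v ∈ V', ∃ T ∈ S ∆ tet X, v ∈ T)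
    (hV : V' ⊆ V ∪ X) 
    (hlk : ∀ u ∈ V', u ∈ X → (∃ T ∈ S, T ∈ tet X ∧ u ∈ T) ∨ u ∉ V)
    (r : α) (hrV : r ∈ V) (hrV' : r ∈ V')
    (hr : ∀ a ∈ X, a ∈ V' → ∃ T ∈ S ∆ tet X, a ∈ T ∧ r ∈ T)
    (hchi : (S ∆ tet X).card + 4 = 2 * V'.card) : Sp V' (S ∆ tet X) where
  tri T hT := by
    rcases mem_symmDiff.1 hT with hh | hh
    · exact h.tri T hh.1
    · exact (mem_tet.1 hh.1).2
  sub := hsub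
  cov := hcov
  two := two_move h hX hedge
  chi := hchi
  lnk := by
    intro u hu q hq T hT T' hT' huT huT' hqT
    by_cases huV : u ∈ V
    swap
    · have hall : ∀ U ∈ S ∆ tet X, u ∈ U → U ∈ tet X := by
        intro U hU huU
        rcases mem_symmDiff.1 hU with hh | hh
        · exact absurd (h.sub U hh.1 huU) huV
        · exact hh.1
      obtain ⟨a, ha1, ha2, ha3⟩ := tet_meet hX (hall T hT huT) (hall T' hT' huT') huT huT'
      exact hq T hT T' hT' huT huT' a ha1 ha2 ha3 hqT
    have hD : ∀ U ∈ S ∆ tet X, U ∈ tet X → u ∈ U → 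
        ((∃ U' ∈ S ∆ tet X, U' ∈ tet X ∧ u ∈ U' ∧ q U') ↔ q U) := by
      intro U hU hUX huU
      constructor
      · rintro ⟨U', hU', hUX', huU', hq'⟩
        obtain ⟨a, ha1, ha2, ha3⟩ := tet_meet hX hUX' hUX huU' huU
        exact hq U' hU' U hU huU' huU a ha1 ha2 ha3 hq'
      · intro hq'
        exact ⟨U, hU, hUX, huU, hq'⟩
    set c := ∃ U' ∈ S ∆ tet X, U' ∈ tet X ∧ u ∈ U' ∧ q U' with hc
    have key := h.lnk u huV (fun U => if U ∈ tet X then c else q U) (by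
      intro U hU U' hU' huU huU' a hau haU haU'
      by_cases h1 : U ∈ tet X <;> by_cases h2 : U' ∈ tet X <;> simp only [h1, h2, if_true, if_false]
      · exact id
      · obtain ⟨T1, hT1, hT1X, heT1⟩ := h.other hX (card_pair hau) hU' h2 (by simp [insert_subset_iff, *])
          hU h1 (by simp [insert_subset_iff, *])
        simp only [insert_subset_iff, singleton_subset_iff] at heT1
        rw [hD T1 hT1 hT1X heT1.2]
        exact hq T1 hT1 U' (mem_symmDiff.2 (Or.inl ⟨hU', h2⟩)) heT1.2 huU' a hau heT1.1 haU'
      · obtain ⟨T1, hT1, hT1X, heT1⟩ := h.other hX (card_pair hau) hU h1 (by simp [insert_subset_iff, *])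
          hU' h2 (by simp [insert_subset_iff, *])
        simp only [insert_subset_iff, singleton_subset_iff] at heT1
        rw [hD T1 hT1 hT1X heT1.2]
        exact hq U (mem_symmDiff.2 (Or.inl ⟨hU, h1⟩)) T1 hT1 huU heT1.2 a hau haU heT1.1
      · exact hq U (mem_symmDiff.2 (Or.inl ⟨hU, h1⟩)) U' (mem_symmDiff.2 (Or.inl ⟨hU', h2⟩)) huU huU' 
          a hau haU haU')
    have hex : ∀ U ∈ S ∆ tet X, u ∈ U → ∃ W ∈ S, u ∈ W ∧ ((if W ∈ tet X then c else q W) ↔ q U) := by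
      intro U hU huU
      by_cases h1 : U ∈ tet X
      · obtain ⟨W, hW, hWX, huW⟩ := (hlk u hu ((mem_tet.1 h1).1 huU)).resolve_right (not_not.2 huV)
        refine ⟨W, hW, huW, ?_⟩
        rw [if_pos hWX]
        exact hD U hU h1 huU
      · rcases mem_symmDiff.1 hU with hh | hh
        · exact ⟨U, hh.1, huU, by rw [if_neg h1]⟩
        · exact absurd hh.1 h1
    obtain ⟨W, hW, huW, hWq⟩ := hex T hT huT
    obtain ⟨W', hW', huW', hWq'⟩ := hex T' hT' huT'
    exact hWq'.1 (key W hW W' hW' huW huW' (hWq.2 hqT))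
  con := by
    intro p hp
    have hpr : ∀ a ∈ X, a ∈ V' → (p a ↔ p r) := by
      intro a ha ha'
      obtain ⟨T, hT, haT, hrT⟩ := hr a ha ha'
      exact ⟨hp T hT a haT r hrT, hp T hT r hrT a haT⟩
    have key := h.con (fun a => if a ∈ V' then p a else p r) (by
      intro T hT a ha b hb
      by_cases hTX : T ∈ tet X
      · have : ∀ x ∈ T, ((if x ∈ V' then p x else p r) ↔ p r) := by
          intro x hx
          split_ifs with hxV
          · exact hpr x ((mem_tet.1 hTX).1 hx) hxV
          · rfl
        rw [this a ha, this b hb]; exact id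
      · have hT' : T ∈ S ∆ tet X := mem_symmDiff.2 (Or.inl ⟨hT, hTX⟩)
        rw [if_pos (hsub T hT' ha), if_pos (hsub T hT' hb)]
        exact hp T hT' a ha b hb)
    have hall : ∀ a ∈ V', (p a ↔ p r) := by
      intro a ha
      rcases mem_union.1 (hV ha) with h1 | h1
      · have k1 := key a h1 r hrV
        have k2 := key r hrV a h1
        rw [if_pos ha, if_pos hrV'] at k1 k2
        exact ⟨k1, k2⟩
      · exact hpr a h1 ha
    intro a ha b hb
    rw [hall a ha, hall b hb]; exact id

end Moves

section Moves2

variable {α : Type*} [DecidableEq α]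

/-- Four distinct elements. -/
structure Ne4 (a b c d : α) : Prop where
  ab : a ≠ b
  ac : a ≠ c
  ad : a ≠ d
  bc : b ≠ c
  bd : b ≠ d
  cd : c ≠ d

lemma Ne4.card {a b c d : α} (h : Ne4 a b c d) : ({a, b, c, d} : Finset α).card = 4 := by
  obtain ⟨h1, h2, h3, h4, h5, h6⟩ := h
  rw [card_insert_of_notMem (by simp [*]), card_insert_of_notMem (by simp [*]), card_pair h6]

lemma card_three {a b c : α} (h1 : a ≠ b) (h2 : a ≠ c) (h3 : b ≠ c) :
    ({a, b, c} : Finset α).card = 3 := by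
  rw [card_insert_of_notMem (by simp [*]), card_pair h3]

lemma ne_of_card_three {a b c : α} (h : ({a, b, c} : Finset α).card = 3) :
    a ≠ b ∧ a ≠ c ∧ b ≠ c := by
  refine ⟨?_, ?_, ?_⟩ <;> rintro rfl
  · have := card_le_two (a := a) (b := c); simp at h; omega
  · have : ({a, b, a} : Finset α) = {a, b} := by ext; simp; tauto
    rw [this] at h; have := card_le_two (a := a) (b := b); omega
  · have := card_le_two (a := a) (b := b); simp at h; omega

lemma Ne4.tet {a b c d : α} (h : Ne4 a b c d) (T : Finset α) : T ∈ tet {a, b, c, d} ↔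
    T = {a, b, c} ∨ T = {a, b, d} ∨ T = {a, c, d} ∨ T = {b, c, d} := by
  have h4 := h.card
  rw [mem_tet]
  constructor
  · rintro ⟨h1, h2⟩
    have h5 : (({a, b, c, d} : Finset α) \ T).card = 1 := by rw [card_sdiff_of_subset h1]; omega
    obtain ⟨x, hx⟩ := card_eq_one.1 h5
    have hT : T = ({a, b, c, d} : Finset α).erase x := by
      rw [← sdiff_singleton_eq_erase, ← hx, Finset.sdiff_sdiff_eq_self h1]
    have hx' : x ∈ ({a, b, c, d} : Finset α) := by
      have : x ∈ ({a, b, c, d} : Finset α) \ T := by simp [hx]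
      exact (mem_sdiff.1 this).1
    obtain ⟨h1, h2, h3, h4, h5, h6⟩ := h
    simp only [mem_insert, mem_singleton] at hx'
    rcases hx' with rfl | rfl | rfl | rfl
    · refine Or.inr (Or.inr (Or.inr ?_)); rw [hT]; ext y; simp; grind
    · refine Or.inr (Or.inr (Or.inl ?_)); rw [hT]; ext y; simp; grind
    · refine Or.inr (Or.inl ?_); rw [hT]; ext y; simp; grind
    · refine Or.inl ?_; rw [hT]; ext y; simp; grind
  · obtain ⟨h1, h2, h3, h4, h5, h6⟩ := h
    rintro (rfl | rfl | rfl | rfl)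
    · exact ⟨by intro y; simp; tauto, card_three h1 h2 h4⟩
    · exact ⟨by intro y; simp; tauto, card_three h1 h3 h5⟩
    · exact ⟨by intro y; simp; tauto, card_three h2 h3 h6⟩
    · exact ⟨by intro y; simp; tauto, card_three h4 h5 h6⟩

lemma card_tet {X : Finset α} (h : X.card = 4) : (tet X).card = 4 := by
  rw [tet, card_powersetCard, h]; rfl

lemma Sp.ne {V : Finset α} {S : Finset (Finset α)} (h : Sp V S) {a b c : α}
    (hS : {a, b, c} ∈ S) : a ≠ b ∧ a ≠ c ∧ b ≠ c := ne_of_card_three (h.tri _ hS)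

lemma Sp.flip {V : Finset α} {S : Finset (Finset α)} (h : Sp V S) {a b c w : α}
    (h1 : {a, b, c} ∈ S) (h2 : {a, b, w} ∈ S) (hcw : c ≠ w)
    (hn : ¬ ∃ T ∈ S, c ∈ T ∧ w ∈ T) : Ne4 a b c w ∧ S ∩ tet {a, b, c, w} = {{a, b, c}, {a, b, w}} ∧
    Sp V (S ∆ tet {a, b, c, w}) := by
  have n1 := h.ne h1
  have n2 := h.ne h2
  have n4 : Ne4 a b c w := ⟨n1.1, n1.2.1, n2.2.1, n1.2.2, n2.2.2, hcw⟩
  have m3 : ({a, c, w} : Finset α) ∉ S := fun hh => hn ⟨_, hh, by simp, by simp⟩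
  have m4 : ({b, c, w} : Finset α) ∉ S := fun hh => hn ⟨_, hh, by simp, by simp⟩
  have hXV : ({a, b, c, w} : Finset α) ⊆ V := by
    have i1 := h.sub _ h1
    have i2 := h.sub _ h2
    simp only [insert_subset_iff, singleton_subset_iff] at i1 i2 ⊢
    tauto
  have m3' : ({a, c, w} : Finset α) ∈ S ∆ tet {a, b, c, w} :=
    mem_symmDiff.2 (Or.inr ⟨(n4.tet _).2 (by tauto), m3⟩)
  have m4' : ({b, c, w} : Finset α) ∈ S ∆ tet {a, b, c, w} :=
    mem_symmDiff.2 (Or.inr ⟨(n4.tet _).2 (by tauto), m4⟩)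
  have hI : S ∩ tet {a, b, c, w} = {{a, b, c}, {a, b, w}} := by
    ext T
    rw [mem_inter, n4.tet, mem_insert, mem_singleton]
    constructor
    · rintro ⟨hT, rfl | rfl | rfl | rfl⟩ <;> tauto
    · rintro (rfl | rfl) <;> tauto
  have hr : ∀ u ∈ ({a, b, c, w} : Finset α), ∃ T ∈ S ∆ tet {a, b, c, w}, u ∈ T ∧ c ∈ T := by
    intro u hu
    simp only [mem_insert, mem_singleton] at hu
    rcases hu with rfl | rfl | rfl | rfl
    · exact ⟨_, m3', by simp, by simp⟩
    · exact ⟨_, m4', by simp, by simp⟩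
    · exact ⟨_, m3', by simp, by simp⟩
    · exact ⟨_, m3', by simp, by simp⟩
  refine ⟨n4, hI, move h n4.card ?_ ?_ ?_ subset_union_left ?_ c (hXV (by simp)) (hXV (by simp)) 
    (fun a ha _ => hr a ha) ?_⟩
  · rintro e heX he ⟨T, hT, heT⟩
    by_cases hce : c ∈ e
    · have hwe : w ∉ e := fun hwe => hn ⟨T, hT, heT hce, heT hwe⟩
      refine ⟨_, h1, (n4.tet _).2 (by tauto), fun x hx => ?_⟩
      have := heX hx
      simp only [mem_insert, mem_singleton] at this ⊢
      rcases this with rfl | rfl | rfl | rfl <;> tauto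
    · refine ⟨_, h2, (n4.tet _).2 (by tauto), fun x hx => ?_⟩
      have := heX hx
      simp only [mem_insert, mem_singleton] at this ⊢
      rcases this with rfl | rfl | rfl | rfl <;> tauto
  · intro T hT
    rcases mem_symmDiff.1 hT with hh | hh
    · exact h.sub T hh.1
    · exact (mem_tet.1 hh.1).1.trans hXV
  · intro u hu
    obtain ⟨T, hT, huT⟩ := h.cov u hu
    by_cases hTX : T ∈ tet {a, b, c, w}
    · obtain ⟨T, hT, h1, _⟩ := hr u ((mem_tet.1 hTX).1 huT)
      exact ⟨T, hT, h1⟩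
    · exact ⟨T, mem_symmDiff.2 (Or.inl ⟨hT, hTX⟩), huT⟩
  · intro u _ hu
    left
    simp only [mem_insert, mem_singleton] at hu
    rcases hu with rfl | rfl | rfl | rfl
    · exact ⟨_, h1, (n4.tet _).2 (by tauto), by simp⟩
    · exact ⟨_, h1, (n4.tet _).2 (by tauto), by simp⟩
    · exact ⟨_, h1, (n4.tet _).2 (by tauto), by simp⟩
    · exact ⟨_, h2, (n4.tet _).2 (by tauto), by simp⟩
  · have k1 := card_symmDiff' S (tet {a, b, c, w})
    rw [hI, card_pair, card_tet n4.card] at k1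
    · have := h.chi; omega
    · intro hh
      have : c ∈ ({a, b, w} : Finset α) := hh ▸ (by simp)
      simp [n4.cd, n4.ac.symm, n4.bc.symm] at this

lemma Sp.insert {V : Finset α} {S : Finset (Finset α)} (h : Sp V S) {v a b c : α}
    (h1 : {a, b, c} ∈ S) (hv : v ∉ V) : Ne4 v a b c ∧ S ∩ tet {v, a, b, c} = {{a, b, c}} ∧
    Sp (insert v V) (S ∆ tet {v, a, b, c}) := by
  have n1 := h.ne h1
  have i1 := h.sub _ h1
  simp only [insert_subset_iff, singleton_subset_iff] at i1
  have n4 : Ne4 v a b c := ⟨by rintro rfl; tauto, by rintro rfl; tauto, by rintro rfl; tauto,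
    n1.1, n1.2.1, n1.2.2⟩
  have hvS : ∀ T ∈ S, v ∉ T := fun T hT hvT => hv (h.sub T hT hvT)
  have m3 : ({v, a, b} : Finset α) ∈ S ∆ tet {v, a, b, c} :=
    mem_symmDiff.2 (Or.inr ⟨(n4.tet _).2 (by tauto), fun hh => hvS _ hh (by simp)⟩)
  have m4 : ({v, a, c} : Finset α) ∈ S ∆ tet {v, a, b, c} :=
    mem_symmDiff.2 (Or.inr ⟨(n4.tet _).2 (by tauto), fun hh => hvS _ hh (by simp)⟩)
  have hI : S ∩ tet {v, a, b, c} = {{a, b, c}} := by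
    ext T
    rw [mem_inter, n4.tet, mem_singleton]
    constructor
    · rintro ⟨hT, rfl | rfl | rfl | rfl⟩
      · exact absurd (by simp) (hvS _ hT)
      · exact absurd (by simp) (hvS _ hT)
      · exact absurd (by simp) (hvS _ hT)
      · rfl
    · rintro rfl; tauto
  have hr : ∀ u ∈ ({v, a, b, c} : Finset α), ∃ T ∈ S ∆ tet {v, a, b, c}, u ∈ T ∧ a ∈ T := by
    intro u hu
    simp only [mem_insert, mem_singleton] at hu
    rcases hu with rfl | rfl | rfl | rfl
    · exact ⟨_, m3, by simp, by simp⟩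
    · exact ⟨_, m3, by simp, by simp⟩
    · exact ⟨_, m3, by simp, by simp⟩
    · exact ⟨_, m4, by simp, by simp⟩
  have hXV : ({v, a, b, c} : Finset α) ⊆ Insert.insert v V := by
    simp only [insert_subset_iff, singleton_subset_iff, mem_insert]
    tauto
  refine ⟨n4, hI, move h n4.card ?_ ?_ ?_ ?_ ?_ a i1.1 (by simp [i1.1]) 
    (fun a ha _ => hr a ha) ?_⟩
  · rintro e heX he ⟨T, hT, heT⟩
    refine ⟨_, h1, (n4.tet _).2 (by tauto), fun x hx => ?_⟩
    have := heX hx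
    rw [mem_insert] at this
    rcases this with rfl | hh
    · exact absurd (heT hx) (hvS T hT)
    · exact hh
  · intro T hT
    rcases mem_symmDiff.1 hT with hh | hh
    · exact (h.sub T hh.1).trans (subset_insert _ _)
    · exact (mem_tet.1 hh.1).1.trans hXV
  · intro u hu
    by_cases huX : u ∈ ({v, a, b, c} : Finset α)
    · obtain ⟨T, hT, h1, _⟩ := hr u huX
      exact ⟨T, hT, h1⟩
    have huv : u ≠ v := by rintro rfl; simp at huX
    obtain ⟨T, hT, huT⟩ := h.cov u (mem_of_mem_insert_of_ne hu huv)
    exact ⟨T, mem_symmDiff.2 (Or.inl ⟨hT, fun hh => huX ((mem_tet.1 hh).1 huT)⟩), huT⟩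
  · intro u hu
    simp only [mem_insert, mem_union, mem_singleton] at hu ⊢; tauto
  · intro u _ hu
    rw [mem_insert] at hu
    rcases hu with rfl | hu
    · exact Or.inr hv
    · exact Or.inl ⟨_, h1, (n4.tet _).2 (by tauto), hu⟩
  · have k1 := card_symmDiff' S (tet {v, a, b, c})
    rw [hI, card_singleton, card_tet n4.card] at k1
    rw [card_insert_of_notMem hv]
    have := h.chi; omega

lemma Sp.remove {V : Finset α} {S : Finset (Finset α)} (h : Sp V S) {v a b c : α} (n4 : Ne4 v a b c)
    (h1 : {v, a, b} ∈ S) (h2 : {v, a, c} ∈ S) (h3 : {v, b, c} ∈ S) (h4 : {a, b, c} ∉ S)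
    (hst : ∀ T ∈ S, v ∈ T → T ∈ tet {v, a, b, c}) :
    S ∩ tet {v, a, b, c} = {{v, a, b}, {v, a, c}, {v, b, c}} ∧
    Sp (V.erase v) (S ∆ tet {v, a, b, c}) := by
  have i1 := h.sub _ h1
  have i2 := h.sub _ h2
  simp only [insert_subset_iff, singleton_subset_iff] at i1 i2
  have m : ({a, b, c} : Finset α) ∈ S ∆ tet {v, a, b, c} :=
    mem_symmDiff.2 (Or.inr ⟨(n4.tet _).2 (by tauto), h4⟩)
  have hI : S ∩ tet {v, a, b, c} = {{v, a, b}, {v, a, c}, {v, b, c}} := by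
    ext T
    rw [mem_inter, n4.tet]
    simp only [mem_insert, mem_singleton]
    constructor
    · rintro ⟨hT, rfl | rfl | rfl | rfl⟩ <;> tauto
    · rintro (rfl | rfl | rfl) <;> tauto
  have hr : ∀ u ∈ ({v, a, b, c} : Finset α), u ≠ v → u ∈ ({a, b, c} : Finset α) := by
    intro u hu; rw [mem_insert] at hu; tauto
  refine ⟨hI, move h n4.card ?_ ?_ ?_ ?_ ?_ a i1.2.1 (by simp [i1.2.1, n4.ab.symm]) 
    (fun x hx hx' => ⟨_, m, hr x hx (ne_of_mem_erase hx'), by simp⟩) ?_⟩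
  · rintro e heX he -
    by_cases ha : a ∈ e
    · by_cases hb : b ∈ e
      · have hc : c ∉ e := by
          intro hc
          have : ({a, b, c} : Finset α) ⊆ e := by simp [insert_subset_iff, *]
          have := card_le_card this
          rw [card_three n4.bc n4.bd n4.cd] at this
          omega
        refine ⟨_, h1, (n4.tet _).2 (by tauto), fun x hx => ?_⟩
        have := heX hx
        simp only [mem_insert, mem_singleton] at this ⊢
        rcases this with rfl | rfl | rfl | rfl <;> tauto
      · refine ⟨_, h2, (n4.tet _).2 (by tauto), fun x hx => ?_⟩
        have := heX hx
        simp only [mem_insert, mem_singleton] at this ⊢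
        rcases this with rfl | rfl | rfl | rfl <;> tauto
    · refine ⟨_, h3, (n4.tet _).2 (by tauto), fun x hx => ?_⟩
      have := heX hx
      simp only [mem_insert, mem_singleton] at this ⊢
      rcases this with rfl | rfl | rfl | rfl <;> tauto
  · intro T hT
    rcases mem_symmDiff.1 hT with hh | hh
    · exact subset_erase.2 ⟨h.sub T hh.1, fun hv => hh.2 (hst T hh.1 hv)⟩
    · rcases (n4.tet T).1 hh.1 with rfl | rfl | rfl | rfl
      · exact absurd h1 hh.2
      · exact absurd h2 hh.2
      · exact absurd h3 hh.2
      · simp [insert_subset_iff, n4.ab.symm, n4.ac.symm, n4.ad.symm, i1, i2]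
  · intro u hu
    rw [mem_erase] at hu
    obtain ⟨T, hT, huT⟩ := h.cov u hu.2
    by_cases hTX : T ∈ tet {v, a, b, c}
    · exact ⟨_, m, hr u ((mem_tet.1 hTX).1 huT) hu.1⟩
    · exact ⟨T, mem_symmDiff.2 (Or.inl ⟨hT, hTX⟩), huT⟩
  · exact (erase_subset _ _).trans subset_union_left
  · intro u _ hu
    left
    simp only [mem_insert, mem_singleton] at hu
    rcases hu with rfl | rfl | rfl | rfl
    · exact ⟨_, h1, (n4.tet _).2 (by tauto), by simp⟩
    · exact ⟨_, h1, (n4.tet _).2 (by tauto), by simp⟩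
    · exact ⟨_, h1, (n4.tet _).2 (by tauto), by simp⟩
    · exact ⟨_, h2, (n4.tet _).2 (by tauto), by simp⟩
  · have k1 := card_symmDiff' S (tet {v, a, b, c})
    rw [hI, card_three, card_tet n4.card] at k1
    · rw [card_erase_of_mem i1.1]
      have := h.chi
      have : 0 < V.card := card_pos.2 ⟨v, i1.1⟩
      omega
    · intro hh
      have : b ∈ ({v, a, c} : Finset α) := hh ▸ (by simp)
      simp [n4.cd, n4.ac.symm, n4.bc.symm] at this
    · intro hh
      have : a ∈ ({v, b, c} : Finset α) := hh ▸ (by simp)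
      simp [n4.bd, n4.ab.symm, n4.bc] at this
    · intro hh
      have : a ∈ ({v, b, c} : Finset α) := hh ▸ (by simp)
      simp [n4.bd, n4.ab.symm, n4.bc] at this

end Moves2

section Star

variable {α : Type*} [DecidableEq α] {V : Finset α} {S : Finset (Finset α)}

lemma pair_subset' {a b : α} {T : Finset α} : ({a, b} : Finset α) ⊆ T ↔ a ∈ T ∧ b ∈ T := by
  simp [insert_subset_iff]

lemma Sp.next (h : Sp V S) {v a b : α} (hS : {v, a, b} ∈ S) :
    ∃ c, c ≠ b ∧ {v, a, c} ∈ S ∧ ∀ T ∈ S, v ∈ T → a ∈ T → T = {v, a, b} ∨ T = {v, a, c} := by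
  obtain ⟨n1, n2, n3⟩ := h.ne hS
  have h2 := h.two {v, a} (card_pair n1) ⟨_, hS, by simp [pair_subset']⟩
  have h3 : ({v, a, b} : Finset α) ∈ S.filter (fun T => ({v, a} : Finset α) ⊆ T) := by
    simp [pair_subset', hS]
  have h4 : ((S.filter (fun T => ({v, a} : Finset α) ⊆ T)).erase {v, a, b}).card = 1 := by
    rw [card_erase_of_mem h3]; unfold cnt at h2; omega
  obtain ⟨T', hT'⟩ := card_eq_one.1 h4
  have h5 : T' ∈ (S.filter (fun T => ({v, a} : Finset α) ⊆ T)).erase {v, a, b} := by simp [hT']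
  rw [mem_erase, mem_filter, pair_subset'] at h5
  obtain ⟨c, hc1, hc2, rfl⟩ := eq_triple (h.tri T' h5.2.1) h5.2.2.1 h5.2.2.2 n1.symm
  refine ⟨c, by rintro rfl; exact h5.1 rfl, h5.2.1, fun T hT h6 h7 => ?_⟩
  by_cases hh : T = {v, a, b}
  · exact Or.inl hh
  · right
    have : T ∈ (S.filter (fun T => ({v, a} : Finset α) ⊆ T)).erase {v, a, b} := by
      rw [mem_erase, mem_filter, pair_subset']; exact ⟨hh, hT, h6, h7⟩
    rw [hT'] at this
    exact mem_singleton.1 this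

lemma Sp.star (h : Sp V S) {v : α} (hv : v ∈ V) :
    (∃ a b c, Ne4 v a b c ∧ {v, a, b} ∈ S ∧ {v, a, c} ∈ S ∧ {v, b, c} ∈ S ∧
      ∀ T ∈ S, v ∈ T → T ∈ tet {v, a, b, c}) ∨
    ∃ a b c d, Ne4 a b c d ∧ {v, a, b} ∈ S ∧ {v, b, c} ∈ S ∧ {v, c, d} ∈ S := by
  obtain ⟨T, hT, hvT⟩ := h.cov v hv
  obtain ⟨a, ha, hav⟩ := exists_mem_ne (s := T) (by rw [h.tri T hT]; norm_num) v
  obtain ⟨b, hb1, hb2, rfl⟩ := eq_triple (h.tri T hT) hvT ha hav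
  obtain ⟨c, hcb, hc, hc'⟩ := h.next hT
  rw [pair_comm] at hT
  obtain ⟨d, hda, hd, hd'⟩ := h.next hT
  have n1 := h.ne hT
  have n2 := h.ne hc
  have n3 := h.ne hd
  by_cases hcd : c = d
  · subst hcd
    left
    have n4 : Ne4 v a b c := ⟨n1.2.1, n1.1, n2.2.1, hb2.symm, hda.symm, hcb.symm⟩
    refine ⟨a, b, c, n4, by rwa [pair_comm], hc, hd, ?_⟩
    obtain ⟨e, he, he1, he2⟩ := h.next (show ({v, c, a} : Finset α) ∈ S by rwa [pair_comm])
    have heb : e = b := by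
      rcases he2 {v, b, c} hd (by simp) (by simp) with h1 | h1
      · have : b ∈ ({v, c, a} : Finset α) := h1 ▸ (by simp)
        simp at this; tauto
      · have : b ∈ ({v, c, e} : Finset α) := h1 ▸ (by simp)
        simp at this; rcases this with h | h | h
        · tauto
        · exact absurd h.symm hcb
        · exact h.symm
    subst heb
    intro T' hT' hvT'
    refine h.lnk v hv (fun T => T ∈ tet {v, a, e, c}) ?_ _ hT T' hT' (by simp) hvT' ?_
    · intro U hU U' hU' hvU hvU' x hxv hxU hxU' hq
      have hx := (mem_tet.1 hq).1 hxU
      have k1 : ({v, e, a} : Finset α) = {v, a, e} := by rw [pair_comm]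
      have k2 : ({v, c, a} : Finset α) = {v, a, c} := by rw [pair_comm]
      have k3 : ({v, c, e} : Finset α) = {v, e, c} := by rw [pair_comm]
      rw [n4.tet]
      simp only [mem_insert, mem_singleton] at hx
      rcases hx with rfl | rfl | rfl | rfl
      · exact absurd rfl hxv
      · rcases hc' U' hU' hvU' hxU' with h | h <;> simp [h]
      · rcases hd' U' hU' hvU' hxU' with h | h <;> simp [h, k1]
      · rcases he2 U' hU' hvU' hxU' with h | h <;> simp [h, k2, k3]
    · rw [n4.tet, pair_comm]; exact Or.inl rfl
  · right
    refine ⟨c, a, b, d, ⟨n2.2.2.symm, hcb, hcd, hb2.symm, hda.symm, n3.2.2⟩, ?_, ?_, hd⟩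
    · rwa [pair_comm]
    · rwa [pair_comm]

lemma cnt_ge {A : Finset (Finset α)} (e : Finset α) (h1 : A ⊆ S) (h2 : ∀ T ∈ A, e ⊆ T) : A.card ≤ cnt S e :=
  card_le_card fun T hT => mem_filter.2 ⟨h1 hT, h2 T hT⟩

lemma cnt_single (u : α) : cnt S {u} = (S.filter fun T => u ∈ T).card := by
  unfold cnt; simp

lemma deg_tet {X : Finset α} (hX : X.card = 4) (u : α) :
    cnt (tet X) {u} = if u ∈ X then 3 else 0 := by
  split_ifs with hu
  · have : ((tet X).filter fun T => u ∈ T) = (tet X).erase (X.erase u) := by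
      ext T
      rw [mem_filter, mem_erase, mem_tet]
      constructor
      · rintro ⟨h1, h2⟩
        exact ⟨by rintro rfl; simp at h2, h1⟩
      · rintro ⟨h1, h2⟩
        refine ⟨h2, ?_⟩
        by_contra huT
        apply h1
        apply eq_of_subset_of_card_le (subset_erase.2 ⟨h2.1, huT⟩)
        rw [card_erase_of_mem hu]; omega
    rw [cnt_single, this, card_erase_of_mem, card_tet hX]
    rw [mem_tet]
    exact ⟨erase_subset _ _, by rw [card_erase_of_mem hu]; omega⟩
  · exact cnt_tet_zero (by simpa using hu)

/-- Degree three vertices. -/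
lemma Sp.star3 (h : Sp V S) {v : α} (hv : v ∈ V) (hd : cnt S {v} ≤ 3) :
    ∃ a b c, Ne4 v a b c ∧ {v, a, b} ∈ S ∧ {v, a, c} ∈ S ∧ {v, b, c} ∈ S ∧
      ∀ T ∈ S, v ∈ T → T ∈ tet {v, a, b, c} := by
  rcases h.star hv with h1 | ⟨a, b, c, d, n4, h1, h2, h3⟩
  · exact h1
  exfalso
  obtain ⟨x, hx1, hx2, -⟩ := h.next (show ({v, d, c} : Finset α) ∈ S by rwa [pair_comm])
  have n1 := h.ne h1
  have n2 := h.ne h2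
  have n3 := h.ne h3
  have n5 := h.ne hx2
  obtain ⟨g1, g2, g3, g4, g5, g6⟩ := n4
  have h4 : ({{v, a, b}, {v, b, c}, {v, c, d}, {v, d, x}} : Finset (Finset α)).card = 4 := by
    apply Ne4.card
    constructor <;> intro hh
    · have := (Finset.ext_iff.1 hh a); simp at this; grind
    · have := (Finset.ext_iff.1 hh a); simp at this; grind
    · have := (Finset.ext_iff.1 hh d); simp at this; grind
    · have := (Finset.ext_iff.1 hh b); simp at this; grind
    · have := (Finset.ext_iff.1 hh d); simp at this; grind
    · have := (Finset.ext_iff.1 hh c); simp at this; grind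
  have h5 := cnt_ge (S := S) {v} (A := {{v, a, b}, {v, b, c}, {v, c, d}, {v, d, x}})
    (by simp [insert_subset_iff, *]) (by simp)
  omega

lemma Sp.deg_ge (h : Sp V S) {v : α} (hv : v ∈ V) : 3 ≤ cnt S {v} := by
  by_contra hlt
  obtain ⟨a, b, c, ⟨g1, g2, g3, g4, g5, g6⟩, h1, h2, h3, -⟩ := h.star3 hv (by omega)
  have h5 := cnt_ge (S := S) {v} (A := {{v, a, b}, {v, a, c}, {v, b, c}})
    (by simp [insert_subset_iff, *]) (by simp)
  rw [card_three] at h5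
  · omega
  · intro hh; have := (Finset.ext_iff.1 hh b); simp at this; grind
  · intro hh; have := (Finset.ext_iff.1 hh a); simp at this; grind
  · intro hh; have := (Finset.ext_iff.1 hh a); simp at this; grind

/-- A sphere containing a tetrahedron. -/
lemma Sp.of_tet (h : Sp V S) {X : Finset α} (hX : X.card = 4) (hS : tet X ⊆ S) : V.card = 4 := by
  have key : ∀ T ∈ S, ∀ x ∈ T, x ∈ X → T ∈ tet X := by
    intro T hT x hxT hxX
    obtain ⟨T0, hT0, hxT0⟩ : ∃ T0 ∈ tet X, x ∈ T0 := by
      have := deg_tet hX x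
      rw [if_pos hxX] at this
      obtain ⟨T, h1, h2⟩ := cnt_pos.1 (by omega : 0 < cnt (tet X) {x})
      exact ⟨T, h1, by simpa using h2⟩
    refine h.lnk x (h.sub T hT hxT) (fun T => T ∈ tet X) ?_ T0 (hS hT0) T hT hxT0 hxT hT0
    intro U hU U' hU' hxU hxU' y hyx hyU hyU' hUX
    have e1 : ({x, y} : Finset α) ⊆ X := pair_subset'.2 ⟨hxX, (mem_tet.1 hUX).1 hyU⟩
    have e2 := cnt_tet hX (card_pair hyx.symm) e1
    have e3 := h.two {x, y} (card_pair hyx.symm) ⟨U, hU, pair_subset'.2 ⟨hxU, hyU⟩⟩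
    have e4 := eq_of_subset_of_card_le (filter_subset_filter (fun T => ({x, y} : Finset α) ⊆ T) hS)
      (by unfold cnt at e2 e3; omega)
    have : U' ∈ S.filter (fun T => ({x, y} : Finset α) ⊆ T) :=
      mem_filter.2 ⟨hU', pair_subset'.2 ⟨hxU', hyU'⟩⟩
    rw [← e4] at this
    exact (mem_filter.1 this).1
  have hXV : X ⊆ V := by
    intro x hx
    have := deg_tet hX x
    rw [if_pos hx] at this
    obtain ⟨T, h1, h2⟩ := cnt_pos.1 (by omega : 0 < cnt (tet X) {x})
    exact h.sub T (hS h1) (by simpa using h2)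
  obtain ⟨x, hx⟩ := card_pos.1 (by omega : 0 < X.card)
  have hVX : V ⊆ X := by
    intro y hy
    refine h.con (fun y => y ∈ X) ?_ x (hXV hx) y hy hx
    intro T hT a ha b hb haX
    exact (mem_tet.1 (key T hT a ha haX)).1 hb
  rw [← hX, subset_antisymm hVX hXV]

lemma Sp.base (h : Sp V S) (hV : V.card = 4) : S = tet V := by
  apply eq_of_subset_of_card_le
  · intro T hT
    exact mem_tet.2 ⟨h.sub T hT, h.tri T hT⟩
  · rw [card_tet hV]; have := h.chi; omega

end Star

section Jordan

variable {α : Type*} [DecidableEq α] {V : Finset α} {S : Finset (Finset α)}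

lemma sum_cycle {a b c : α} (h1 : a ≠ b) (h2 : a ≠ c) (h3 : b ≠ c) (u : α) :
    ∑ e ∈ ({{a, b}, {a, c}, {b, c}} : Finset (Finset α)), (if u ∈ e then (1 : ZMod 2) else 0) = 0 := by
  have d : (1 : ZMod 2) + 1 = 0 := by decide
  rw [sum_insert, sum_insert, sum_singleton]
  · by_cases ha : u = a
    · subst ha; simp [h1, h2, d]
    · by_cases hb : u = b
      · subst hb; simp [h1.symm, h3, d]
      · by_cases hc : u = c
        · subst hc; simp [h2.symm, h3.symm, d]
        · simp [ha, hb, hc]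
  · intro hh
    have := (Finset.ext_iff.1 (mem_singleton.1 hh) a); simp at this; grind
  · intro hh
    simp only [mem_insert, mem_singleton] at hh
    rcases hh with hh | hh
    · have := (Finset.ext_iff.1 hh b); simp at this; grind
    · have := (Finset.ext_iff.1 hh a); simp at this; grind

lemma powersetCard_two {a b c : α} (h1 : a ≠ b) (h2 : a ≠ c) (h3 : b ≠ c) :
    ({a, b, c} : Finset α).powersetCard 2 = {{a, b}, {a, c}, {b, c}} := by
  symm
  apply eq_of_subset_of_card_le
  · simp only [insert_subset_iff, singleton_subset_iff, mem_powersetCard, card_pair h1, card_pair h2,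
      card_pair h3]
    simp
  · rw [card_powersetCard, card_three h1 h2 h3, card_three]
    · rfl
    · intro hh; have := (Finset.ext_iff.1 hh b); simp at this; grind
    · intro hh; have := (Finset.ext_iff.1 hh a); simp at this; grind
    · intro hh; have := (Finset.ext_iff.1 hh a); simp at this; grind

lemma mem_edgesOn (h : Sp V S) {e : Finset α} :
    e ∈ edgesOn V S ↔ e.card = 2 ∧ ∃ T ∈ S, e ⊆ T := by
  unfold edgesOn
  rw [mem_filter, mem_powerset]
  constructor
  · exact fun h => h.2
  · rintro ⟨h1, T, hT, hT2⟩
    exact ⟨hT2.trans (h.sub T hT), h1, T, hT, hT2⟩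

/-- A function on the faces which agrees on the two faces of every edge is constant. -/
lemma Sp.const (h : Sp V S) (q : Finset α → Prop)
    (hq : ∀ e : Finset α, e.card = 2 → ∀ T ∈ S, ∀ T' ∈ S, e ⊆ T → e ⊆ T' → q T → q T') :
    ∀ T ∈ S, ∀ T' ∈ S, q T → q T' := by
  have hst : ∀ v ∈ V, ∀ T ∈ S, ∀ T' ∈ S, v ∈ T → v ∈ T' → q T → q T' := by
    intro v hv
    apply h.lnk v hv q
    intro T hT T' hT' h1 h2 a ha h3 h4
    exact hq {v, a} (card_pair ha.symm) T hT T' hT' (pair_subset'.2 ⟨h1, h3⟩) (pair_subset'.2 ⟨h2, h4⟩)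
  have hne : ∀ T ∈ S, ∃ x, x ∈ T := fun T hT => card_pos.1 (by rw [h.tri T hT]; norm_num)
  intro T hT T' hT' hqT
  obtain ⟨x, hx⟩ := hne T hT
  obtain ⟨y, hy⟩ := hne T' hT'
  have key := h.con (fun u => ∃ U ∈ S, u ∈ U ∧ q U) (by
    rintro U hU a ha b hb ⟨U', hU', haU', hqU'⟩
    exact ⟨U, hU, hb, hst a (h.sub U hU ha) U' hU' U hU haU' ha hqU'⟩) x (h.sub T hT hx)
    y (h.sub T' hT' hy) ⟨T, hT, hx, hqT⟩
  obtain ⟨U, hU, hyU, hqU⟩ := key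
  exact hst y (h.sub T' hT' hy) U hU T' hT' hyU hy hqU

/-- Every triangular cycle bounds a set of faces. -/
lemma Sp.bounds (h : Sp V S) {a b c : α} (h1 : a ≠ b) (h2 : a ≠ c) (h3 : b ≠ c)
    (hC : ({{a, b}, {a, c}, {b, c}} : Finset (Finset α)) ⊆ edgesOn V S) :
    ∃ x : Finset α → ZMod 2, ∀ e ∈ edgesOn V S, ∑ T ∈ S.filter (fun T => e ⊆ T), x T =
      if e ∈ ({{a, b}, {a, c}, {b, c}} : Finset (Finset α)) then 1 else 0 := by
  classical
  set C : Finset (Finset α) := {{a, b}, {a, c}, {b, c}} with hCdef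
  set E := edgesOn V S with hE
  let M2 : Matrix E S (ZMod 2) := fun e T => if e.1 ⊆ T.1 then 1 else 0
  let M1 : Matrix V E (ZMod 2) := fun u e => if u.1 ∈ e.1 then 1 else 0
  have char2 : ∀ s t : ZMod 2, s + t = 0 → s = t := by decide
  have hM2 : ∀ x e, M2.mulVec x e = ∑ T ∈ S.filter (fun T => e.1 ⊆ T),
      (if hT : T ∈ S then x ⟨T, hT⟩ else 0) := by
    intro x e
    rw [sum_filter, ← sum_coe_sort S]
    simp only [Matrix.mulVec, dotProduct, M2]
    refine sum_congr rfl fun T _ => ?_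
    simp
  have h12 : M1 * M2 = 0 := by
    ext u T
    rw [Matrix.mul_apply]
    simp only [M1, M2, mul_ite, mul_one, mul_zero, Matrix.zero_apply]
    rw [sum_coe_sort E (fun e => if e ⊆ T.1 then (if u.1 ∈ e then (1 : ZMod 2) else 0) else 0), ← sum_filter]
    obtain ⟨x, y, z, g1, g2, g3, hT⟩ := card_eq_three.1 (h.tri T.1 T.2)
    have : E.filter (· ⊆ T.1) = {{x, y}, {x, z}, {y, z}} := by
      rw [← powersetCard_two g1 g2 g3, ← hT]
      ext e
      rw [mem_filter, mem_edgesOn h, mem_powersetCard]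
      constructor
      · rintro ⟨⟨e1, -⟩, e2⟩; exact ⟨e2, e1⟩
      · rintro ⟨e2, e1⟩; exact ⟨⟨e1, T.1, T.2, e2⟩, e2⟩
    rw [this]
    exact sum_cycle g1 g2 g3 _
  have k2 : Module.finrank (ZMod 2) (LinearMap.ker M2.mulVecLin) ≤ 1 := by
    refine finrank_le_one ⟨fun _ => 1, ?_⟩ ?_
    · rw [LinearMap.mem_ker, Matrix.mulVecLin_apply]
      ext e
      rw [hM2]
      have : ∀ T ∈ S.filter (fun T => e.1 ⊆ T), (if hT : T ∈ S then (1 : ZMod 2) else 0) = 1 := by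
        intro T hT; rw [dif_pos (mem_filter.1 hT).1]
      rw [sum_congr rfl this, sum_const]
      have e2 := (mem_edgesOn h).1 e.2
      have := h.two e.1 e2.1 e2.2
      unfold cnt at this
      rw [this]; exact (by decide : (2 : ℕ) • (1 : ZMod 2) = 0)
    · rintro ⟨x, hx⟩
      rw [LinearMap.mem_ker, Matrix.mulVecLin_apply] at hx
      obtain ⟨T0, hT0⟩ : S.Nonempty := by
        obtain ⟨T, hT, -⟩ := ((mem_edgesOn h).1 (hC (by simp [hCdef] : ({a, b} : Finset α) ∈ C))).2
        exact ⟨T, hT⟩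
      refine ⟨x ⟨T0, hT0⟩, ?_⟩
      ext T
      simp only [Submodule.coe_smul_of_tower, Pi.smul_apply, smul_eq_mul, mul_one]
      have := h.const (fun T => ∃ hT : T ∈ S, x ⟨T, hT⟩ = x ⟨T0, hT0⟩) ?_ T0 hT0 T.1 T.2 ⟨hT0, rfl⟩
      · exact this.2.symm
      · rintro e he U hU U' hU' heU heU' ⟨_, hq⟩
        refine ⟨hU', ?_⟩
        rw [← hq]
        by_cases hUU : U = U'
        · subst hUU; rfl
        have e2 := h.two e he ⟨U, hU, heU⟩
        have e3 : ({U, U'} : Finset _) = S.filter (fun T => e ⊆ T) := by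
          apply eq_of_subset_of_card_le
          · simp [insert_subset_iff, *]
          · rw [card_pair hUU]; unfold cnt at e2; omega
        have e4 := congrFun hx ⟨e, (mem_edgesOn h).2 ⟨he, U, hU, heU⟩⟩
        rw [hM2] at e4
        simp only [] at e4
        rw [← e3, sum_pair hUU, dif_pos hU, dif_pos hU'] at e4
        exact (char2 _ _ e4).symm
  have k1 : Module.finrank (ZMod 2) (LinearMap.ker M1.transpose.mulVecLin) ≤ 1 := by
    have hM1 : ∀ p e, M1.transpose.mulVec p e = ∑ u ∈ e.1, (if hu : u ∈ V then p ⟨u, hu⟩ else 0) := by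
      intro p e
      have heV : V.filter (· ∈ e.1) = e.1 := by
        obtain ⟨T, hT, hT2⟩ := ((mem_edgesOn h).1 e.2).2
        ext u; simp only [mem_filter]
        exact ⟨fun h => h.2, fun hu => ⟨h.sub T hT (hT2 hu), hu⟩⟩
      conv_rhs => rw [← heV]
      rw [sum_filter, ← sum_coe_sort V]
      simp only [Matrix.mulVec, dotProduct]
      refine sum_congr rfl fun T _ => ?_
      rw [Matrix.transpose_apply]
      simp [M1]
    have haV : a ∈ V := by
      obtain ⟨T, hT, hT2⟩ := ((mem_edgesOn h).1 (hC (by simp [hCdef] : ({a, b} : Finset α) ∈ C))).2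
      exact h.sub T hT (hT2 (by simp))
    refine finrank_le_one ⟨fun _ => 1, ?_⟩ ?_
    · rw [LinearMap.mem_ker, Matrix.mulVecLin_apply]
      ext e
      rw [hM1]
      have e2 := (mem_edgesOn h).1 e.2
      have : ∀ u ∈ e.1, (if hT : u ∈ V then (1 : ZMod 2) else 0) = 1 := by
        obtain ⟨T, hT, hT2⟩ := e2.2
        intro u hu; rw [dif_pos (h.sub T hT (hT2 hu))]
      rw [sum_congr rfl this, sum_const, e2.1]; exact (by decide : (2 : ℕ) • (1 : ZMod 2) = 0)
    · rintro ⟨p, hp⟩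
      rw [LinearMap.mem_ker, Matrix.mulVecLin_apply] at hp
      refine ⟨p ⟨a, haV⟩, ?_⟩
      ext u
      simp only [Submodule.coe_smul_of_tower, Pi.smul_apply, smul_eq_mul, mul_one]
      have := h.con (fun u => ∃ hu : u ∈ V, p ⟨u, hu⟩ = p ⟨a, haV⟩) ?_ a haV u.1 u.2 ⟨haV, rfl⟩
      · exact this.2.symm
      · rintro T hT s hs t ht ⟨hs', hq⟩
        refine ⟨h.sub T hT ht, ?_⟩
        rw [← hq]
        by_cases hst : s = t
        · subst hst; rfl
        have e4 := congrFun hp ⟨{s, t}, (mem_edgesOn h).2 ⟨card_pair hst, T, hT, pair_subset'.2 ⟨hs, ht⟩⟩⟩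
        rw [hM1] at e4
        simp only [] at e4
        rw [sum_pair hst, dif_pos hs', dif_pos (h.sub T hT ht)] at e4
        exact (char2 _ _ e4).symm
  have r2 := LinearMap.finrank_range_add_finrank_ker M2.mulVecLin
  have r1 := LinearMap.finrank_range_add_finrank_ker M1.transpose.mulVecLin
  have r3 := LinearMap.finrank_range_add_finrank_ker M1.mulVecLin
  have r4 : Module.finrank (ZMod 2) (LinearMap.range M1.transpose.mulVecLin) =
    Module.finrank (ZMod 2) (LinearMap.range M1.mulVecLin) := Matrix.rank_transpose M1
  rw [Module.finrank_pi, Fintype.card_coe] at r1 r2 r3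
  have hle : LinearMap.range M2.mulVecLin ≤ LinearMap.ker M1.mulVecLin := by
    rintro _ ⟨x, rfl⟩
    rw [LinearMap.mem_ker, Matrix.mulVecLin_apply, Matrix.mulVecLin_apply, Matrix.mulVec_mulVec, h12,
      Matrix.zero_mulVec]
  have hchi := h.chi
  have hed := card_edges h.tri h.sub h.two
  have heq := Submodule.eq_of_le_of_finrank_le hle (by rw [← hE] at hed; omega)
  have hz : (fun e : E => if e.1 ∈ C then (1 : ZMod 2) else 0) ∈ LinearMap.range M2.mulVecLin := by
    rw [heq, LinearMap.mem_ker, Matrix.mulVecLin_apply]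
    ext u
    simp only [Matrix.mulVec, dotProduct, M1, mul_ite, mul_one, mul_zero, Pi.zero_apply]
    rw [sum_coe_sort E (fun e => if e ∈ C then (if u.1 ∈ e then (1 : ZMod 2) else 0) else 0), ← sum_filter]
    have : E.filter (· ∈ C) = C := by
      ext e; simp only [mem_filter]; exact ⟨fun h => h.2, fun h => ⟨hC h, h⟩⟩
    rw [this]
    exact sum_cycle h1 h2 h3 _
  obtain ⟨x, hx⟩ := hz
  refine ⟨fun T => if hT : T ∈ S then x ⟨T, hT⟩ else 0, fun e he => ?_⟩
  have := congrFun hx ⟨e, he⟩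
  rw [Matrix.mulVecLin_apply, hM2] at this
  exact this

/-- The Jordan curve argument. -/
lemma Sp.jordan (h : Sp V S) {v a b c d : α} (n4 : Ne4 a b c d) (h1 : {v, a, b} ∈ S)
    (h2 : {v, b, c} ∈ S) (h3 : {v, c, d} ∈ S) (hac : ∃ T ∈ S, a ∈ T ∧ c ∈ T)
    (hbd : ∃ T ∈ S, b ∈ T ∧ d ∈ T) : False := by
  have n1 := h.ne h1
  have n2 := h.ne h2
  have n3 := h.ne h3
  obtain ⟨g1, g2, g3, g4, g5, g6⟩ := n4
  have char2 : ∀ s t : ZMod 2, s + t = 0 → s = t := by decide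
  obtain ⟨x, hx⟩ := h.bounds (a := v) (b := a) (c := c) n1.1 n2.2.1 g2 (by
    simp only [insert_subset_iff, singleton_subset_iff, mem_edgesOn h, card_pair n1.1,
      card_pair n2.2.1, card_pair g2, true_and, pair_subset']
    exact ⟨⟨_, h1, by simp, by simp⟩, ⟨_, h2, by simp, by simp⟩, hac⟩)
  have hsum : ∀ e : Finset α, e.card = 2 → ∀ T ∈ S, ∀ T' ∈ S, e ⊆ T → e ⊆ T' → T ≠ T' →
      x T + x T' = if e ∈ ({{v, a}, {v, c}, {a, c}} : Finset (Finset α)) then 1 else 0 := by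
    intro e he T hT T' hT' heT heT' hne
    have e2 := h.two e he ⟨T, hT, heT⟩
    have e3 : ({T, T'} : Finset _) = S.filter (fun T => e ⊆ T) := by
      apply eq_of_subset_of_card_le
      · simp [insert_subset_iff, *]
      · rw [card_pair hne]; unfold cnt at e2; omega
    rw [← hx e ((mem_edgesOn h).2 ⟨he, T, hT, heT⟩), ← e3, sum_pair hne]
  have hst : ∀ u, u ≠ v → u ≠ a → u ≠ c → ∀ T ∈ S, ∀ T' ∈ S, u ∈ T → u ∈ T' → x T = x T' := by
    intro u k1 k2 k3 T hT T' hT' huT huT'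
    refine (h.lnk u (h.sub T hT huT) (fun U => x U = x T) ?_ T hT T' hT' huT huT' rfl).symm
    intro U hU U' hU' huU huU' y hy hyU hyU' hq
    rw [← hq]
    by_cases hUU : U = U'
    · rw [hUU]
    have := hsum {u, y} (card_pair hy.symm) U hU U' hU' (pair_subset'.2 ⟨huU, hyU⟩)
      (pair_subset'.2 ⟨huU', hyU'⟩) hUU
    rw [if_neg] at this
    · exact (char2 _ _ this).symm
    · intro hh
      have hu : u ∈ ({u, y} : Finset α) := by simp
      simp only [mem_insert, mem_singleton] at hh
      rcases hh with hh | hh | hh <;> rw [hh] at hu <;> simp at hu <;> tauto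
  obtain ⟨T, hT, hbT, hdT⟩ := hbd
  have p1 := hst b n1.2.1.symm g1.symm g4 _ h2 T hT (by simp) hbT
  have p2 := hst d n3.2.1.symm g3.symm g6.symm _ h3 T hT (by simp) hdT
  have hne : ({v, b, c} : Finset α) ≠ {v, c, d} := by
    intro hh; have := (Finset.ext_iff.1 hh b); simp at this; grind
  have p3 := hsum {v, c} (card_pair n2.2.1) _ h2 _ h3 (by simp [pair_subset']) (by simp [pair_subset']) hne
  rw [if_pos (by simp), p1, p2] at p3
  revert p3
  generalize x T = t
  revert t
  decide

/-- Every vertex of degree at least four has an edge that can be flipped. -/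
lemma Sp.flippable (h : Sp V S) {v : α} (hv : v ∈ V) (hd : 4 ≤ cnt S {v}) :
    ∃ x p q, {v, x, p} ∈ S ∧ {v, x, q} ∈ S ∧ p ≠ q ∧ ¬ ∃ T ∈ S, p ∈ T ∧ q ∈ T := by
  rcases h.star hv with ⟨a, b, c, n4, h1, h2, h3, hst⟩ | ⟨a, b, c, d, n4, h1, h2, h3⟩
  · exfalso
    have : (S.filter fun T => v ∈ T) ⊆ (tet {v, a, b, c}).filter fun T => v ∈ T := by
      intro T hT
      rw [mem_filter] at hT ⊢
      exact ⟨hst T hT.1 hT.2, hT.2⟩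
    have := card_le_card this
    rw [← cnt_single, ← cnt_single, deg_tet n4.card, if_pos (by simp)] at this
    omega
  · by_cases hac : ∃ T ∈ S, a ∈ T ∧ c ∈ T
    · exact ⟨c, b, d, by rwa [pair_comm], h3, n4.bd, fun hbd => h.jordan n4 h1 h2 h3 hac hbd⟩
    · exact ⟨b, a, c, by rwa [pair_comm], h2, n4.ac, hac⟩

end Jordan

section Cases

variable {α : Type*} [DecidableEq α] {V : Finset α} {S : Finset (Finset α)}

lemma Sp.sum_deg (h : Sp V S) : ∑ v ∈ V, cnt S {v} = 3 * S.card := by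
  have h1 := sum_card_bipartiteAbove_eq_sum_card_bipartiteBelow (s := S) (t := V) (fun T v => v ∈ T)
  have h2 : ∀ T ∈ S, (bipartiteAbove (fun T v => v ∈ T) V T).card = 3 := by
    intro T hT
    rw [← h.tri T hT]
    congr 1
    ext u
    simp only [bipartiteAbove, mem_filter]
    exact ⟨fun h => h.2, fun hu => ⟨h.sub T hT hu, hu⟩⟩
  rw [sum_const_nat h2] at h1
  rw [mul_comm, h1]
  refine sum_congr rfl fun v _ => ?_
  rw [cnt_single]; rfl

lemma Sp.exists_deg (h : Sp V S) : ∃ v ∈ V, cnt S {v} ≤ 5 := by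
  by_contra hcon
  push Not at hcon
  have h1 := h.sum_deg
  have h2 : ∑ v ∈ V, 6 ≤ ∑ v ∈ V, cnt S {v} := sum_le_sum fun v hv => hcon v hv
  rw [sum_const, smul_eq_mul] at h2
  have := h.chi
  omega

lemma cnt_insert {T e : Finset α} (hT : T ∉ S) :
    cnt (insert T S) e = cnt S e + if e ⊆ T then 1 else 0 := by
  unfold cnt
  rw [filter_insert]
  split_ifs with h
  · rw [card_insert_of_notMem (by simp [hT])]
  · rfl

lemma cnt_empty (e : Finset α) : cnt (∅ : Finset (Finset α)) e = 0 := rfl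

/-- Degrees after a flip. -/
lemma flip_deg {a b c w : α} (n4 : Ne4 a b c w)
    (hI : S ∩ tet {a, b, c, w} = {{a, b, c}, {a, b, w}}) (u : α) :
    cnt (S ∆ tet {a, b, c, w}) {u} + (if u = a ∨ u = b then 1 else 0) =
      cnt S {u} + (if u = c ∨ u = w then 1 else 0) := by
  have h1 := cnt_symmDiff S (tet {a, b, c, w}) {u}
  have h2 : ({a, b, c} : Finset α) ∉ ({{a, b, w}} : Finset (Finset α)) := by
    rw [mem_singleton]
    intro hh
    have : c ∈ ({a, b, w} : Finset α) := hh ▸ (by simp)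
    simp [n4.cd, n4.ac.symm, n4.bc.symm] at this
  rw [hI, deg_tet n4.card, cnt_insert h2, ← insert_empty_eq ({a, b, w} : Finset α),
    cnt_insert (notMem_empty _), cnt_empty] at h1
  obtain ⟨g1, g2, g3, g4, g5, g6⟩ := n4
  simp only [singleton_subset_iff, mem_insert, mem_singleton] at h1
  by_cases ha : u = a
  · subst ha; simp [*] at h1 ⊢; omega
  by_cases hb : u = b
  · subst hb; simp [*] at h1 ⊢; omega
  by_cases hc : u = c
  · subst hc; simp [*] at h1 ⊢; omega
  by_cases hw : u = w
  · subst hw; simp [*] at h1 ⊢; omega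
  simp [*] at h1 ⊢; omega

/-- Degrees after removing a vertex. -/
lemma remove_deg {v a b c : α} (n4 : Ne4 v a b c)
    (hI : S ∩ tet {v, a, b, c} = {{v, a, b}, {v, a, c}, {v, b, c}}) (u : α) (hu : u ≠ v) :
    cnt (S ∆ tet {v, a, b, c}) {u} + (if u = a ∨ u = b ∨ u = c then 1 else 0) = cnt S {u} := by
  have h1 := cnt_symmDiff S (tet {v, a, b, c}) {u}
  obtain ⟨g1, g2, g3, g4, g5, g6⟩ := id n4
  have h2 : ({v, a, b} : Finset α) ∉ ({{v, a, c}, {v, b, c}} : Finset (Finset α)) := by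
    simp only [mem_insert, mem_singleton]
    rintro (hh | hh)
    · have := (Finset.ext_iff.1 hh b); simp at this; grind
    · have := (Finset.ext_iff.1 hh a); simp at this; grind
  have h3 : ({v, a, c} : Finset α) ∉ ({{v, b, c}} : Finset (Finset α)) := by
    simp only [mem_singleton]
    intro hh
    have := (Finset.ext_iff.1 hh a); simp at this; grind
  rw [hI, deg_tet n4.card, cnt_insert h2, cnt_insert h3, ← insert_empty_eq ({v, b, c} : Finset α),
    cnt_insert (notMem_empty _), cnt_empty] at h1
  simp only [singleton_subset_iff, mem_insert, mem_singleton] at h1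
  by_cases ha : u = a
  · subst ha; simp [*] at h1 ⊢; omega
  by_cases hb : u = b
  · subst hb; simp [*] at h1 ⊢; omega
  by_cases hc : u = c
  · subst hc; simp [*] at h1 ⊢; omega
  simp [*] at h1 ⊢; omega

lemma Sp.remove3 (h : Sp V S) (hV : 5 ≤ V.card) {v : α} (hv : v ∈ V) (hd : cnt S {v} ≤ 3) {p q : α}
    (hpq : {v, p, q} ∈ S) : ∃ c, Ne4 v p q c ∧ {v, p, c} ∈ S ∧
      S ∩ tet {v, p, q, c} = {{v, p, q}, {v, p, c}, {v, q, c}} ∧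
      Sp (V.erase v) (S ∆ tet {v, p, q, c}) ∧ {p, q, c} ∈ S ∆ tet {v, p, q, c} := by
  obtain ⟨a, b, c, n4, h1, h2, h3, hst⟩ := h.star3 hv hd
  have hX := n4.card
  have hin : ∀ T ∈ tet {v, a, b, c}, v ∈ T → T ∈ S := by
    intro T hT hvT
    rcases (n4.tet T).1 hT with rfl | rfl | rfl | rfl
    · exact h1
    · exact h2
    · exact h3
    · simp [n4.ab, n4.ac, n4.ad] at hvT
  have hvX : v ∈ ({v, a, b, c} : Finset α) := by simp
  have hn : ¬ tet {v, a, b, c} ⊆ S := fun hh => by have := h.of_tet hX hh; omega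
  revert hX hst hin hvX hn
  generalize ({v, a, b, c} : Finset α) = X
  intro hst hX hin hvX hn
  obtain ⟨hs, hc3⟩ := mem_tet.1 (hst _ hpq (by simp))
  have hcd : (X \ {v, p, q}).card = 1 := by rw [card_sdiff_of_subset hs]; omega
  obtain ⟨d, hd⟩ := card_eq_one.1 hcd
  have hXe : X = {v, p, q, d} := by
    rw [← sdiff_union_of_subset hs, hd]
    ext; simp; tauto
  have hd' : d ∈ X \ {v, p, q} := by simp [hd]
  simp only [mem_sdiff, mem_insert, mem_singleton, not_or] at hd'
  have n1 := h.ne hpq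
  have n5 : Ne4 v p q d := ⟨n1.1, n1.2.1, Ne.symm hd'.2.1, n1.2.2, Ne.symm hd'.2.2.1, Ne.symm hd'.2.2.2⟩
  subst hXe
  have k1 := hin {v, p, d} ((n5.tet _).2 (by tauto)) (by simp)
  have k2 := hin {v, q, d} ((n5.tet _).2 (by tauto)) (by simp)
  have k3 : {p, q, d} ∉ S := by
    intro hh
    apply hn
    intro T hT
    rcases (n5.tet T).1 hT with rfl | rfl | rfl | rfl <;> assumption
  obtain ⟨r1, r2⟩ := h.remove n5 hpq k1 k2 k3 hst
  exact ⟨d, n5, k1, r1, r2, mem_symmDiff.2 (Or.inr ⟨(n5.tet _).2 (by tauto), k3⟩)⟩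

lemma Sp.caseA (h : Sp V S) (hV : 5 ≤ V.card) {v : α} (hv : v ∈ V) (hd : cnt S {v} ≤ 3) :
    ∃ a b c S2, Sp (V.erase v) S2 ∧ {a, b, c} ∈ S2 ∧ S = S2 ∆ tet {v, a, b, c} := by
  obtain ⟨a, b, c, n4, h1, -, -, -⟩ := h.star3 hv hd
  obtain ⟨c, -, -, -, h2, h3⟩ := h.remove3 hV hv hd h1
  exact ⟨a, b, c, _, h2, h3, (symmDiff_symmDiff_cancel_right _ _).symm⟩

lemma Sp.caseB (h : Sp V S) (hV : 5 ≤ V.card) (h4 : ∀ u ∈ V, 4 ≤ cnt S {u}) {v : α} (hv : v ∈ V)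
    (hd : cnt S {v} = 4) :
    ∃ a b c w S2, Sp (V.erase v) S2 ∧ {a, b, c} ∈ S2 ∧ {a, b, w} ∈ S2 ∧ c ≠ w ∧
      S = S2 ∆ tet {v, a, b, c} ∆ tet {v, a, b, w} ∧
      ∀ u ∈ V.erase v, cnt S2 {u} ≤ 3 → u = c ∨ u = w := by
  obtain ⟨x, p, q, h1, h2, hpq, hn⟩ := h.flippable hv (by omega)
  obtain ⟨n4, hI, hS1⟩ := h.flip h1 h2 hpq hn
  have hvx : ¬ ∃ T ∈ S ∆ tet {v, x, p, q}, v ∈ T ∧ x ∈ T := by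
    rintro ⟨T, hT, hvT, hxT⟩
    have e1 := cnt_symmDiff S (tet {v, x, p, q}) {v, x}
    rw [hI, cnt_tet n4.card (card_pair n4.ab) (by simp [pair_subset']),
      h.two _ (card_pair n4.ab) ⟨_, h1, by simp [pair_subset']⟩] at e1
    have e2 := cnt_ge (S := {{v, x, p}, {v, x, q}}) (A := {{v, x, p}, {v, x, q}}) {v, x} (Subset.refl _)
      (by simp [pair_subset'])
    rw [card_pair (by
      intro hh
      have : p ∈ ({v, x, q} : Finset α) := hh ▸ (by simp)
      simp [n4.cd, n4.ac.symm, n4.bc.symm] at this)] at e2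
    have e3 : 0 < cnt (S ∆ tet {v, x, p, q}) {v, x} := cnt_pos.2 ⟨T, hT, pair_subset'.2 ⟨hvT, hxT⟩⟩
    omega
  have fd := flip_deg n4 hI
  have hvpq : ({v, p, q} : Finset α) ∈ S ∆ tet {v, x, p, q} :=
    mem_symmDiff.2 (Or.inr ⟨(n4.tet _).2 (by tauto), fun hh => hn ⟨_, hh, by simp, by simp⟩⟩)
  have hxpq : ({x, p, q} : Finset α) ∈ S ∆ tet {v, x, p, q} :=
    mem_symmDiff.2 (Or.inr ⟨(n4.tet _).2 (by tauto), fun hh => hn ⟨_, hh, by simp, by simp⟩⟩)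
  have hdv := fd v
  rw [if_pos (by simp), if_neg (by simp [n4.ac, n4.ad])] at hdv
  obtain ⟨c, m4, hvpc, hI2, hS2, hpqc⟩ := hS1.remove3 hV hv (by omega) hvpq
  have hcx : c ≠ x := by
    rintro rfl
    exact hvx ⟨_, hvpc, by simp, by simp⟩
  have rd := remove_deg m4 hI2
  refine ⟨p, q, c, x, _, hS2, hpqc, ?_, hcx, ?_, ?_⟩
  · have hre : ({p, q, x} : Finset α) = {x, p, q} := by ext; simp; tauto
    rw [hre]
    refine mem_symmDiff.2 (Or.inl ⟨hxpq, fun hh => ?_⟩)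
    have : x ∈ ({v, p, q, c} : Finset α) := (mem_tet.1 hh).1 (by simp)
    simp [n4.ab.symm, n4.bc, n4.bd, hcx.symm] at this
  · rw [symmDiff_symmDiff_cancel_right]
    have hre : ({v, p, q, x} : Finset α) = {v, x, p, q} := by ext; simp; tauto
    rw [hre, symmDiff_symmDiff_cancel_right]
  · intro u hu hu3
    rw [mem_erase] at hu
    have e1 := fd u
    have e2 := rd u hu.1
    have e3 := h4 u hu.2
    by_contra hcon
    push Not at hcon
    simp only [hu.1, hcon.1, hcon.2, or_false, if_false, add_zero] at e1 e2
    omega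

lemma Sp.caseC (h : Sp V S) (h5 : ∀ u ∈ V, 5 ≤ cnt S {u}) {v : α} (hv : v ∈ V)
    (hd : cnt S {v} = 5) :
    ∃ a b c w S2, Sp V S2 ∧ {a, b, c} ∈ S2 ∧ {a, b, w} ∈ S2 ∧ c ≠ w ∧ c ∈ V ∧
      S = S2 ∆ tet {a, b, c, w} ∧ (¬ ∃ T ∈ S2, c ∈ T ∧ w ∈ T) ∧
      (∀ u ∈ V, 4 ≤ cnt S2 {u}) ∧ cnt S2 {c} = 4 ∧
      ∀ u ∈ V, cnt S2 {u} ≤ 4 → u = c ∨ u = w := by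
  obtain ⟨x, p, q, h1, h2, hpq, hn⟩ := h.flippable hv (by omega)
  obtain ⟨n4, hI, hS1⟩ := h.flip h1 h2 hpq hn
  have hvx : ¬ ∃ T ∈ S ∆ tet {v, x, p, q}, v ∈ T ∧ x ∈ T := by
    rintro ⟨T, hT, hvT, hxT⟩
    have e1 := cnt_symmDiff S (tet {v, x, p, q}) {v, x}
    rw [hI, cnt_tet n4.card (card_pair n4.ab) (by simp [pair_subset']),
      h.two _ (card_pair n4.ab) ⟨_, h1, by simp [pair_subset']⟩] at e1
    have e2 := cnt_ge (S := {{v, x, p}, {v, x, q}}) (A := {{v, x, p}, {v, x, q}}) {v, x} (Subset.refl _)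
      (by simp [pair_subset'])
    rw [card_pair (by
      intro hh
      have : p ∈ ({v, x, q} : Finset α) := hh ▸ (by simp)
      simp [n4.cd, n4.ac.symm, n4.bc.symm] at this)] at e2
    have e3 : 0 < cnt (S ∆ tet {v, x, p, q}) {v, x} := cnt_pos.2 ⟨T, hT, pair_subset'.2 ⟨hvT, hxT⟩⟩
    omega
  have fd := flip_deg n4 hI
  have hvpq : ({v, p, q} : Finset α) ∈ S ∆ tet {v, x, p, q} :=
    mem_symmDiff.2 (Or.inr ⟨(n4.tet _).2 (by tauto), fun hh => hn ⟨_, hh, by simp, by simp⟩⟩)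
  have hxpq : ({x, p, q} : Finset α) ∈ S ∆ tet {v, x, p, q} :=
    mem_symmDiff.2 (Or.inr ⟨(n4.tet _).2 (by tauto), fun hh => hn ⟨_, hh, by simp, by simp⟩⟩)
  have r1 : ({p, q, v} : Finset α) = {v, p, q} := by ext; simp; tauto
  have r2 : ({p, q, x} : Finset α) = {x, p, q} := by ext; simp; tauto
  have r3 : ({p, q, v, x} : Finset α) = {v, x, p, q} := by ext; simp; tauto
  refine ⟨p, q, v, x, _, hS1, by rwa [r1], by rwa [r2], n4.ab, hv, ?_, hvx, ?_, ?_, ?_⟩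
  · rw [r3, symmDiff_symmDiff_cancel_right]
  · intro u hu
    have e1 := fd u
    have e2 := h5 u hu
    split_ifs at e1 <;> omega
  · have e1 := fd v
    rw [if_pos (by simp), if_neg (by simp [n4.ac, n4.ad])] at e1
    omega
  · intro u hu hu4
    have e1 := fd u
    have e2 := h5 u hu
    by_contra hcon
    rw [if_neg hcon] at e1
    omega

end Cases

section Iso

variable {α β γ : Type*} [DecidableEq α] [DecidableEq β] [DecidableEq γ]

/-- The image of a set of faces. -/
def mv (f : α → β) (S : Finset (Finset α)) : Finset (Finset β) := S.image fun T => T.image f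

lemma mv_mv (f : α → β) (g : β → γ) (S : Finset (Finset α)) : mv g (mv f S) = mv (g ∘ f) S := by
  unfold mv; rw [image_image]; congr 1; ext1 T; simp [image_image]

lemma mem_mv {f : α → β} (hf : f.Injective) {S : Finset (Finset α)} {T : Finset α} :
    T.image f ∈ mv f S ↔ T ∈ S := by
  unfold mv
  rw [mem_image]
  exact ⟨fun ⟨T', h, h'⟩ => image_injective hf h' ▸ h, fun h => ⟨T, h, rfl⟩⟩

lemma mv_symmDiff {f : α → β} (hf : f.Injective) (S D : Finset (Finset α)) :
    mv f (S ∆ D) = mv f S ∆ mv f D := image_symmDiff _ _ (image_injective hf)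

lemma mv_tet {f : α → β} (hf : f.Injective) (X : Finset α) : mv f (tet X) = tet (X.image f) := by
  ext T
  rw [mem_tet]
  unfold mv
  rw [mem_image]
  constructor
  · rintro ⟨T, hT, rfl⟩
    rw [mem_tet] at hT
    exact ⟨image_subset_image hT.1, by rw [card_image_of_injective _ hf, hT.2]⟩
  · rintro ⟨h1, h2⟩
    obtain ⟨T', hT', rfl⟩ := subset_image_iff.1 h1
    exact ⟨T', mem_tet.2 ⟨by exact_mod_cast hT', by rwa [card_image_of_injective _ hf] at h2⟩, rfl⟩

lemma cnt_mv {f : α → β} (hf : f.Injective) (S : Finset (Finset α)) (e : Finset α) :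
    cnt (mv f S) (e.image f) = cnt S e := by
  unfold cnt mv
  rw [filter_image, card_image_of_injective _ (image_injective hf)]
  congr 1
  ext T
  simp only [mem_filter, image_subset_image_iff hf]

lemma mv_congr {f g : α → β} {S : Finset (Finset α)} (h : ∀ T ∈ S, ∀ x ∈ T, f x = g x) :
    mv f S = mv g S := by
  unfold mv
  exact image_congr fun T hT => image_congr fun x hx => h T hT x hx

lemma mv_eq_self {f : α → α} {S : Finset (Finset α)} (h : ∀ T ∈ S, ∀ x ∈ T, f x = x) :
    mv f S = S := by
  rw [mv_congr (g := id) h]; simp [mv]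

lemma Sp.mv {V : Finset α} {S : Finset (Finset α)} (h : Sp V S) (f : α → β) (g : β → α)
    (hg : ∀ x ∈ V, g (f x) = x) : Sp (V.image f) (mv f S) := by
  have hinj : ∀ X ⊆ V, (X.image f).image g = X := by
    intro X hX
    rw [image_image]
    conv_rhs => rw [← image_id (s := X)]
    exact image_congr fun x hx => hg x (hX hx)
  have hcard : ∀ X ⊆ V, (X.image f).card = X.card := by
    intro X hX
    apply le_antisymm card_image_le
    conv_lhs => rw [← hinj X hX]
    exact card_image_le
  have hf : ∀ x ∈ V, ∀ y ∈ V, f x = f y → x = y := fun x hx y hy he => by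
    rw [← hg x hx, he, hg y hy]
  have hmem : ∀ X ⊆ V, ∀ x ∈ V, (f x ∈ X.image f ↔ x ∈ X) := by
    intro X hX x hx
    refine ⟨fun hh => ?_, fun hh => mem_image_of_mem _ hh⟩
    obtain ⟨y, hy, hyx⟩ := mem_image.1 hh
    rwa [← hf y (hX hy) x hx hyx]
  unfold _root_.mv
  refine ⟨?_, ?_, ?_, ?_, ?_, ?_, ?_⟩
  · simp only [forall_mem_image]
    intro T hT
    rw [hcard T (h.sub T hT), h.tri T hT]
  · simp only [forall_mem_image]
    exact fun T hT => image_subset_image (h.sub T hT)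
  · simp only [forall_mem_image]
    intro v hv
    obtain ⟨T, hT, hvT⟩ := h.cov v hv
    exact ⟨_, mem_image_of_mem _ hT, mem_image_of_mem _ hvT⟩
  · rintro e he ⟨_, hTm, heT⟩
    obtain ⟨T, hT, rfl⟩ := mem_image.1 hTm
    obtain ⟨e, he', rfl⟩ := subset_image_iff.1 heT
    have he' : e ⊆ T := by exact_mod_cast he'
    have heV := he'.trans (h.sub T hT)
    rw [hcard e heV] at he
    rw [← h.two e he ⟨T, hT, he'⟩]
    unfold cnt
    rw [filter_image, card_image_of_injOn]
    · congr 1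
      refine filter_congr fun U hU => ⟨fun hh => ?_, fun hh => image_subset_image hh⟩
      rw [← hinj e heV, ← hinj U (h.sub U hU)]
      exact image_subset_image hh
    · intro A hA B hB hAB
      simp only [mem_coe, mem_filter] at hA hB
      rw [← hinj A (h.sub A hA.1), ← hinj B (h.sub B hB.1)]
      simp only at hAB
      rw [hAB]
  · simp only [forall_mem_image]
    intro v hv q hq T hT T' hT' hvT hvT'
    rw [hmem T (h.sub T hT) v hv] at hvT
    rw [hmem T' (h.sub T' hT') v hv] at hvT'
    refine h.lnk v hv (fun U => q (U.image f)) ?_ T hT T' hT' hvT hvT'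
    intro U hU U' hU' hvU hvU' a hav haU haU'
    exact hq hU hU' (mem_image_of_mem _ hvU) (mem_image_of_mem _ hvU') (f a)
      (fun hh => hav (hf a (h.sub U hU haU) v hv hh)) (mem_image_of_mem _ haU) (mem_image_of_mem _ haU')
  · simp only [forall_mem_image]
    intro p hp a ha b hb
    exact h.con (fun x => p (f x)) (fun T hT x hx y hy => hp hT hx hy) a ha b hb
  · rw [hcard V (Subset.refl _), ← h.chi, card_image_of_injOn]
    intro A hA B hB hAB
    rw [← hinj A (h.sub A hA), ← hinj B (h.sub B hB)]
    simp only at hAB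
    rw [hAB]

/-- Isomorphism of complexes with vertices natural numbers. -/
def Iso (S S' : Finset (Finset ℕ)) : Prop := ∃ σ : Equiv.Perm ℕ, mv σ S = S'

lemma Iso.trans {A B C : Finset (Finset ℕ)} : Iso A B → Iso B C → Iso A C := by
  rintro ⟨σ, rfl⟩ ⟨τ, rfl⟩
  exact ⟨σ.trans τ, by rw [mv_mv]; rfl⟩

/-- A map between two spheres with the same vertices is an isomorphism. -/
lemma iso_of_map {V : Finset ℕ} {A B : Finset (Finset ℕ)} (hA : Sp V A) (hB : Sp V B) (g : ℕ → ℕ)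
    (h : mv g A = B) : Iso A B := by
  have hgV : ∀ x ∈ V, g x ∈ V := by
    intro x hx
    obtain ⟨T, hT, hxT⟩ := hA.cov x hx
    exact hB.sub (T.image g) (h ▸ mem_image_of_mem _ hT) (mem_image_of_mem _ hxT)
  have hsurj : Function.Surjective (fun x : V => (⟨g x.1, hgV x.1 x.2⟩ : V)) := by
    rintro ⟨y, hy⟩
    obtain ⟨T, hT, hyT⟩ := hB.cov y hy
    rw [← h] at hT
    obtain ⟨U, hU, rfl⟩ := mem_image.1 hT
    obtain ⟨x, hx, rfl⟩ := mem_image.1 hyT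
    exact ⟨⟨x, hA.sub U hU hx⟩, rfl⟩
  let τ : Equiv.Perm V := Equiv.ofBijective _ (Finite.surjective_iff_bijective.1 hsurj)
  refine ⟨Equiv.Perm.ofSubtype τ, ?_⟩
  rw [← h]
  refine mv_congr fun T hT x hx => ?_
  rw [Equiv.Perm.ofSubtype_apply_of_mem τ (hA.sub T hT hx)]
  rfl

/-- Adjust an isomorphism at an additional vertex. -/
lemma iso_adjust {V W : Finset ℕ} {A B : Finset (Finset ℕ)} {v : ℕ} (hA : Sp (V.erase v) A) (hB : Sp W B)
    (h : Iso A B) {w : ℕ} (hw : w ∉ W) : ∃ σ : Equiv.Perm ℕ, mv σ A = B ∧ σ v = w := by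
  obtain ⟨σ, hσ⟩ := h
  have hv : σ v ∉ W := by
    intro hh
    obtain ⟨T, hT, hvT⟩ := hB.cov _ hh
    rw [← hσ] at hT
    obtain ⟨U, hU, rfl⟩ := mem_image.1 hT
    obtain ⟨x, hx, hxv⟩ := mem_image.1 hvT
    have := hA.sub U hU hx
    rw [σ.injective hxv] at this
    simp at this
  refine ⟨σ.trans (Equiv.swap (σ v) w), ?_, by simp⟩
  have : mv (Equiv.swap (σ v) w) (mv σ A) = B := by
    rw [hσ]
    refine mv_eq_self fun T hT x hx => ?_
    have hxW := hB.sub T hT hx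
    apply Equiv.swap_apply_of_ne_of_ne <;> rintro rfl <;> contradiction
  rw [← this, mv_mv]; rfl

end Iso

/-! ### Computation -/

/-- Lists of triangles with vertices natural numbers. -/
inductive TL | nil | cons (a b c : ℕ) (tl : TL)

/-- Trees of natural numbers. -/
inductive CT | leaf (c : ℕ) | node (l r : CT)

/-- Evaluate a natural number before passing it on. -/
noncomputable def fN {β : Type} (x : ℕ) (k : ℕ → β) : β :=
  Nat.rec (k 0) (fun m _ => k m) (Nat.add x 1)

/-- Evaluate a list of triangles before passing it on. -/
noncomputable def fTL {β : Type} (l : TL) (k : TL → β) : β :=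
  TL.rec (fun k => k .nil) (fun a b c _ ih k =>
    ih fun l => k (.cons a b c l)) l k

/-- Evaluate a list of lists of triangles before passing it on. -/
noncomputable def fL {β : Type} (l : List TL) (k : List TL → β) : β :=
  List.rec (fun k => k []) (fun t _ ih k => fTL t fun t => ih fun l => k (t :: l)) l k

/-- Concatenation of lists. -/
noncomputable def app (l m : List TL) : List TL := List.rec m (fun t _ ih => t :: ih) l

/-- The code of the image of a list of triangles under the packed map `F`. -/
noncomputable def img (F : ℕ) (l : TL) : ℕ :=
  TL.rec 0 (fun a b c _ ih => Nat.lor (Nat.shiftLeft 1 (Nat.lor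
    (Nat.shiftLeft 1 (Nat.land (Nat.shiftRight F a) 15)) (Nat.lor
    (Nat.shiftLeft 1 (Nat.land (Nat.shiftRight F b) 15))
    (Nat.shiftLeft 1 (Nat.land (Nat.shiftRight F c) 15))))) ih) l

/-- The packed map sending `32 * i` to `i`. -/
def idF : ℕ := 0xb0000000a00000009000000080000000700000006000000050000000400000003000000020000000100000000

/-- Decode a packed permutation. -/
noncomputable def dec (k c R F : ℕ) : ℕ :=
  Nat.rec (fun _ _ F => F) (fun m ih c R F =>
    fN (Nat.mul 4 (Nat.mod c (Nat.succ m))) fun d =>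
    fN (Nat.land (Nat.shiftRight R d) 15) fun v =>
    ih (Nat.div c (Nat.succ m))
      (Nat.xor R (Nat.shiftLeft (Nat.xor v (Nat.land (Nat.shiftRight R (Nat.mul 4 m)) 15)) d))
      (Nat.lor (Nat.shiftLeft F 32) v)) k c R F

/-- Look up in a tree. -/
noncomputable def look (t : CT) (j : ℕ) : ℕ :=
  CT.rec (fun c _ => c) (fun _ _ il ir j =>
    cond (Nat.beq (Nat.land j 1) 0) (il (Nat.shiftRight j 1)) (ir (Nat.shiftRight j 1))) t j

/-- The candidates selected as new by the stream. -/
noncomputable def gen (cs : List TL) (st : ℕ) : List TL :=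
  List.rec (fun _ => []) (fun c _ ih st =>
    cond (Nat.beq (Nat.land st 1) 1) (c :: fN (Nat.shiftRight st 1) ih)
      (cond (Nat.beq (Nat.land st 2) 0) (fN (Nat.shiftRight st 6) ih) (fN (Nat.shiftRight st 44) ih))) cs st

/-- Check that the other candidates satisfy `g` or are isomorphic to elements of the list. -/
noncomputable def ver (g : ℕ → TL → Bool) (T : CT) (cs : List TL) (st : ℕ) : Bool :=
  List.rec (fun _ => true) (fun c _ ih st =>
    cond (Nat.beq (Nat.land st 1) 1) (fN (Nat.shiftRight st 1) ih)
      (cond (Nat.beq (Nat.land st 2) 0) (cond (fN (Nat.land (Nat.shiftRight st 2) 15) fun i => g i c) (fN (Nat.shiftRight st 6) ih) false)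
        (cond (fN (dec 12 (Nat.land (Nat.shiftRight st 15) 536870911) 0xba9876543210 0) fun F =>
            Nat.beq (img F c) (look T (Nat.land (Nat.shiftRight st 2) 8191)))
          (fN (Nat.shiftRight st 44) ih) false))) cs st

/-- `revApp l m` is the reversal of `l` followed by `m`. -/
noncomputable def revApp (l m : TL) : TL :=
  TL.rec (fun m => m) (fun a b c _ ih m => ih (.cons a b c m)) l m

/-- All insertions of the vertex `v`. -/
noncomputable def insAll (v : ℕ) (l pre : TL) : List TL :=
  TL.rec (fun _ => []) (fun a b c l ih pre =>
    .cons a b v (.cons b c v (.cons c a v (revApp pre l))) :: ih (.cons a b c pre)) l pre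

/-- Membership of `x` in the triangle `a b c`. -/
noncomputable def mem3 (x a b c : ℕ) : Bool :=
  cond (Nat.beq x a) true (cond (Nat.beq x b) true (Nat.beq x c))

/-- Packed vertex degrees. -/
noncomputable def pdeg (l : TL) : ℕ :=
  TL.rec 0 (fun a b c _ ih => Nat.add ih (Nat.add (Nat.shiftLeft 1 a)
    (Nat.add (Nat.shiftLeft 1 b) (Nat.shiftLeft 1 c)))) l

/-- The vertices among `32 * i`, `i < n`, of degree at most `d`. -/
noncomputable def bad (d H n : ℕ) : List ℕ :=
  Nat.rec [] (fun m ih => cond (Nat.ble (Nat.land (Nat.shiftRight H (Nat.mul 32 m)) 4294967295) d)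
    (fN (Nat.mul 32 m) fun x => x :: ih) ih) n

/-- A field of a packed function. -/
noncomputable def fld (H a : ℕ) : ℕ := Nat.land (Nat.shiftRight H a) 4294967295

/-- One round of refining a packed function. -/
noncomputable def psum (H : ℕ) (l : TL) : ℕ :=
  TL.rec 0 (fun a b c _ ih => fN (Nat.mul (fld H a) (Nat.mul (fld H b) (fld H c))) fun w =>
    Nat.add ih (Nat.add (Nat.shiftLeft w a) (Nat.add (Nat.shiftLeft w b) (Nat.shiftLeft w c)))) l

/-- Is vertex number `i` of degree three and better than `v`? -/
noncomputable def drop3 (n v i : ℕ) (t : TL) : Bool :=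
  cond (Nat.ble n i) false (fN (pdeg t) fun H => fN (Nat.mul 32 i) fun u =>
    cond (Nat.ble (fld H u) 3) (fN (psum H t) fun Q => cond (Nat.ble (fld Q u) (fld Q v)) false true) false)

/-- The list with the triangles containing the edge `a b` removed. -/
noncomputable def del (a b : ℕ) (l : TL) : TL :=
  TL.rec .nil (fun x y z _ ih =>
    cond (mem3 a x y z) (cond (mem3 b x y z) ih (.cons x y z ih)) (.cons x y z ih)) l

/-- Is `a b` not an edge? -/
noncomputable def nonE (a b : ℕ) (l : TL) : Bool :=
  TL.rec true (fun x y z _ ih =>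
    cond (mem3 a x y z) (cond (mem3 b x y z) false ih) ih) l

/-- Are all elements of `B` in `c, w`? -/
noncomputable def sub2 (B : List ℕ) (c w : ℕ) : Bool :=
  List.rec true (fun x _ ih => cond (Nat.beq x c) ih (cond (Nat.beq x w) ih false)) B

/-- Does `B` have at most `k` elements different from `c`? -/
noncomputable def atmost (B : List ℕ) (c k : ℕ) : Bool :=
  List.rec (fun _ => true) (fun x _ ih k => cond (Nat.beq x c) (ih k)
    (cond (Nat.beq k 0) false (ih (Nat.pred k)))) B k

/-- Candidates obtained from the triangle `a b c` with a triangle `a b w` in `l`. -/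
noncomputable def pairs1 (B : List ℕ) (f : ℕ → ℕ → ℕ → ℕ → List TL) (l : TL) (a b c : ℕ)
    (r : List TL) : List TL :=
  cond (atmost B c 1)
    (TL.rec r (fun x y z _ ih => cond (mem3 a x y z) (cond (mem3 b x y z)
      (fN (Nat.sub (Nat.add x (Nat.add y z)) (Nat.add a b)) fun w =>
        cond (Nat.ble w c) ih (cond (sub2 B c w) (app (f a b c w) ih) ih)) ih) ih) l) r

/-- Candidates obtained from all pairs of adjacent triangles. -/
noncomputable def pairs (B : List ℕ) (f : ℕ → ℕ → ℕ → ℕ → List TL) (l m : TL) : List TL :=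
  TL.rec [] (fun a b c _ ih =>
    pairs1 B f l a b c (pairs1 B f l b c a (pairs1 B f l c a b ih))) m

/-- Candidates with a new vertex of degree four. -/
noncomputable def cone4 (n v : ℕ) (l : TL) : List TL :=
  fN (pdeg l) fun H => (fun B => cond (atmost B v 2)
    (pairs B (fun a b c w => [.cons v a c (.cons v c b (.cons v b w (.cons v w a (del a b l))))]) l l)
    []) (bad 3 H n)

/-- New elements with a vertex of degree three. -/
noncomputable def gen3 (v : ℕ) (P : List TL) (hs : List ℕ) : List TL :=
  List.rec (fun _ => []) (fun p _ ih hs =>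
    app (gen (insAll v p .nil) (hs.headD 0)) (ih hs.tail)) P hs

/-- Check the candidates with a vertex of degree three. -/
noncomputable def ver3 (T : CT) (n v : ℕ) (P : List TL) (hs : List ℕ) : Bool :=
  List.rec (fun _ => true) (fun p _ ih hs =>
    cond (ver (drop3 n v) T (insAll v p .nil) (hs.headD 0)) (ih hs.tail) false) P hs

/-- All candidates with a vertex of degree four. -/
noncomputable def cands4 (n v : ℕ) (P : List TL) : List TL :=
  List.rec [] (fun p _ ih => app (cone4 n v p) ih) P

/-- Is the list empty? -/
noncomputable def emp {β : Type} (l : List β) : Bool := List.rec true (fun _ _ _ => false) l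

/-- The flips of `l` of minimal degree at least five. -/
noncomputable def flips5 (n : ℕ) (l : TL) : List TL :=
  fN (pdeg l) fun H => (fun B => cond (atmost B (Nat.mul 32 n) 2)
    (pairs B (fun a b c w => cond (nonE c w l)
      ((fun t => cond (emp (bad 4 (pdeg t) n)) [t] []) (.cons c w a (.cons c w b (del a b l)))) []) l l)
    []) (bad 4 H n)

/-- The spheres of minimal degree five. -/
noncomputable def gen5 (n : ℕ) (P : List TL) : List TL :=
  List.rec [] (fun p _ ih => app (flips5 n p) ih) P

/-- The list of spheres with one more vertex. -/
noncomputable def nextL (n v : ℕ) (P : List TL) (hs : List ℕ) (h4 : ℕ) : List TL :=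
  fL P fun P => app (gen3 v P hs) (fL (gen (cands4 n v P) h4) fun m => app m (gen5 (Nat.succ n) m))

/-- Build a tree of codes. -/
noncomputable def tree {β : Type} (d : ℕ) (l : List TL) (k : CT → List TL → β) : β :=
  Nat.rec (fun l k => List.rec (fN 0 fun c => k (.leaf c) []) (fun t l _ => fN (img idF t) fun c => k (.leaf c) l) l)
    (fun _ ih l k => ih l fun x l => ih l fun y l => k (.node x y) l) d l k

/-- The check that every candidate has been treated. -/
noncomputable def chk (n v d d4 : ℕ) (P : List TL) (hs : List ℕ) (h4 : ℕ) : Bool :=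
  fL P fun P => cond (tree d (gen3 v P hs) fun T _ => ver3 T n v P hs)
    (tree d4 (gen (cands4 n v P) h4) fun T _ => ver (fun _ _ => false) T (cands4 n v P) h4) false


/-! ### Distinguishing the elements -/

/-- Binary search trees. -/
inductive BT | nil | node (l : BT) (k : ℕ) (r : BT)

/-- The sum over all triangles of the product of the values. -/
noncomputable def jsum (H : ℕ) (l : TL) : ℕ :=
  TL.rec 0 (fun a b c _ ih => Nat.add ih (Nat.mul (fld H a) (Nat.mul (fld H b) (fld H c)))) l

/-- The first invariant. -/
noncomputable def inv1 (H : ℕ) (l : TL) : ℕ := fN (psum H l) fun H => jsum H l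

/-- The second invariant. -/
noncomputable def inv2 (H : ℕ) (l : TL) (n : ℕ) : ℕ :=
  Nat.rec 0 (fun m ih => fN (inv1 (Nat.add H (Nat.shiftLeft 1 (Nat.mul 32 m))) l) fun J =>
    Nat.add ih (Nat.mul J J)) n

/-- Combine the invariants. -/
noncomputable def mix (M J : ℕ) (I : ℕ) : ℕ :=
  Nat.add (Nat.mod J 1000003) (Nat.mul 1048576 (Nat.add J (Nat.mul 1099511627776
    (cond (Nat.beq (Nat.land (Nat.shiftRight M (Nat.mod J 8192)) 1) 0) 0 I))))

/-- The key of a list of triangles. -/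
noncomputable def key (n M : ℕ) (l : TL) : ℕ :=
  fTL l fun l => fN (pdeg l) fun H => fN (inv1 H l) fun J => mix M J (inv2 H l n)

/-- Insertion, failing if the key is present. -/
noncomputable def bins (k : ℕ) (t : BT) (f : BT → Bool) : Bool :=
  BT.rec (fun f => fN 0 fun _ => f (.node .nil k .nil)) (fun l x r il ir f =>
    cond (Nat.beq k x) false (cond (Nat.ble k x) (il fun l => f (.node l x r))
      (ir fun r => f (.node l x r)))) t f

/-- The list has `N` elements with different keys. -/
noncomputable def dist (n M N : ℕ) (l : List TL) : Bool :=
  List.rec (fun _ c => Nat.beq c N) (fun t _ ih T c =>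
    fN (key n M t) fun k => fN (Nat.succ c) fun c => bins k T fun T => ih T c) l BT.nil 0

/-! ### Soundness of the computation -/

lemma fN_eq {β : Type} (x : ℕ) (k : ℕ → β) : fN x k = k x := rfl

lemma fTL_eq {β : Type} (l : TL) (k : TL → β) : fTL l k = k l := by
  induction l generalizing k with
  | nil => rfl
  | cons a b c l ih => exact ih _

lemma fL_eq {β : Type} (l : List TL) (k : List TL → β) : fL l k = k l := by
  induction l generalizing k with
  | nil => rfl
  | cons t l ih => exact (fTL_eq t _).trans (ih _)

lemma app_eq (l m : List TL) : app l m = l ++ m := by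
  induction l with
  | nil => rfl
  | cons t l ih => exact congrArg (t :: ·) ih

/-- The multiset of triangles of a list. -/
def toM : TL → Multiset (Finset ℕ)
  | .nil => 0
  | .cons a b c l => {a, b, c} ::ₘ toM l

/-- The names of the vertices. -/
def nm (n : ℕ) : Finset ℕ := (range n).image (32 * ·)

lemma mem_nm {n x : ℕ} : x ∈ nm n ↔ ∃ i < n, 32 * i = x := by simp [nm]

lemma card_nm (n : ℕ) : (nm n).card = n := by
  rw [nm, card_image_of_injective _ fun a b (h : 32 * a = 32 * b) => by omega, card_range]

lemma nm_succ (n : ℕ) : nm (n + 1) = insert (32 * n) (nm n) := by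
  rw [nm, range_add_one, image_insert]; rfl

lemma notMem_nm (n : ℕ) : 32 * n ∉ nm n := by
  rw [mem_nm]; rintro ⟨i, h, h'⟩; omega

/-- The list `t` represents the sphere `S`. -/
def Rp (n : ℕ) (t : TL) (S : Finset (Finset ℕ)) : Prop := Sp (nm n) S ∧ toM t = S.val

lemma Rp.mem {n : ℕ} {t : TL} {S : Finset (Finset ℕ)} (h : Rp n t S) {T : Finset ℕ} :
    T ∈ toM t ↔ T ∈ S := by rw [h.2]; rfl

lemma rep_mk {n : ℕ} {t : TL} {S : Finset (Finset ℕ)} (h : Sp (nm n) S) (hs : ∀ T ∈ S, T ∈ toM t)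
    (hc : (toM t).card + 4 ≤ 2 * n) : Rp n t S := by
  refine ⟨h, (Multiset.eq_of_le_of_card_le ((Multiset.le_iff_subset S.nodup).2 hs) ?_).symm⟩
  have := h.chi
  rw [card_nm] at this
  rw [card_val]
  omega

lemma toM_revApp (l m : TL) : toM (revApp l m) = toM l + toM m := by
  induction l generalizing m with
  | nil => exact (zero_add _).symm
  | cons a b c l ih =>
    refine (ih _).trans ?_
    simp [toM, add_comm]

lemma insAll_sound {v : ℕ} {t l pre : TL} (h : t ∈ insAll v l pre) : ∃ a b c r,
    toM t = {a, b, v} ::ₘ {b, c, v} ::ₘ {c, a, v} ::ₘ r ∧ {a, b, c} ::ₘ r = toM pre + toM l := by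
  induction l generalizing pre with
  | nil => cases h
  | cons a b c l ih =>
    rcases List.mem_cons.1 h with rfl | h
    · exact ⟨a, b, c, toM (revApp pre l), rfl, by simp [toM_revApp, toM]⟩
    · obtain ⟨x, y, z, r, h1, h2⟩ := ih h
      exact ⟨x, y, z, r, h1, by simp [h2, toM]⟩

lemma insAll_complete {v : ℕ} {l pre : TL} {T : Finset ℕ} (h : T ∈ toM l) : ∃ a b c r, ∃ t ∈ insAll v l pre,
    T = {a, b, c} ∧ toM t = {a, b, v} ::ₘ {b, c, v} ::ₘ {c, a, v} ::ₘ r ∧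
    {a, b, c} ::ₘ r = toM pre + toM l := by
  induction l generalizing pre with
  | nil => simp [toM] at h
  | cons a b c l ih =>
    rcases Multiset.mem_cons.1 h with rfl | h
    · exact ⟨a, b, c, toM (revApp pre l), _, List.mem_cons_self, rfl, rfl, by simp [toM_revApp, toM]⟩
    · obtain ⟨x, y, z, r, t, h1, h2, h3, h4⟩ := ih h
      exact ⟨x, y, z, r, t, List.mem_cons_of_mem _ h1, h2, h3, by rw [h4]; simp [toM]⟩

lemma rep_ins {n a b c : ℕ} {t l : TL} {S : Finset (Finset ℕ)} {r : Multiset (Finset ℕ)} (h : Rp n l S)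
    (h1 : toM t = {a, b, 32 * n} ::ₘ {b, c, 32 * n} ::ₘ {c, a, 32 * n} ::ₘ r)
    (h2 : {a, b, c} ::ₘ r = toM l) : Rp (n + 1) t (S ∆ tet {32 * n, a, b, c}) := by
  have hm : {a, b, c} ∈ S := h.mem.1 (h2 ▸ Multiset.mem_cons_self _ _)
  obtain ⟨hn, hi, hsp⟩ := h.1.insert hm (notMem_nm n)
  rw [← nm_succ] at hsp
  refine rep_mk hsp (fun T hT => ?_) ?_
  · rw [mem_symmDiff, hn.tet T] at hT
    rw [h1]
    have := h.mem (T := T)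
    rw [← h2] at this
    simp only [Multiset.mem_cons] at this ⊢
    have e1 : ({32 * n, a, b} : Finset ℕ) = {a, b, 32 * n} := by ext; simp; tauto
    have e2 : ({32 * n, a, c} : Finset ℕ) = {c, a, 32 * n} := by ext; simp; tauto
    have e3 : ({32 * n, b, c} : Finset ℕ) = {b, c, 32 * n} := by ext; simp; tauto
    rw [e1, e2, e3] at hT
    rcases hT with ⟨h3, h4⟩ | ⟨rfl | rfl | rfl | rfl, h4⟩ <;> tauto
  · have := congrArg Multiset.card h2
    rw [h.2, card_val] at this
    have h5 := h.1.chi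
    rw [card_nm] at h5
    rw [h1]
    simp only [Multiset.card_cons] at this ⊢
    omega

lemma ins_sound {n : ℕ} {t l : TL} {S : Finset (Finset ℕ)} (h : Rp n l S)
    (ht : t ∈ insAll (32 * n) l .nil) : ∃ S', Rp (n + 1) t S' := by
  obtain ⟨a, b, c, r, h1, h2⟩ := insAll_sound ht
  exact ⟨_, rep_ins h h1 (by simpa [toM] using h2)⟩

lemma ins_complete {n a b c : ℕ} {l : TL} {S : Finset (Finset ℕ)} (h : Rp n l S) (hS : {a, b, c} ∈ S) :
    ∃ t ∈ insAll (32 * n) l .nil, Rp (n + 1) t (S ∆ tet {32 * n, a, b, c}) := by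
  obtain ⟨x, y, z, r, t, ht, h0, h1, h2⟩ := insAll_complete (v := 32 * n) (pre := .nil) (h.mem.2 hS)
  refine ⟨t, ht, ?_⟩
  rw [h0]
  exact rep_ins h h1 (by simpa [toM] using h2)

lemma mem3_iff {x a b c : ℕ} : mem3 x a b c = true ↔ x ∈ ({a, b, c} : Finset ℕ) := by
  simp only [mem3, Bool.cond_eq_ite, Nat.beq_eq, mem_insert, mem_singleton]
  split_ifs <;> simp_all

lemma toM_del (a b : ℕ) (l : TL) : toM (del a b l) = (toM l).filter fun T => ¬(a ∈ T ∧ b ∈ T) := by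
  induction l with
  | nil => rfl
  | cons x y z l ih =>
    rw [toM, Multiset.filter_cons, ← ih]
    change toM (cond (mem3 a x y z) (cond (mem3 b x y z) (del a b l) (.cons x y z (del a b l)))
      (.cons x y z (del a b l))) = _
    simp only [Bool.cond_eq_ite, mem3_iff]
    split_ifs <;> first | tauto | simp [toM]

lemma nonE_iff {a b : ℕ} {l : TL} : nonE a b l = true ↔ ¬∃ T ∈ toM l, a ∈ T ∧ b ∈ T := by
  induction l with
  | nil => simp [toM]; rfl
  | cons x y z l ih =>
    change cond (mem3 a x y z) (cond (mem3 b x y z) false (nonE a b l)) (nonE a b l) = true ↔ _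
    simp only [Bool.cond_eq_ite, mem3_iff, toM, Multiset.mem_cons, exists_eq_or_imp]
    split_ifs <;> simp_all

lemma sub2_iff {B : List ℕ} {c w : ℕ} : sub2 B c w = true ↔ ∀ u ∈ B, u = c ∨ u = w := by
  induction B with
  | nil => simp [sub2]
  | cons x l ih =>
    change cond (Nat.beq x c) (sub2 l c w) (cond (Nat.beq x w) (sub2 l c w) false) = true ↔ _
    simp only [Bool.cond_eq_ite, Nat.beq_eq]
    split_ifs <;> simp_all

lemma atmost_iff {B : List ℕ} {c k : ℕ} : atmost B c k = true ↔ (B.filter (· ≠ c)).length ≤ k := by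
  induction B generalizing k with
  | nil => simp [atmost]
  | cons x l ih =>
    change cond (Nat.beq x c) (atmost l c k) (cond (Nat.beq k 0) false (atmost l c (Nat.pred k))) = true ↔ _
    simp only [Bool.cond_eq_ite, Nat.beq_eq]
    split_ifs with h1 h2
    · simp [ih, h1]
    · simp [h1, h2]
    · simp [ih, h1]; omega

lemma atmost_of {B : List ℕ} {c k : ℕ} (hB : B.Nodup) (X : Finset ℕ) (hX : X.card ≤ k)
    (h : ∀ u ∈ B, u ≠ c → u ∈ X) : atmost B c k = true := by
  rw [atmost_iff, ← List.toFinset_card_of_nodup (hB.filter _)]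
  refine (card_le_card fun u hu => ?_).trans hX
  simp at hu
  exact h u hu.1 hu.2

lemma bad_spec (d H n : ℕ) : (bad d H n).Nodup ∧ ∀ x, x ∈ bad d H n ↔ x ∈ nm n ∧ fld H x ≤ d := by
  induction n with
  | zero => simp [bad, nm]
  | succ m ih =>
    have : bad d H (m + 1) = if fld H (32 * m) ≤ d then 32 * m :: bad d H m else bad d H m := by
      change cond (Nat.ble (fld H (32 * m)) d) (32 * m :: bad d H m) (bad d H m) = _
      simp only [Bool.cond_eq_ite, Nat.ble_eq]
    rw [this, nm_succ]
    have := notMem_nm m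
    split_ifs
    · simp only [List.nodup_cons, List.mem_cons, ih, mem_insert]
      grind
    · simp only [ih, mem_insert]
      grind

/-- The packed sum of a weight over the stars of the vertices. -/
def pk (w : Finset ℕ → ℕ) (S : Finset (Finset ℕ)) : ℕ := ∑ T ∈ S, w T * ∑ x ∈ T, 2 ^ x

/-- The sum of a weight over the star of a vertex. -/
def sw {α : Type*} [DecidableEq α] (w : Finset α → ℕ) (S : Finset (Finset α)) (u : α) : ℕ :=
  ∑ T ∈ S with u ∈ T, w T

lemma fld_sum (g : ℕ → ℕ) (hg : ∀ i, g i < 2 ^ 32) (n j : ℕ) (hj : j < n) :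
    fld (∑ i ∈ range n, g i * 2 ^ (32 * i)) (32 * j) = g j := by
  change (_ >>> _) &&& (2 ^ 32 - 1) = _
  rw [Nat.and_two_pow_sub_one_eq_mod, Nat.shiftRight_eq_div_pow]
  induction j generalizing g n with
  | zero =>
    obtain ⟨n, rfl⟩ := Nat.exists_eq_succ_of_ne_zero hj.ne'
    have : ∑ i ∈ range n, g (i + 1) * 2 ^ (32 * (i + 1)) =
        2 ^ 32 * ∑ i ∈ range n, g (i + 1) * 2 ^ (32 * i) := by
      rw [mul_sum]; exact sum_congr rfl fun i _ => by ring
    rw [Nat.succ_eq_add_one, sum_range_succ', this]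
    have := hg 0
    simp
    omega
  | succ j ih =>
    obtain ⟨n, rfl⟩ := Nat.exists_eq_succ_of_ne_zero (by omega : n ≠ 0)
    have : ∑ i ∈ range n, g (i + 1) * 2 ^ (32 * (i + 1)) =
        2 ^ 32 * ∑ i ∈ range n, g (i + 1) * 2 ^ (32 * i) := by
      rw [mul_sum]; exact sum_congr rfl fun i _ => by ring
    rw [Nat.succ_eq_add_one, sum_range_succ', this, show 32 * (j + 1) = 32 + 32 * j by ring, pow_add,
      ← Nat.div_div_eq_div_mul]
    have h0 := hg 0
    rw [show ∀ x, (2 ^ 32 * x + g 0 * 2 ^ (32 * 0)) / 2 ^ 32 = x by intro x; simp; omega]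
    exact ih (fun i => g (i + 1)) (fun i => hg _) n (by omega)

lemma pk_eq {n : ℕ} {S : Finset (Finset ℕ)} (h : Sp (nm n) S) (w : Finset ℕ → ℕ) :
    pk w S = ∑ i ∈ range n, sw w S (32 * i) * 2 ^ (32 * i) := by
  simp only [pk, sw, sum_mul, mul_sum, sum_filter]
  rw [sum_comm]
  refine sum_congr rfl fun T hT => ?_
  have : T = T.filter (· ∈ nm n) := (filter_true_of_mem fun x hx => h.sub T hT hx).symm
  rw [← sum_filter_add_sum_filter_not T (· ∈ nm n) (fun x => w T * 2 ^ x), ← this,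
    filter_false_of_mem fun x hx => by simpa using h.sub T hT hx, sum_empty, add_zero]
  simp only [ite_mul, zero_mul]
  rw [← sum_filter]
  refine (sum_bij (fun i _ => 32 * i) ?_ ?_ ?_ ?_).symm
  · simp
  · intro a _ b _ h; omega
  · intro b hb
    obtain ⟨i, hi, rfl⟩ := mem_nm.1 (h.sub T hT hb)
    exact ⟨i, by simp [hi, hb], rfl⟩
  · simp

lemma fld_pk {n : ℕ} {S : Finset (Finset ℕ)} (h : Sp (nm n) S) (w : Finset ℕ → ℕ)
    (hw : ∀ u, sw w S u < 2 ^ 32) (u : ℕ) (hu : u ∈ nm n) : fld (pk w S) u = sw w S u := by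
  obtain ⟨j, hj, rfl⟩ := mem_nm.1 hu
  rw [pk_eq h, fld_sum (fun i => sw w S (32 * i)) (fun i => hw _) n j hj]

lemma Rp.tri {n : ℕ} {l : TL} {S : Finset (Finset ℕ)} (h : Rp n l S) : ∀ T ∈ toM l, T.card = 3 :=
  fun T hT => h.1.tri T (h.mem.1 hT)

lemma sum_three {a b c : ℕ} (h : ({a, b, c} : Finset ℕ).card = 3) (f : ℕ → ℕ) :
    ∑ x ∈ ({a, b, c} : Finset ℕ), f x = f a + (f b + f c) := by
  obtain ⟨h1, h2, h3⟩ := ne_of_card_three h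
  rw [sum_insert (by simp [h1, h2]), sum_insert (by simp [h3]), sum_singleton]

lemma pdeg_eq {l : TL} (h : ∀ T ∈ toM l, T.card = 3) :
    pdeg l = ((toM l).map fun T => 1 * ∑ x ∈ T, 2 ^ x).sum := by
  induction l with
  | nil => rfl
  | cons a b c l ih =>
    simp only [toM, Multiset.mem_cons, forall_eq_or_imp] at h
    rw [toM, Multiset.map_cons, Multiset.sum_cons, ← ih h.2, sum_three h.1, add_comm, one_mul]
    simp only [← Nat.one_shiftLeft]; rfl

lemma sw_one {α : Type*} [DecidableEq α] (S : Finset (Finset α)) (u : α) :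
    sw (fun _ => 1) S u = cnt S {u} := by
  simp [sw, cnt]

lemma bad_deg {n : ℕ} {l : TL} {S : Finset (Finset ℕ)} (h : Rp n l S) (hn : n ≤ 12) (d : ℕ) :
    (bad d (pdeg l) n).Nodup ∧ ∀ x, x ∈ bad d (pdeg l) n ↔ x ∈ nm n ∧ cnt S {x} ≤ d := by
  have h1 := bad_spec d (pdeg l) n
  refine ⟨h1.1, fun x => ?_⟩
  rw [h1.2, pdeg_eq h.tri, h.2]
  refine and_congr_right fun hx => ?_
  rw [← sw_one, ← fld_pk h.1 _ (fun u => ?_) x hx]; rfl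
  rw [sw_one]
  refine (card_filter_le _ _).trans_lt ?_
  have := h.1.chi
  rw [card_nm] at this
  omega

lemma pairs1_iff {B : List ℕ} {f : ℕ → ℕ → ℕ → ℕ → List TL} {l : TL} {a b c : ℕ} {r : List TL} {t : TL}
    (h : ∀ T ∈ toM l, T.card = 3) (hab : a ≠ b) : t ∈ pairs1 B f l a b c r ↔ t ∈ r ∨ (atmost B c 1 = true ∧
      ∃ w, {a, b, w} ∈ toM l ∧ c < w ∧ sub2 B c w = true ∧ t ∈ f a b c w) := by
  unfold pairs1
  cases atmost B c 1
  · simp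
  simp only [cond_true, true_and]
  induction l with
  | nil => simp [toM]
  | cons x y z l ih =>
    simp only [toM, Multiset.mem_cons, forall_eq_or_imp] at h
    have ih := ih h.2
    obtain ⟨h1, h2, h3⟩ := ne_of_card_three h.1
    set R : List TL := TL.rec r (fun x y z _ ih => cond (mem3 a x y z) (cond (mem3 b x y z)
      (fN (Nat.sub (Nat.add x (Nat.add y z)) (Nat.add a b)) fun w =>
        cond (Nat.ble w c) ih (cond (sub2 B c w) (app (f a b c w) ih) ih)) ih) ih) l with hR
    change t ∈ cond (mem3 a x y z) (cond (mem3 b x y z)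
      (cond (Nat.ble (x + (y + z) - (a + b)) c) R (cond (sub2 B c (x + (y + z) - (a + b)))
        (app (f a b c (x + (y + z) - (a + b))) R) R)) R) R ↔ _
    have key : ∀ w, ({a, b, w} : Finset ℕ) = {x, y, z} ↔ (mem3 a x y z = true ∧ mem3 b x y z = true ∧
        w = x + (y + z) - (a + b)) := by
      intro w
      rw [mem3_iff, mem3_iff]
      constructor
      · intro he
        refine ⟨he ▸ by simp, he ▸ by simp, ?_⟩
        have hs := sum_three h.1 (fun x => x)
        have hc := h.1
        rw [← he] at hs hc
        rw [sum_three hc] at hs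
        omega
      · rintro ⟨ha, hb, rfl⟩
        simp only [mem_insert, mem_singleton] at ha hb
        ext u
        simp only [mem_insert, mem_singleton]
        omega
    simp only [toM, Multiset.mem_cons, key, Bool.cond_eq_ite, Nat.ble_eq]
    split_ifs <;> simp only [app_eq, List.mem_append, ih] <;> grind

lemma pairs_sound {B : List ℕ} {f : ℕ → ℕ → ℕ → ℕ → List TL} {l m : TL} {t : TL}
    (h : ∀ T ∈ toM l, T.card = 3) (hm : ∀ T ∈ toM m, T.card = 3) (ht : t ∈ pairs B f l m) :
    ∃ a b c w, {a, b, c} ∈ toM m ∧ {a, b, w} ∈ toM l ∧ c < w ∧ t ∈ f a b c w := by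
  induction m with
  | nil => cases ht
  | cons x y z m ih =>
    simp only [toM, Multiset.mem_cons, forall_eq_or_imp] at hm
    obtain ⟨h1, h2, h3⟩ := ne_of_card_three hm.1
    change t ∈ pairs1 B f l x y z (pairs1 B f l y z x (pairs1 B f l z x y (pairs B f l m))) at ht
    rw [pairs1_iff h h1, pairs1_iff h h3, pairs1_iff h h2.symm] at ht
    have e1 : ({y, z, x} : Finset ℕ) = {x, y, z} := by ext; simp; tauto
    have e2 : ({z, x, y} : Finset ℕ) = {x, y, z} := by ext; simp; tauto
    rcases ht with ((ht | ⟨-, w, g⟩) | ⟨-, w, g⟩) | ⟨-, w, g⟩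
    · obtain ⟨a, b, c, w, h1, h2⟩ := ih hm.2 ht
      exact ⟨a, b, c, w, Multiset.mem_cons_of_mem h1, h2⟩
    · exact ⟨z, x, y, w, by simp [toM, e2], g.1, g.2.1, g.2.2.2⟩
    · exact ⟨y, z, x, w, by simp [toM, e1], g.1, g.2.1, g.2.2.2⟩
    · exact ⟨x, y, z, w, by simp [toM], g.1, g.2.1, g.2.2.2⟩

lemma pairs_complete {B : List ℕ} {f : ℕ → ℕ → ℕ → ℕ → List TL} {l m : TL} {a b c w : ℕ} (p : TL → Prop)
    (h : ∀ T ∈ toM l, T.card = 3) (hm : ∀ T ∈ toM m, T.card = 3) (h1 : {a, b, c} ∈ toM m)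
    (h2 : {a, b, w} ∈ toM l) (h3 : c < w) (hB : B.Nodup) (h4 : ∀ u ∈ B, u = c ∨ u = w)
    (h5 : ∃ t ∈ f a b c w, p t) (h6 : ∃ t ∈ f b a c w, p t) : ∃ t ∈ pairs B f l m, p t := by
  induction m with
  | nil => simp [toM] at h1
  | cons x y z m ih =>
    simp only [toM, Multiset.mem_cons, forall_eq_or_imp] at hm h1
    obtain ⟨g1, g2, g3⟩ := ne_of_card_three hm.1
    change ∃ t ∈ pairs1 B f l x y z (pairs1 B f l y z x (pairs1 B f l z x y (pairs B f l m))), _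
    simp only [pairs1_iff h g1, pairs1_iff h g3, pairs1_iff h g2.symm]
    rcases h1 with h1 | h1
    · have hat : atmost B c 1 = true := atmost_of hB {w} (by simp) fun u hu huc => by
        simpa using (h4 u hu).resolve_left huc
      have hs := sub2_iff.2 h4
      have h2' : {b, a, w} ∈ toM l := by rwa [insert_comm]
      obtain ⟨t1, ht1, hp1⟩ := h5
      obtain ⟨t2, ht2, hp2⟩ := h6
      obtain ⟨k1, k2, k3⟩ := ne_of_card_three (h1 ▸ hm.1)
      have ha : a ∈ ({x, y, z} : Finset ℕ) := by simp [← h1]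
      have hb : b ∈ ({x, y, z} : Finset ℕ) := by simp [← h1]
      have hc : c ∈ ({x, y, z} : Finset ℕ) := by simp [← h1]
      simp only [mem_insert, mem_singleton] at ha hb hc
      rcases ha with rfl | rfl | rfl <;> rcases hb with rfl | rfl | rfl <;>
        first | contradiction | skip <;> rcases hc with rfl | rfl | rfl <;>
        first
        | contradiction
        | exact ⟨t1, .inr ⟨hat, w, h2, h3, hs, ht1⟩, hp1⟩
        | exact ⟨t2, .inr ⟨hat, w, h2', h3, hs, ht2⟩, hp2⟩
        | exact ⟨t1, .inl (.inr ⟨hat, w, h2, h3, hs, ht1⟩), hp1⟩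
        | exact ⟨t2, .inl (.inr ⟨hat, w, h2', h3, hs, ht2⟩), hp2⟩
        | exact ⟨t1, .inl (.inl (.inr ⟨hat, w, h2, h3, hs, ht1⟩)), hp1⟩
        | exact ⟨t2, .inl (.inl (.inr ⟨hat, w, h2', h3, hs, ht2⟩)), hp2⟩
    · obtain ⟨t, ht, hp⟩ := ih hm.2 h1
      exact ⟨t, .inl (.inl (.inl ht)), hp⟩

lemma Sp.two_of {V : Finset ℕ} {S : Finset (Finset ℕ)} (h : Sp V S) {a b c w : ℕ} (h1 : {a, b, c} ∈ S)
    (h2 : {a, b, w} ∈ S) (hcw : c ≠ w) : (∀ T ∈ S, a ∈ T → b ∈ T → T = {a, b, c} ∨ T = {a, b, w}) ∧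
    (S.filter fun T => ¬(a ∈ T ∧ b ∈ T)).card + 2 = S.card := by
  obtain ⟨n1, n2, n3⟩ := h.ne h1
  have ht := h.two {a, b} (card_pair n1) ⟨_, h1, by intro x; simp; tauto⟩
  have hf : cnt S {a, b} = (S.filter fun T => a ∈ T ∧ b ∈ T).card := by
    unfold cnt
    simp only [insert_subset_iff, singleton_subset_iff]
  have hne : ({a, b, c} : Finset ℕ) ≠ {a, b, w} := by
    intro he
    have : c ∈ ({a, b, w} : Finset ℕ) := by simp [← he]
    simp [n2.symm, n3.symm, hcw] at this
  have hs : ({{a, b, c}, {a, b, w}} : Finset (Finset ℕ)) ⊆ S.filter fun T => a ∈ T ∧ b ∈ T := by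
    simp [insert_subset_iff, h1, h2]
  have he := eq_of_subset_of_card_le hs (by rw [card_pair hne, ← hf, ht])
  refine ⟨fun T hT ha hb => ?_, ?_⟩
  · have : T ∈ S.filter fun T => a ∈ T ∧ b ∈ T := mem_filter.2 ⟨hT, ha, hb⟩
    simpa [← he] using this
  · rw [← ht, hf, add_comm]
    exact card_filter_add_card_filter_not _

lemma card_del {n : ℕ} {l : TL} {S : Finset (Finset ℕ)} (h : Rp n l S) {a b c w : ℕ}
    (h1 : {a, b, c} ∈ S) (h2 : {a, b, w} ∈ S) (hcw : c ≠ w) : (toM (del a b l)).card + 6 = 2 * n := by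
  have := (h.1.two_of h1 h2 hcw).2
  have h3 := h.1.chi
  rw [card_nm] at h3
  rw [toM_del, h.2, ← filter_val, card_val]
  omega

lemma cone_rep {n : ℕ} {l : TL} {S : Finset (Finset ℕ)} (h : Rp n l S) {a b c w v : ℕ} (hv : v = 32 * n)
    (h1 : {a, b, c} ∈ S) (h2 : {a, b, w} ∈ S) (hcw : c ≠ w) :
    Rp (n + 1) (.cons v a c (.cons v c b (.cons v b w (.cons v w a (del a b l)))))
      (S ∆ tet {v, a, b, c} ∆ tet {v, a, b, w}) := by
  have hvV := notMem_nm n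
  rw [← hv] at hvV
  have hvS : ∀ T ∈ S, v ∉ T := fun T hT hh => hvV (h.1.sub T hT hh)
  have n2 := h.1.ne h2
  have hwv : w ≠ v := by rintro rfl; exact hvS _ h2 (by simp)
  obtain ⟨hn, hi, hsp⟩ := h.1.insert h1 hvV
  have eT : ({a, b, v, w} : Finset ℕ) = {v, a, b, w} := by ext; simp; tauto
  obtain ⟨hn', -, hsp'⟩ := hsp.flip (a := a) (b := b) (c := v) (w := w)
    (mem_symmDiff.2 <| .inr ⟨(hn.tet _).2 <| .inl (by ext; simp; tauto), fun hh => hvS _ hh (by simp)⟩)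
    (mem_symmDiff.2 <| .inl ⟨h2, fun hh => by
      have := (mem_tet.1 hh).1 (show w ∈ {a, b, w} by simp)
      simp [hwv, n2.2.1.symm, n2.2.2.symm, hcw.symm] at this⟩) hwv.symm (by
    rintro ⟨T, hT, hvT, hwT⟩
    rcases mem_symmDiff.1 hT with hT | hT
    · exact hvS T hT.1 hvT
    · have := (mem_tet.1 hT.1).1 hwT
      simp [hwv, n2.2.1.symm, n2.2.2.symm, hcw.symm] at this)
  rw [eT, hv, ← nm_succ, ← hv] at hsp'
  refine rep_mk hsp' (fun T hT => ?_) ?_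
  · have hn2 : Ne4 v a b w := ⟨hn.ab, hn.ac, hwv.symm, hn.bc, n2.2.1, n2.2.2⟩
    simp only [mem_symmDiff, hn.tet, hn2.tet] at hT
    simp only [toM, Multiset.mem_cons, toM_del, Multiset.mem_filter, h.mem]
    rw [pair_comm c b, pair_comm w a]
    by_cases hTS : T ∈ S
    · have h3 := (h.1.two_of h1 h2 hcw).1 T hTS
      have h4 := hvS T hTS
      have : ¬(T = {v, a, b}) := by rintro rfl; simp at h4
      have : ¬(T = {v, a, c}) := by rintro rfl; simp at h4
      have : ¬(T = {v, b, c}) := by rintro rfl; simp at h4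
      have : ¬(T = {v, a, w}) := by rintro rfl; simp at h4
      have : ¬(T = {v, b, w}) := by rintro rfl; simp at h4
      have : T = {a, b, c} → T ≠ {a, b, w} := by
        rintro rfl he
        have : c ∈ ({a, b, w} : Finset ℕ) := by simp [← he]
        simp [hn.bd.symm, hn.cd.symm, hcw] at this
      tauto
    · have : ¬(T = {a, b, c}) := by rintro rfl; tauto
      have : ¬(T = {a, b, w}) := by rintro rfl; tauto
      tauto
  · have := card_del h h1 h2 hcw
    simp only [toM, Multiset.card_cons]
    omega

lemma flip_rep {n : ℕ} {l : TL} {S : Finset (Finset ℕ)} (h : Rp n l S) {a b c w : ℕ}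
    (h1 : {a, b, c} ∈ S) (h2 : {a, b, w} ∈ S) (hcw : c ≠ w) (hn : ¬∃ T ∈ S, c ∈ T ∧ w ∈ T) :
    Rp n (.cons c w a (.cons c w b (del a b l))) (S ∆ tet {a, b, c, w}) := by
  obtain ⟨hn', -, hsp'⟩ := h.1.flip h1 h2 hcw hn
  refine rep_mk hsp' (fun T hT => ?_) ?_
  · simp only [mem_symmDiff, hn'.tet] at hT
    simp only [toM, Multiset.mem_cons, toM_del, Multiset.mem_filter, h.mem]
    have e1 : ({c, w, a} : Finset ℕ) = {a, c, w} := by ext; simp; tauto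
    have e2 : ({c, w, b} : Finset ℕ) = {b, c, w} := by ext; simp; tauto
    rw [e1, e2]
    have h3 := (h.1.two_of h1 h2 hcw).1 T
    rcases hT with ⟨g1, g2⟩ | ⟨rfl | rfl | rfl | rfl, g2⟩ <;> tauto
  · have := card_del h h1 h2 hcw
    simp only [toM, Multiset.card_cons]
    omega

lemma cone4_eq (n v : ℕ) (l : TL) : cone4 n v l = if atmost (bad 3 (pdeg l) n) v 2 then
    pairs (bad 3 (pdeg l) n) (fun a b c w => [.cons v a c (.cons v c b (.cons v b w (.cons v w a (del a b l))))])
      l l else [] := (Bool.cond_eq_ite _ _ _)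

lemma flips5_eq (n : ℕ) (l : TL) : flips5 n l = if atmost (bad 4 (pdeg l) n) (32 * n) 2 then
    pairs (bad 4 (pdeg l) n) (fun a b c w => if nonE c w l then
      if emp (bad 4 (pdeg (.cons c w a (.cons c w b (del a b l)))) n) then
        [.cons c w a (.cons c w b (del a b l))] else [] else []) l l else [] := by
  simp only [← Bool.cond_eq_ite]; rfl

lemma cone_sound {n : ℕ} {t l : TL} {S : Finset (Finset ℕ)} (h : Rp n l S) (ht : t ∈ cone4 n (32 * n) l) :
    ∃ S', Rp (n + 1) t S' := by
  rw [cone4_eq] at ht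
  split_ifs at ht
  · obtain ⟨a, b, c, w, h1, h2, h3, h4⟩ := pairs_sound h.tri h.tri ht
    rw [List.mem_singleton.1 h4]
    exact ⟨_, cone_rep h rfl (h.mem.1 h1) (h.mem.1 h2) h3.ne⟩
  · cases ht

lemma flips_sound {n : ℕ} {t l : TL} {S : Finset (Finset ℕ)} (h : Rp n l S) (ht : t ∈ flips5 n l) :
    ∃ S', Rp n t S' := by
  rw [flips5_eq] at ht
  split_ifs at ht
  · obtain ⟨a, b, c, w, h1, h2, h3, h4⟩ := pairs_sound h.tri h.tri ht
    split_ifs at h4 with h5 h6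
    · rw [List.mem_singleton.1 h4]
      rw [nonE_iff] at h5
      simp only [h.mem] at h5
      exact ⟨_, flip_rep h (h.mem.1 h1) (h.mem.1 h2) h3.ne h5⟩
    · cases h4
    · cases h4
  · cases ht

lemma cone_complete {n : ℕ} (hn : n ≤ 12) {l : TL} {S : Finset (Finset ℕ)} (h : Rp n l S) {a b c w : ℕ}
    (h1 : {a, b, c} ∈ S) (h2 : {a, b, w} ∈ S) (hcw : c < w)
    (hd : ∀ u ∈ nm n, cnt S {u} ≤ 3 → u = c ∨ u = w) :
    ∃ t ∈ cone4 n (32 * n) l, Rp (n + 1) t (S ∆ tet {32 * n, a, b, c} ∆ tet {32 * n, a, b, w}) := by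
  obtain ⟨hB, hB'⟩ := bad_deg h hn 3
  have hB2 : ∀ u ∈ bad 3 (pdeg l) n, u = c ∨ u = w := fun u hu => hd u ((hB' u).1 hu).1 ((hB' u).1 hu).2
  rw [cone4_eq, if_pos (atmost_of hB {c, w} card_le_two fun u hu _ => by simpa using hB2 u hu)]
  refine pairs_complete _ h.tri h.tri (h.mem.2 h1) (h.mem.2 h2) hcw hB hB2 ⟨_, List.mem_singleton_self _, ?_⟩
    ⟨_, List.mem_singleton_self _, ?_⟩
  · exact cone_rep h rfl h1 h2 hcw.ne
  · rw [insert_comm a b {c}, insert_comm a b {w}]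
    exact cone_rep h rfl (by rwa [insert_comm]) (by rwa [insert_comm]) hcw.ne

lemma emp_of {β : Type} {l : List β} (h : ∀ x, x ∉ l) : emp l = true := by
  cases l
  · rfl
  · exact absurd List.mem_cons_self (h _)

lemma flips_complete {n : ℕ} (hn : n ≤ 12) {l : TL} {S : Finset (Finset ℕ)} (h : Rp n l S) {a b c w : ℕ}
    (h1 : {a, b, c} ∈ S) (h2 : {a, b, w} ∈ S) (hcw : c < w) (hcw' : ¬∃ T ∈ S, c ∈ T ∧ w ∈ T)
    (hd : ∀ u ∈ nm n, cnt S {u} ≤ 4 → u = c ∨ u = w)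
    (hd' : ∀ u ∈ nm n, 5 ≤ cnt (S ∆ tet {a, b, c, w}) {u}) :
    ∃ t ∈ flips5 n l, Rp n t (S ∆ tet {a, b, c, w}) := by
  obtain ⟨hB, hB'⟩ := bad_deg h hn 4
  have hB2 : ∀ u ∈ bad 4 (pdeg l) n, u = c ∨ u = w := fun u hu => hd u ((hB' u).1 hu).1 ((hB' u).1 hu).2
  rw [flips5_eq, if_pos (atmost_of hB {c, w} card_le_two fun u hu _ => by simpa using hB2 u hu)]
  have hE : nonE c w l = true := nonE_iff.2 (by simpa only [h.mem] using hcw')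
  have h3 := flip_rep h h1 h2 hcw.ne hcw'
  have h4 := flip_rep h (by rwa [insert_comm]) (by rwa [insert_comm]) hcw.ne hcw' (a := b) (b := a)
  rw [insert_comm b a] at h4
  refine pairs_complete _ h.tri h.tri (h.mem.2 h1) (h.mem.2 h2) hcw hB hB2 ⟨_, ?_, h3⟩ ⟨_, ?_, h4⟩
  all_goals
    simp only [hE, if_true]
    rw [if_pos (emp_of fun x hx => ?_)]
    · exact List.mem_singleton_self _
    first
    | rw [(bad_deg h3 hn 4).2] at hx
      exact absurd (hd' x hx.1) (by omega)
    | rw [(bad_deg h4 hn 4).2] at hx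
      exact absurd (hd' x hx.1) (by omega)

/-! ### Ranks of vertices -/

/-- The sum over the star of a vertex of the products of the values. -/
def ps {α : Type*} [DecidableEq α] (h : α → ℕ) (S : Finset (Finset α)) (u : α) : ℕ :=
  sw (fun T => ∏ x ∈ T, h x) S u

lemma ps_congr {α : Type*} [DecidableEq α] {h h' : α → ℕ} {S : Finset (Finset α)}
    (hh : ∀ T ∈ S, ∀ x ∈ T, h x = h' x) (u : α) : ps h S u = ps h' S u := by
  unfold ps sw
  exact sum_congr rfl fun T hT => prod_congr rfl (hh T (mem_filter.1 hT).1)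

lemma sum_mv {α β : Type*} [DecidableEq α] [DecidableEq β] {f : α → β} (hf : f.Injective)
    (S : Finset (Finset α)) (h : β → ℕ) :
    ∑ T ∈ mv f S, ∏ x ∈ T, h x = ∑ T ∈ S, ∏ x ∈ T, h (f x) := by
  unfold mv
  rw [sum_image fun _ _ _ _ h => image_injective hf h]
  exact sum_congr rfl fun T _ => prod_image fun _ _ _ _ h => hf h

lemma ps_mv {α β : Type*} [DecidableEq α] [DecidableEq β] {f : α → β} (hf : f.Injective)
    (S : Finset (Finset α)) (h : β → ℕ) (u : α) :
    ps h (mv f S) (f u) = ps (fun x => h (f x)) S u := by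
  unfold ps sw
  have : {T ∈ mv f S | f u ∈ T} = mv f {T ∈ S | u ∈ T} := by
    unfold mv
    rw [filter_image]
    congr 1
    refine filter_congr fun T _ => ?_
    rw [hf.mem_finset_image]
  rw [this]
  exact sum_mv hf _ h

lemma prod_three {a b c : ℕ} (h : ({a, b, c} : Finset ℕ).card = 3) (f : ℕ → ℕ) :
    ∏ x ∈ ({a, b, c} : Finset ℕ), f x = f a * (f b * f c) := by
  obtain ⟨h1, h2, h3⟩ := ne_of_card_three h
  rw [prod_insert (by simp [h1, h2]), prod_insert (by simp [h3]), prod_singleton]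

lemma psum_eq {H : ℕ} {l : TL} (h : ∀ T ∈ toM l, T.card = 3) :
    psum H l = ((toM l).map fun T => (∏ x ∈ T, fld H x) * ∑ x ∈ T, 2 ^ x).sum := by
  induction l with
  | nil => rfl
  | cons a b c l ih =>
    simp only [toM, Multiset.mem_cons, forall_eq_or_imp] at h
    rw [toM, Multiset.map_cons, Multiset.sum_cons, ← ih h.2, sum_three h.1, prod_three h.1, add_comm,
      mul_add, mul_add]
    simp only [← Nat.shiftLeft_eq]; rfl

lemma jsum_eq {H : ℕ} {l : TL} (h : ∀ T ∈ toM l, T.card = 3) :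
    jsum H l = ((toM l).map fun T => ∏ x ∈ T, fld H x).sum := by
  induction l with
  | nil => rfl
  | cons a b c l ih =>
    simp only [toM, Multiset.mem_cons, forall_eq_or_imp] at h
    rw [toM, Multiset.map_cons, Multiset.sum_cons, ← ih h.2, prod_three h.1, add_comm]
    rfl

lemma cnt_le {n : ℕ} {S : Finset (Finset ℕ)} (h : Sp (nm n) S) (hn : n ≤ 12) (e : Finset ℕ) :
    cnt S e ≤ 20 := by
  refine (card_filter_le _ _).trans ?_
  have := h.chi
  rw [card_nm] at this
  omega

lemma fld_pdeg {n : ℕ} {l : TL} {S : Finset (Finset ℕ)} (h : Rp n l S) (hn : n ≤ 12) (u : ℕ)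
    (hu : u ∈ nm n) : fld (pdeg l) u = cnt S {u} := by
  rw [pdeg_eq h.tri, h.2, ← sw_one]
  exact fld_pk h.1 _ (fun u => by rw [sw_one]; have := cnt_le h.1 hn {u}; omega) u hu

lemma fld_psum {n H : ℕ} {l : TL} {S : Finset (Finset ℕ)} (h : Rp n l S) (hn : n ≤ 12) {f : ℕ → ℕ}
    (hf : ∀ u ∈ nm n, fld H u = f u) (hf' : ∀ u ∈ nm n, f u ≤ 21) (u : ℕ) (hu : u ∈ nm n) :
    fld (psum H l) u = ps f S u := by
  rw [psum_eq h.tri, h.2, ← ps_congr (fun T hT x hx => hf x (h.1.sub T hT hx))]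
  refine fld_pk h.1 (fun T => ∏ x ∈ T, fld H x) (fun u => ?_) u hu
  have h1 : ∀ T ∈ S.filter (u ∈ ·), ∏ x ∈ T, fld H x ≤ 21 ^ 3 := by
    intro T hT
    have hT := (mem_filter.1 hT).1
    rw [← h.1.tri T hT]
    exact prod_le_pow_card _ _ _ fun x hx => (hf x (h.1.sub T hT hx)).trans_le (hf' x (h.1.sub T hT hx))
  have h2 := sum_le_card_nsmul _ _ _ h1
  have h3 : (S.filter (u ∈ ·)).card ≤ 20 := by
    have := cnt_le h.1 hn {u}
    rw [← sw_one] at this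
    simpa [sw] using this
  unfold sw
  rw [smul_eq_mul] at h2
  refine (h2.trans (Nat.mul_le_mul_right _ h3)).trans_lt (by norm_num)

/-- The degree of a vertex. -/
def dg {α : Type*} [DecidableEq α] (S : Finset (Finset α)) (u : α) : ℕ := cnt S {u}

lemma dg_mv {α β : Type*} [DecidableEq α] [DecidableEq β] {f : α → β} (hf : f.Injective)
    (S : Finset (Finset α)) (u : α) : dg (mv f S) (f u) = dg S u := by
  unfold dg; rw [← image_singleton, cnt_mv hf]

lemma drop3_spec {n i : ℕ} {t : TL} {S : Finset (Finset ℕ)} (h : Rp (n + 1) t S) (hn : n ≤ 11)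
    (hd : drop3 n (32 * n) i t = true) :
    ∃ u ∈ nm (n + 1), dg S u ≤ 3 ∧ ps (dg S) S (32 * n) < ps (dg S) S u := by
  have hd : cond (Nat.ble n i) false (cond (Nat.ble (fld (pdeg t) (32 * i)) 3)
    (cond (Nat.ble (fld (psum (pdeg t) t) (32 * i)) (fld (psum (pdeg t) t) (32 * n))) false true) false) = true := hd
  simp only [Bool.cond_eq_ite, Nat.ble_eq] at hd
  split_ifs at hd with h1 h2 h3
  have hu : 32 * i ∈ nm (n + 1) := mem_nm.2 ⟨i, by omega, rfl⟩
  have hv : 32 * n ∈ nm (n + 1) := mem_nm.2 ⟨n, by omega, rfl⟩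
  have hp := fld_psum h (by omega) (fld_pdeg h (by omega)) (fun u _ => (cnt_le h.1 (by omega) _).trans (by norm_num))
  rw [fld_pdeg h (by omega) _ hu] at h2
  rw [hp _ hu, hp _ hv, not_le] at h3
  exact ⟨_, hu, h2, h3⟩

lemma gen_sub {cs : List TL} {st : ℕ} : ∀ t ∈ gen cs st, t ∈ cs := by
  induction cs generalizing st with
  | nil => exact fun t h => h
  | cons c cs ih =>
    intro t ht
    change t ∈ cond (Nat.beq (Nat.land st 1) 1) (c :: gen cs (Nat.shiftRight st 1))
      (cond (Nat.beq (Nat.land st 2) 0) (gen cs (Nat.shiftRight st 6)) (gen cs (Nat.shiftRight st 44))) at ht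
    simp only [Bool.cond_eq_ite] at ht
    split_ifs at ht
    · rcases List.mem_cons.1 ht with rfl | ht
      · exact List.mem_cons_self
      · exact List.mem_cons_of_mem _ (ih _ ht)
    · exact List.mem_cons_of_mem _ (ih _ ht)
    · exact List.mem_cons_of_mem _ (ih _ ht)

lemma ver_spec {g : ℕ → TL → Bool} {T : CT} {cs : List TL} {st : ℕ} (h : ver g T cs st = true) :
    ∀ c ∈ cs, c ∈ gen cs st ∨ (∃ i, g i c = true) ∨ ∃ F j, img F c = look T j := by
  induction cs generalizing st with
  | nil => exact fun c hc => .inl hc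
  | cons c cs ih =>
    have hg : gen (c :: cs) st = cond (Nat.beq (Nat.land st 1) 1) (c :: gen cs (Nat.shiftRight st 1))
      (cond (Nat.beq (Nat.land st 2) 0) (gen cs (Nat.shiftRight st 6)) (gen cs (Nat.shiftRight st 44))) := rfl
    rw [hg]
    change cond (Nat.beq (Nat.land st 1) 1) (ver g T cs (Nat.shiftRight st 1))
      (cond (Nat.beq (Nat.land st 2) 0)
        (cond (g (Nat.land (Nat.shiftRight st 2) 15) c) (ver g T cs (Nat.shiftRight st 6)) false)
        (cond (Nat.beq (img (dec 12 (Nat.land (Nat.shiftRight st 15) 536870911) 0xba9876543210 0) c)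
          (look T (Nat.land (Nat.shiftRight st 2) 8191))) (ver g T cs (Nat.shiftRight st 44)) false)) = true at h
    rw [Bool.cond_eq_ite] at h
    rw [Bool.cond_eq_ite]
    intro x hx
    split_ifs at h ⊢ with h1
    · rcases List.mem_cons.1 hx with rfl | hx
      · exact .inl List.mem_cons_self
      · exact (ih h x hx).imp_left (List.mem_cons_of_mem _)
    · rw [Bool.cond_eq_ite] at h
      rw [Bool.cond_eq_ite]
      split_ifs at h ⊢ with h2
      · rw [Bool.cond_eq_ite] at h
        split_ifs at h with h3
        rcases List.mem_cons.1 hx with rfl | hx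
        · exact .inr (.inl ⟨_, h3⟩)
        · exact ih h x hx
      · rw [Bool.cond_eq_ite] at h
        split_ifs at h with h3
        rcases List.mem_cons.1 hx with rfl | hx
        · exact .inr (.inr ⟨_, _, Nat.eq_of_beq_eq_true h3⟩)
        · exact ih h x hx

lemma tree_spec {β : Type} (d : ℕ) (l : List TL) (k : CT → List TL → β) : ∃ T l', tree d l k = k T l' ∧
    (∀ t ∈ l', t ∈ l) ∧ ∀ j, look T j = 0 ∨ ∃ t ∈ l, look T j = img idF t := by
  induction d generalizing l k with
  | zero =>
    cases l with
    | nil => exact ⟨.leaf 0, [], rfl, fun t h => h, fun j => .inl rfl⟩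
    | cons t l =>
      exact ⟨.leaf (img idF t), l, rfl, fun t h => List.mem_cons_of_mem _ h,
        fun j => .inr ⟨t, List.mem_cons_self, rfl⟩⟩
  | succ d ih =>
    change ∃ T l', tree d l (fun x l => tree d l fun y l => k (.node x y) l) = k T l' ∧ _
    obtain ⟨T1, l1, h1, h2, h3⟩ := ih l (fun x l => tree d l fun y l => k (.node x y) l)
    obtain ⟨T2, l2, g1, g2, g3⟩ := ih l1 (fun y l => k (.node T1 y) l)
    refine ⟨.node T1 T2, l2, h1.trans g1, fun t ht => h2 t (g2 t ht), fun j => ?_⟩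
    change cond (Nat.beq (Nat.land j 1) 0) (look T1 (Nat.shiftRight j 1)) (look T2 (Nat.shiftRight j 1)) = 0 ∨
      ∃ t ∈ l, cond (Nat.beq (Nat.land j 1) 0) (look T1 (Nat.shiftRight j 1)) (look T2 (Nat.shiftRight j 1)) = _
    cases Nat.beq (Nat.land j 1) 0
    · exact (g3 (Nat.shiftRight j 1)).imp_right fun ⟨t, ht, he⟩ => ⟨t, h2 t ht, he⟩
    · exact h3 (Nat.shiftRight j 1)

/-- The map packed in `F`. -/
def fm (F x : ℕ) : ℕ := (F >>> x) &&& 15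

/-- The number `k` is the code of the set `X`. -/
def Cd (k : ℕ) (X : Finset ℕ) : Prop := ∀ i, k.testBit i = true ↔ i ∈ X

lemma Cd.inj {k : ℕ} {X Y : Finset ℕ} (h : Cd k X) (h' : Cd k Y) : X = Y :=
  Finset.ext fun i => (h i).symm.trans (h' i)

lemma cd_three (f : ℕ → ℕ) (a b c : ℕ) :
    Cd (1 <<< f a ||| (1 <<< f b ||| 1 <<< f c)) (image f {a, b, c}) := by
  intro i
  simp only [Nat.testBit_or, Nat.one_shiftLeft, Nat.testBit_two_pow, Bool.or_eq_true, decide_eq_true_eq,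
    image_insert, image_singleton, mem_insert, mem_singleton, @eq_comm _ i]

lemma img_bit (F : ℕ) (l : TL) (k : ℕ) :
    (img F l).testBit k = true ↔ ∃ T ∈ toM l, Cd k (T.image (fm F)) := by
  induction l with
  | nil => simp [toM, img]
  | cons a b c l ih =>
    have : img F (.cons a b c l) = 1 <<< (1 <<< fm F a ||| (1 <<< fm F b ||| 1 <<< fm F c)) ||| img F l := rfl
    rw [this, Nat.testBit_or, Bool.or_eq_true, ih, Nat.one_shiftLeft, Nat.testBit_two_pow]
    simp only [toM, Multiset.mem_cons, exists_eq_or_imp, decide_eq_true_eq]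
    have h3 := cd_three (fm F) a b c
    refine or_congr_left ⟨fun h => h ▸ h3, fun h => Nat.eq_of_testBit_eq fun i => ?_⟩
    exact Bool.eq_iff_iff.2 ((h3 i).trans (h i).symm)

lemma mv_sub_of_img {F G : ℕ} {c t : TL} {C S : Finset (Finset ℕ)} {n : ℕ} (hc : Rp n c C) (ht : Rp n t S)
    (h : img F c = img G t) : mv (fm F) C ⊆ mv (fm G) S := by
  intro X hX
  obtain ⟨T, hT, rfl⟩ := mem_image.1 hX
  obtain ⟨a, b, d, -, -, -, rfl⟩ := card_eq_three.1 (hc.1.tri T hT)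
  have hk := cd_three (fm F) a b d
  obtain ⟨T', hT', h3⟩ := (img_bit G t _).1 (h ▸ (img_bit F c _).2 ⟨_, hc.mem.2 hT, hk⟩)
  exact mem_image.2 ⟨T', ht.mem.1 hT', h3.inj hk⟩

lemma iso_of_img {n F : ℕ} {c t : TL} {C S : Finset (Finset ℕ)} (hc : Rp n c C) (ht : Rp n t S) (hn : n ≤ 12)
    (h : img F c = img idF t) : Iso C S := by
  have he := (mv_sub_of_img hc ht h).antisymm (mv_sub_of_img ht hc h.symm)
  have hid : ∀ i < 12, fm idF (32 * i) = i := by decide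
  refine iso_of_map hc.1 ht.1 ((32 * ·) ∘ fm F) ?_
  rw [← mv_mv, he, mv_mv]
  refine mv_eq_self fun T hT x hx => ?_
  obtain ⟨i, hi, rfl⟩ := mem_nm.1 (ht.1.sub T hT hx)
  simp [hid i (hi.trans_le hn)]

/-- The list `L` represents the spheres with `n` vertices satisfying `p`. -/
def Good (n : ℕ) (L : List TL) (p : Finset ℕ → Finset (Finset ℕ) → Prop) : Prop :=
  (∀ t ∈ L, ∃ S, Rp n t S) ∧
    ∀ V S, V.card = n → Sp V S → p V S → ∃ t ∈ L, ∃ S', Rp n t S' ∧ Iso S S'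

/-- What is achieved by a successful check. -/
lemma tree_ver {n d : ℕ} {L : List TL} {q : CT → Bool} (hn : n ≤ 12) (hL : ∀ t ∈ L, ∃ S, Rp n t S)
    (h : tree d L (fun T _ => q T) = true) : ∃ T, q T = true ∧ ∀ c C F j, Rp n c C → img F c = look T j →
      ∃ t ∈ L, ∃ S', Rp n t S' ∧ Iso C S' := by
  obtain ⟨T, l', h1, -, h3⟩ := tree_spec d L (fun T _ => q T)
  refine ⟨T, h1 ▸ h, fun c C F j hc he => ?_⟩
  rcases h3 j with h4 | ⟨t, ht, h4⟩
  · exfalso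
    rw [h4] at he
    cases c with
    | nil =>
      have h5 := hc.2
      obtain ⟨v, hv, -⟩ := hc.1.exists_deg
      have h8 := hc.1.deg_ge hv
      rw [cnt, show C = ∅ from val_eq_zero.1 h5.symm] at h8
      simp at h8
    | cons a b d c =>
      have := (img_bit F (.cons a b d c) _).2 ⟨{a, b, d}, by simp [toM], cd_three (fm F) a b d⟩
      rw [he] at this
      simp at this
  · obtain ⟨S, hS⟩ := hL t ht
    exact ⟨t, ht, S, hS, iso_of_img hc hS hn (he.trans h4)⟩

lemma gen3_sub {v : ℕ} {P : List TL} {hs : List ℕ} {t : TL} (h : t ∈ gen3 v P hs) :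
    ∃ p ∈ P, t ∈ insAll v p .nil := by
  induction P generalizing hs with
  | nil => cases h
  | cons p P ih =>
    change t ∈ app (gen (insAll v p .nil) (hs.headD 0)) (gen3 v P hs.tail) at h
    rw [app_eq, List.mem_append] at h
    rcases h with h | h
    · exact ⟨p, List.mem_cons_self, gen_sub t h⟩
    · obtain ⟨q, hq, h⟩ := ih h
      exact ⟨q, List.mem_cons_of_mem _ hq, h⟩

lemma ver3_spec {T : CT} {n v : ℕ} {P : List TL} {hs : List ℕ} (h : ver3 T n v P hs = true) :
    ∀ p ∈ P, ∀ c ∈ insAll v p .nil, c ∈ gen3 v P hs ∨ (∃ i, drop3 n v i c = true) ∨ ∃ F j, img F c = look T j := by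
  induction P generalizing hs with
  | nil => simp
  | cons p P ih =>
    change cond (ver (drop3 n v) T (insAll v p .nil) (hs.headD 0)) (ver3 T n v P hs.tail) false = true at h
    have hg : gen3 v (p :: P) hs = app (gen (insAll v p .nil) (hs.headD 0)) (gen3 v P hs.tail) := rfl
    rw [Bool.cond_eq_ite] at h
    split_ifs at h with h1
    simp only [hg, app_eq, List.mem_append]
    intro q hq c hc
    rcases List.mem_cons.1 hq with rfl | hq
    · have := ver_spec h1 c hc
      tauto
    · have := ih h q hq c hc
      tauto

lemma mem_bind {f : TL → List TL} {P : List TL} {t : TL} :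
    t ∈ (List.rec [] (fun p _ ih => app (f p) ih) P : List TL) ↔ ∃ p ∈ P, t ∈ f p := by
  induction P with
  | nil => simp
  | cons p P ih =>
    refine (Iff.of_eq (congrArg (t ∈ ·) (app_eq (f p) _))).trans ?_
    rw [List.mem_append, ih]
    simp

section Step

variable {n d d4 h4 : ℕ} {P : List TL} {hs : List ℕ}

lemma good3 (hn : 4 ≤ n) (hn' : n ≤ 11) (hP : Good n P fun _ _ => True)
    (h : tree d (gen3 (32 * n) P hs) (fun T _ => ver3 T n (32 * n) P hs) = true) :
    Good (n + 1) (gen3 (32 * n) P hs) fun V S => ∃ v ∈ V, cnt S {v} ≤ 3 := by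
  have hs1 : ∀ t ∈ gen3 (32 * n) P hs, ∃ S, Rp (n + 1) t S := by
    intro t ht
    obtain ⟨p, hp, ht⟩ := gen3_sub ht
    obtain ⟨S, hS⟩ := hP.1 p hp
    exact ins_sound hS ht
  refine ⟨hs1, ?_⟩
  rintro V S hV hS ⟨v₀, hv₀, hd₀⟩
  obtain ⟨T, hT, hT'⟩ := tree_ver (by omega) hs1 h
  obtain ⟨v, hv0, hmax⟩ := exists_max_image (V.filter fun v => dg S v ≤ 3) (ps (dg S) S)
    ⟨v₀, mem_filter.2 ⟨hv₀, hd₀⟩⟩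
  obtain ⟨hv, hd⟩ := mem_filter.1 hv0
  obtain ⟨a, b, c, S2, hS2, habc, rfl⟩ := hS.caseA (by omega) hv hd
  obtain ⟨p, hp, S3, hr, hi⟩ := hP.2 _ S2 (by rw [card_erase_of_mem hv]; omega) hS2 trivial
  obtain ⟨σ, rfl, hσ⟩ := iso_adjust hS2 hr.1 hi (notMem_nm n)
  have hm := (mem_mv σ.injective).2 habc
  simp only [image_insert, image_singleton] at hm
  obtain ⟨x, hx, hxr⟩ := ins_complete hr hm
  rw [← hσ, ← image_singleton, ← image_insert, ← image_insert, ← image_insert, ← mv_tet σ.injective,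
    ← mv_symmDiff σ.injective] at hxr
  have hx1 : Iso (S2 ∆ tet {v, a, b, c}) _ := ⟨σ, rfl⟩
  rcases ver3_spec hT p hp x hx with h5 | ⟨i, hi⟩ | ⟨F, j, hF⟩
  · exact ⟨x, h5, _, hxr, hx1⟩
  · exfalso
    obtain ⟨u, hu, h6, h7⟩ := drop3_spec hxr hn' hi
    obtain ⟨X, hX, huX⟩ := hxr.1.cov u hu
    obtain ⟨U, hU, rfl⟩ := mem_image.1 hX
    obtain ⟨y, hy, rfl⟩ := mem_image.1 huX
    have h8 : (fun z => dg (mv σ (S2 ∆ tet {v, a, b, c})) (σ z)) = dg (S2 ∆ tet {v, a, b, c}) :=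
      funext (dg_mv σ.injective _)
    rw [← hσ, ps_mv σ.injective, ps_mv σ.injective, h8] at h7
    rw [dg_mv σ.injective] at h6
    exact (hmax y (mem_filter.2 ⟨hS.sub U hU hy, h6⟩)).not_gt h7
  · obtain ⟨t, ht, S', h6, h7⟩ := hT' x _ F j hxr hF
    exact ⟨t, ht, S', h6, hx1.trans h7⟩

lemma good4 (hn : 4 ≤ n) (hn' : n ≤ 11) (hP : Good n P fun _ _ => True)
    (h : tree d4 (gen (cands4 n (32 * n) P) h4) (fun T _ => ver (fun _ _ => false) T (cands4 n (32 * n) P) h4) = true) :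
    Good (n + 1) (gen (cands4 n (32 * n) P) h4)
      fun V S => (∀ u ∈ V, 4 ≤ cnt S {u}) ∧ ∃ v ∈ V, cnt S {v} = 4 := by
  have hs1 : ∀ t ∈ gen (cands4 n (32 * n) P) h4, ∃ S, Rp (n + 1) t S := by
    intro t ht
    obtain ⟨p, hp, ht⟩ := mem_bind.1 (gen_sub t ht)
    obtain ⟨S, hS⟩ := hP.1 p hp
    exact cone_sound hS ht
  refine ⟨hs1, ?_⟩
  rintro V S hV hS ⟨hd0, v, hv, hd⟩
  obtain ⟨T, hT, hT'⟩ := tree_ver (by omega) hs1 h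
  obtain ⟨a, b, c, w, S2, hS2, habc, habw, hcw, rfl, hdeg⟩ := hS.caseB (by omega) hd0 hv hd
  obtain ⟨p, hp, S3, hr, hi⟩ := hP.2 _ S2 (by rw [card_erase_of_mem hv]; omega) hS2 trivial
  obtain ⟨σ, rfl, hσ⟩ := iso_adjust hS2 hr.1 hi (notMem_nm n)
  have hm := (mem_mv σ.injective).2 habc
  have hm' := (mem_mv σ.injective).2 habw
  simp only [image_insert, image_singleton] at hm hm'
  have hdg : ∀ u ∈ nm n, cnt (mv σ S2) {u} ≤ 3 → u = σ c ∨ u = σ w := by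
    intro u hu hc
    obtain ⟨T, hT, huT⟩ := hr.1.cov u hu
    obtain ⟨U, hU, rfl⟩ := mem_image.1 hT
    obtain ⟨y, hy, rfl⟩ := mem_image.1 huT
    rw [← image_singleton, cnt_mv σ.injective] at hc
    exact (hdeg y (hS2.sub U hU hy) hc).imp (congrArg σ) (congrArg σ)
  have hex : ∃ x ∈ cands4 n (32 * n) P, Rp (n + 1) x (mv σ (S2 ∆ tet {v, a, b, c} ∆ tet {v, a, b, w})) := by
    simp only [mv_symmDiff σ.injective, mv_tet σ.injective, image_insert, image_singleton, hσ]
    rcases lt_or_gt_of_ne (σ.injective.ne hcw) with hlt | hlt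
    · obtain ⟨x, hx, hxr⟩ := cone_complete (by omega) hr hm hm' hlt hdg
      exact ⟨x, mem_bind.2 ⟨p, hp, hx⟩, hxr⟩
    · obtain ⟨x, hx, hxr⟩ := cone_complete (by omega) hr hm' hm hlt fun u hu hc => (hdg u hu hc).symm
      rw [symmDiff_right_comm] at hxr
      exact ⟨x, mem_bind.2 ⟨p, hp, hx⟩, hxr⟩
  obtain ⟨x, hx, hxr⟩ := hex
  have hx1 : Iso (S2 ∆ tet {v, a, b, c} ∆ tet {v, a, b, w}) _ := ⟨σ, rfl⟩
  rcases ver_spec hT x hx with h5 | ⟨i, hi⟩ | ⟨F, j, hF⟩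
  · exact ⟨x, h5, _, hxr, hx1⟩
  · exact absurd hi Bool.false_ne_true
  · obtain ⟨t, ht, S', h6, h7⟩ := hT' x _ F j hxr hF
    exact ⟨t, ht, S', h6, hx1.trans h7⟩

lemma good5 {L : List TL} (hn : n ≤ 12)
    (hL : Good n L fun V S => (∀ u ∈ V, 4 ≤ cnt S {u}) ∧ ∃ v ∈ V, cnt S {v} = 4) :
    Good n (gen5 n L) fun V S => ∀ u ∈ V, 5 ≤ cnt S {u} := by
  refine ⟨fun t ht => ?_, fun V S hV hS hd => ?_⟩
  · obtain ⟨p, hp, ht⟩ := mem_bind.1 ht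
    obtain ⟨S, hS⟩ := hL.1 p hp
    exact flips_sound hS ht
  obtain ⟨v, hv, hv5⟩ := hS.exists_deg
  obtain ⟨a, b, c, w, S2, hS2, habc, habw, hcw, hcV, rfl, hne, hd4, hc4, hdeg⟩ :=
    hS.caseC hd hv (le_antisymm hv5 (hd v hv))
  obtain ⟨p, hp, S3, hr, σ, rfl⟩ := hL.2 V S2 hV hS2 ⟨hd4, c, hcV, hc4⟩
  have hm := (mem_mv σ.injective).2 habc
  have hm' := (mem_mv σ.injective).2 habw
  simp only [image_insert, image_singleton] at hm hm'
  have hV' : ∀ u ∈ nm n, ∃ y ∈ V, u = σ y := by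
    intro u hu
    obtain ⟨T, hT, huT⟩ := hr.1.cov u hu
    obtain ⟨U, hU, rfl⟩ := mem_image.1 hT
    obtain ⟨y, hy, rfl⟩ := mem_image.1 huT
    exact ⟨y, hS2.sub U hU hy, rfl⟩
  have hdg : ∀ u ∈ nm n, cnt (mv σ S2) {u} ≤ 4 → u = σ c ∨ u = σ w := by
    intro u hu hc
    obtain ⟨y, hy, rfl⟩ := hV' u hu
    rw [← image_singleton, cnt_mv σ.injective] at hc
    exact (hdeg y hy hc).imp (congrArg σ) (congrArg σ)
  have hE : ¬∃ T ∈ mv σ S2, σ c ∈ T ∧ σ w ∈ T := by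
    rintro ⟨T, hT, h1, h2⟩
    obtain ⟨U, hU, rfl⟩ := mem_image.1 hT
    rw [σ.injective.mem_finset_image] at h1 h2
    exact hne ⟨U, hU, h1, h2⟩
  have hd' : ∀ u ∈ nm n, 5 ≤ cnt (mv σ (S2 ∆ tet {a, b, c, w})) {u} := by
    intro u hu
    obtain ⟨y, hy, rfl⟩ := hV' u hu
    rw [← image_singleton, cnt_mv σ.injective]
    exact hd y hy
  have hex : ∃ x ∈ gen5 n L, Rp n x (mv σ (S2 ∆ tet {a, b, c, w})) := by
    simp only [mv_symmDiff σ.injective, mv_tet σ.injective, image_insert, image_singleton] at hd' ⊢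
    rcases lt_or_gt_of_ne (σ.injective.ne hcw) with hlt | hlt
    · obtain ⟨x, hx, hxr⟩ := flips_complete hn hr hm hm' hlt hE hdg hd'
      exact ⟨x, mem_bind.2 ⟨p, hp, hx⟩, hxr⟩
    · rw [pair_comm (σ c) (σ w)] at hd' ⊢
      obtain ⟨x, hx, hxr⟩ := flips_complete hn hr hm' hm hlt (by simpa only [and_comm] using hE)
        (fun u hu hc => (hdg u hu hc).symm) hd'
      exact ⟨x, mem_bind.2 ⟨p, hp, hx⟩, hxr⟩
  obtain ⟨x, hx, hxr⟩ := hex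
  exact ⟨x, hx, _, hxr, σ, rfl⟩

theorem good_step (hP : Good n P fun _ _ => True) (h : chk n (32 * n) d d4 P hs h4 = true)
    (hn : 4 ≤ n := by norm_num) (hn' : n ≤ 11 := by norm_num) :
    Good (n + 1) (nextL n (32 * n) P hs h4) fun _ _ => True := by
  rw [chk, fL_eq, Bool.cond_eq_ite] at h
  split_ifs at h with h3
  have g3 := good3 hn hn' hP h3
  have g4 := good4 hn hn' hP h
  have g5 := good5 (by omega) g4
  rw [nextL, fL_eq, fL_eq, app_eq, app_eq]
  refine ⟨fun t ht => ?_, fun V S hV hS _ => ?_⟩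
  · simp only [List.mem_append] at ht
    rcases ht with ht | ht | ht
    · exact g3.1 t ht
    · exact g4.1 t ht
    · exact g5.1 t ht
  · simp only [List.mem_append]
    by_cases h1 : ∃ v ∈ V, cnt S {v} ≤ 3
    · obtain ⟨t, ht, h⟩ := g3.2 V S hV hS h1
      exact ⟨t, .inl ht, h⟩
    push Not at h1
    by_cases h2 : ∃ v ∈ V, cnt S {v} = 4
    · obtain ⟨t, ht, h⟩ := g4.2 V S hV hS ⟨h1, h2⟩
      exact ⟨t, .inr (.inl ht), h⟩
    push Not at h2
    obtain ⟨t, ht, h⟩ := g5.2 V S hV hS fun u hu => by have := h1 u hu; have := h2 u hu; omega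
    exact ⟨t, .inr (.inr ht), h⟩

end Step

/-! ### Keys -/

section Inv

variable {α β : Type*} [DecidableEq α] [DecidableEq β]

/-- The first invariant. -/
def J1 (h : α → ℕ) (S : Finset (Finset α)) : ℕ := ∑ T ∈ S, ∏ x ∈ T, ps h S x

/-- The second invariant. -/
def I2 (S : Finset (Finset α)) : ℕ :=
  ∑ v ∈ S.biUnion id, J1 (fun u => dg S u + if u = v then 1 else 0) S ^ 2

/-- The complete invariant. -/
noncomputable def KK (M : ℕ) (S : Finset (Finset α)) : ℕ := mix M (J1 (dg S) S) (I2 S)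

lemma J1_mv {f : α → β} (hf : f.Injective) (h : β → ℕ) (S : Finset (Finset α)) :
    J1 h (mv f S) = J1 (fun x => h (f x)) S := by
  unfold J1
  rw [sum_mv hf]
  simp only [ps_mv hf]

lemma KK_mv {f : α → β} (hf : f.Injective) (M : ℕ) (S : Finset (Finset α)) :
    KK M (mv f S) = KK M S := by
  unfold KK
  have h1 : J1 (dg (mv f S)) (mv f S) = J1 (dg S) S := by
    rw [J1_mv hf]; simp only [dg_mv hf]
  have h2 : (mv f S).biUnion id = (S.biUnion id).image f := by
    ext x
    simp only [mv, mem_biUnion, mem_image, id]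
    constructor
    · rintro ⟨_, ⟨T, hT, rfl⟩, hx⟩
      obtain ⟨y, hy, rfl⟩ := mem_image.1 hx
      exact ⟨y, ⟨T, hT, hy⟩, rfl⟩
    · rintro ⟨y, ⟨T, hT, hy⟩, rfl⟩
      exact ⟨_, ⟨T, hT, rfl⟩, mem_image_of_mem _ hy⟩
  have h3 : I2 (mv f S) = I2 S := by
    unfold I2
    rw [h2, sum_image fun _ _ _ _ h => hf h]
    simp only [J1_mv hf, dg_mv hf, hf.eq_iff]
  rw [h1, h3]

end Inv

lemma inv1_eq {n H : ℕ} {l : TL} {S : Finset (Finset ℕ)} (h : Rp n l S) (hn : n ≤ 12) {f : ℕ → ℕ}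
    (hf : ∀ u ∈ nm n, fld H u = f u) (hf' : ∀ u ∈ nm n, f u ≤ 21) : inv1 H l = J1 f S := by
  have h1 : inv1 H l = jsum (psum H l) l := rfl
  rw [h1, jsum_eq h.tri, h.2]
  exact sum_congr rfl fun T hT => prod_congr rfl fun x hx =>
    fld_psum h hn hf hf' x (h.1.sub T hT hx)

lemma fld_add {n m : ℕ} {l : TL} {S : Finset (Finset ℕ)} (h : Rp n l S) (hn : n ≤ 12) (hm : m < n)
    (u : ℕ) (hu : u ∈ nm n) :
    fld (Nat.add (pdeg l) (Nat.shiftLeft 1 (Nat.mul 32 m))) u = dg S u + if u = 32 * m then 1 else 0 := by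
  obtain ⟨j, hj, rfl⟩ := mem_nm.1 hu
  have h1 : Nat.add (pdeg l) (Nat.shiftLeft 1 (Nat.mul 32 m)) =
      ∑ i ∈ range n, (dg S (32 * i) + if 32 * i = 32 * m then 1 else 0) * 2 ^ (32 * i) := by
    simp only [add_mul, sum_add_distrib]
    have h2 : pdeg l = ∑ i ∈ range n, dg S (32 * i) * 2 ^ (32 * i) := by
      simp only [dg, ← sw_one]
      rw [← pk_eq h.1, pdeg_eq h.tri, h.2]; rfl
    have h3 : ∑ i ∈ range n, (if 32 * i = 32 * m then 1 else 0) * 2 ^ (32 * i) = 2 ^ (32 * m) := by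
      rw [sum_eq_single m]
      · simp
      · intro b _ hb
        rw [if_neg (by omega), zero_mul]
      · intro hm'
        exact absurd (mem_range.2 hm) hm'
    rw [h3, ← h2, ← Nat.one_shiftLeft]; rfl
  rw [h1]
  refine fld_sum (fun i => dg S (32 * i) + if 32 * i = 32 * m then 1 else 0) (fun i => ?_) n j hj
  have := cnt_le h.1 hn {32 * i}
  unfold dg
  beta_reduce
  split_ifs <;> omega

lemma inv2_eq {n m : ℕ} {l : TL} {S : Finset (Finset ℕ)} (h : Rp n l S) (hn : n ≤ 12) (hm : m ≤ n) :
    inv2 (pdeg l) l m =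
      ∑ i ∈ range m, J1 (fun u => dg S u + if u = 32 * i then 1 else 0) S ^ 2 := by
  induction m with
  | zero => rfl
  | succ m ih =>
    have h1 : inv2 (pdeg l) l (m + 1) = inv2 (pdeg l) l m +
      inv1 (Nat.add (pdeg l) (Nat.shiftLeft 1 (Nat.mul 32 m))) l *
      inv1 (Nat.add (pdeg l) (Nat.shiftLeft 1 (Nat.mul 32 m))) l := rfl
    rw [h1, ih (by omega), sum_range_succ, pow_two, inv1_eq h hn (fld_add h hn (by omega))]
    intro u _
    have := cnt_le h.1 hn {u}
    unfold dg
    split_ifs <;> omega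

lemma key_eq {n M : ℕ} {l : TL} {S : Finset (Finset ℕ)} (h : Rp n l S) (hn : n ≤ 12) :
    key n M l = KK M S := by
  have h1 : key n M l = fTL l fun l => mix M (inv1 (pdeg l) l) (inv2 (pdeg l) l n) := rfl
  rw [h1, fTL_eq, KK, inv2_eq h hn le_rfl, inv1_eq h hn (fld_pdeg h hn)
    (fun u _ => (cnt_le h.1 hn _).trans (by norm_num))]
  have h2 : S.biUnion id = nm n := by
    ext x
    simp only [mem_biUnion, id]
    exact ⟨fun ⟨T, hT, hx⟩ => h.1.sub T hT hx, fun hx => h.1.cov x hx⟩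
  congr 1
  rw [I2, h2, nm, sum_image]
  intro a _ b _ h
  exact Nat.eq_of_mul_eq_mul_left (by norm_num) h

/-! ### Distinct keys -/

/-- Membership in a tree. -/
def BT.has (x : ℕ) : BT → Prop
  | .nil => False
  | .node l k r => l.has x ∨ x = k ∨ r.has x

/-- Being a search tree. -/
def BT.Ord : BT → Prop
  | .nil => True
  | .node l k r => l.Ord ∧ r.Ord ∧ (∀ x, l.has x → x < k) ∧ ∀ x, r.has x → k < x

lemma bins_spec {k : ℕ} {t : BT} (ht : t.Ord) {f : BT → Bool} (h : bins k t f = true) :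
    ¬t.has k ∧ ∃ t', f t' = true ∧ t'.Ord ∧ ∀ x, t'.has x ↔ t.has x ∨ x = k := by
  induction t generalizing f with
  | nil => exact ⟨id, _, h, ⟨trivial, trivial, by simp [BT.has], by simp [BT.has]⟩, by simp [BT.has]⟩
  | node l y r il ir =>
    obtain ⟨hl, hr, hly, hry⟩ := ht
    change cond (Nat.beq k y) false (cond (Nat.ble k y) (bins k l fun l => f (.node l y r))
      (bins k r fun r => f (.node l y r))) = true at h
    simp only [Bool.cond_eq_ite] at h
    split_ifs at h with h1 h2
    · have h1 : k ≠ y := fun he => h1 (by subst he; exact Nat.beq_refl k)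
      have h2 : k ≤ y := Nat.le_of_ble_eq_true h2
      obtain ⟨h3, t', h4, h5, h6⟩ := il hl h
      refine ⟨?_, _, h4, ⟨h5, hr, ?_, hry⟩, ?_⟩
      · rintro (h | h | h)
        · exact h3 h
        · exact h1 h
        · have := hry k h; omega
      · intro x hx
        rcases (h6 x).1 hx with h | rfl
        · exact hly x h
        · omega
      · intro x
        simp only [BT.has, h6]; tauto
    · have h2 : ¬k ≤ y := fun he => h2 (Nat.ble_eq ▸ he)
      obtain ⟨h3, t', h4, h5, h6⟩ := ir hr h
      refine ⟨?_, _, h4, ⟨hl, h5, hly, ?_⟩, ?_⟩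
      · rintro (h | h | h)
        · have := hly k h; omega
        · omega
        · exact h3 h
      · intro x hx
        rcases (h6 x).1 hx with h | rfl
        · exact hry x h
        · omega
      · intro x
        simp only [BT.has, h6]; tauto

lemma dist_aux {n M N : ℕ} {L : List TL} {T : BT} {c : ℕ} (hT : T.Ord)
    (h : (List.rec (fun _ c => Nat.beq c N) (fun t _ ih T c =>
      fN (key n M t) fun k => fN (Nat.succ c) fun c => bins k T fun T => ih T c) L : BT → ℕ → Bool) T c = true) :
    (L.map (key n M)).Nodup ∧ (∀ t ∈ L, ¬T.has (key n M t)) ∧ L.length + c = N := by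
  induction L generalizing T c with
  | nil => exact ⟨by simp, by simp, by simpa using Nat.eq_of_beq_eq_true h⟩
  | cons t L ih =>
    obtain ⟨h1, T', h2, h3, h4⟩ := bins_spec hT (h : bins (key n M t) T (fun T => _) = true)
    obtain ⟨g1, g2, g3⟩ := ih h3 h2
    simp only [h4, not_or] at g2
    refine ⟨?_, ?_, ?_⟩
    · rw [List.map_cons, List.nodup_cons]
      refine ⟨fun hm => ?_, g1⟩
      obtain ⟨s, hs, he⟩ := List.mem_map.1 hm
      exact (g2 s hs).2 he
    · intro s hs
      rcases List.mem_cons.1 hs with rfl | hs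
      · exact h1
      · exact (g2 s hs).1
    · rw [List.length_cons]; omega

lemma dist_spec {n M N : ℕ} {L : List TL} (h : dist n M N L = true) :
    (L.map (key n M)).Nodup ∧ L.length = N := by
  obtain ⟨h1, -, h2⟩ := dist_aux (T := .nil) (c := 0) trivial h
  exact ⟨h1, h2⟩

/-! ### Counting -/

lemma Iso.symm {A B : Finset (Finset ℕ)} : Iso A B → Iso B A := by
  rintro ⟨σ, rfl⟩
  exact ⟨σ.symm, by rw [mv_mv]; exact mv_eq_self fun T _ x _ => by simp⟩

/-- The names of the vertices. -/
def nf (n : ℕ) (i : Fin n) : ℕ := 32 * i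

/-- The vertices with given names. -/
def ng (n : ℕ) (hn : 0 < n) (x : ℕ) : Fin n := ⟨x / 32 % n, Nat.mod_lt _ hn⟩

lemma ng_nf {n : ℕ} (hn : 0 < n) (i : Fin n) : ng n hn (nf n i) = i := by
  apply Fin.ext
  simp [ng, nf, Nat.mod_eq_of_lt i.2]

lemma nf_ng {n : ℕ} (hn : 0 < n) {x : ℕ} (hx : x ∈ nm n) : nf n (ng n hn x) = x := by
  obtain ⟨i, hi, rfl⟩ := mem_nm.1 hx
  simp [ng, nf, Nat.mod_eq_of_lt hi]

lemma nf_inj (n : ℕ) : (nf n).Injective := by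
  intro i j h
  apply Fin.ext
  simp only [nf] at h
  omega

lemma image_nf (n : ℕ) : (univ : Finset (Fin n)).image (nf n) = nm n := by
  ext x
  rw [mem_nm, mem_image]
  constructor
  · rintro ⟨i, -, rfl⟩
    exact ⟨i, i.2, rfl⟩
  · rintro ⟨i, hi, rfl⟩
    exact ⟨⟨i, hi⟩, mem_univ _, rfl⟩

lemma sp_nf {n : ℕ} (hn : 0 < n) {S : Finset (Finset (Fin n))} (h : Sp univ S) :
    Sp (nm n) (mv (nf n) S) := by
  rw [← image_nf]
  exact h.mv (nf n) (ng n hn) fun x _ => ng_nf hn x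

lemma iso_of_nf {n : ℕ} (hn : 0 < n) {A B : Finset (Finset (Fin n))} (hA : Sp univ A) (hB : Sp univ B)
    (h : Iso (mv (nf n) A) (mv (nf n) B)) : IsoComplex n A B := by
  obtain ⟨σ, hσ⟩ := h
  have h1 : ∀ i, σ (nf n i) ∈ nm n := by
    intro i
    obtain ⟨T, hT, hi⟩ := hA.cov i (mem_univ _)
    refine (sp_nf hn hB).sub ((T.image (nf n)).image σ) ?_ (mem_image_of_mem _ (mem_image_of_mem _ hi))
    rw [← hσ]
    exact (mem_mv σ.injective).2 ((mem_mv (nf_inj n)).2 hT)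
  have h2 : Function.Injective fun i => ng n hn (σ (nf n i)) := by
    intro i j h
    have h3 := congrArg (nf n) h
    simp only [nf_ng hn (h1 _)] at h3
    exact nf_inj n (σ.injective h3)
  refine ⟨Equiv.ofBijective _ (Finite.injective_iff_bijective.1 h2), ?_⟩
  change mv (ng n hn ∘ σ ∘ nf n) A = B
  rw [← mv_mv, ← mv_mv, hσ, mv_mv]
  exact mv_eq_self fun T _ x _ => ng_nf hn x

theorem count {n M N : ℕ} {L : List TL} (hn : 0 < n) (hn' : n ≤ 12) (hL : Good n L fun _ _ => True)
    (hd : dist n M N L = true) :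
    numClasses n (fun S => IsCombSurface n S ∧ eulerChar n S = 2) = N := by
  obtain ⟨hd1, hd2⟩ := dist_spec hd
  have hsp : ∀ A : {S : Finset (Finset (Fin n)) // IsCombSurface n S ∧ eulerChar n S = 2}, Sp univ A.1 :=
    fun A => (sp_iff _ _).2 A.2
  have hrep : ∀ A : {S : Finset (Finset (Fin n)) // IsCombSurface n S ∧ eulerChar n S = 2},
      ∃ t ∈ L, ∃ S', Rp n t S' ∧ Iso (mv (nf n) A.1) S' ∧ key n M t = KK M A.1 := by
    intro A
    obtain ⟨t, ht, S', h1, h2⟩ := hL.2 _ _ (card_nm n) (sp_nf hn (hsp A)) trivial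
    refine ⟨t, ht, S', h1, h2, ?_⟩
    obtain ⟨σ, rfl⟩ := h2
    rw [key_eq h1 hn', KK_mv σ.injective, KK_mv (nf_inj n)]
  unfold numClasses
  let φ : Quot (fun A B : {S : Finset (Finset (Fin n)) // IsCombSurface n S ∧ eulerChar n S = 2} =>
      IsoComplex n A.1 B.1) → ℕ := Quot.lift (fun A => KK M A.1) (by
    rintro A B ⟨σ, h⟩
    change KK M A.1 = KK M B.1
    rw [← h]
    exact (KK_mv σ.injective M A.1).symm)
  have hφ : φ.Injective := by
    rintro ⟨A⟩ ⟨B⟩ h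
    replace h : KK M A.1 = KK M B.1 := h
    obtain ⟨t, ht, S, h1, h2, h3⟩ := hrep A
    obtain ⟨s, hs, S', g1, g2, g3⟩ := hrep B
    obtain rfl : t = s := List.inj_on_of_nodup_map hd1 ht hs (h3.trans (h.trans g3.symm))
    obtain rfl : S = S' := val_injective (h1.2.symm.trans g1.2)
    exact Quot.sound (iso_of_nf hn (hsp A) (hsp B) (h2.trans g2.symm))
  have hr : Set.range φ = ↑(L.map (key n M)).toFinset := by
    ext k
    simp only [Set.mem_range, mem_coe, List.mem_toFinset, List.mem_map]
    constructor
    · rintro ⟨⟨A⟩, rfl⟩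
      obtain ⟨t, ht, S, h1, h2, h3⟩ := hrep A
      exact ⟨t, ht, h3⟩
    · rintro ⟨t, ht, rfl⟩
      obtain ⟨S, hS⟩ := hL.1 t ht
      have h1 : Sp univ (mv (ng n hn) S) := by
        have h2 := hS.1.mv (ng n hn) (nf n) fun x hx => nf_ng hn hx
        have h3 : (nm n).image (ng n hn) = univ := by
          refine eq_univ_iff_forall.2 fun i => ?_
          rw [← image_nf, image_image]
          exact mem_image.2 ⟨i, mem_univ _, ng_nf hn i⟩
        rwa [h3] at h2
      refine ⟨Quot.mk _ ⟨mv (ng n hn) S, (sp_iff _ _).1 h1⟩, ?_⟩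
      change KK M (mv (ng n hn) S) = _
      rw [key_eq hS hn', ← KK_mv (nf_inj n), mv_mv]
      congr 1
      exact mv_eq_self fun T hT x hx => nf_ng hn (hS.1.sub T hT hx)
  rw [← Nat.card_range_of_injective hφ, hr, Nat.card_coe_set_eq, Set.ncard_coe_finset,
    List.toFinset_card_of_nodup hd1, List.length_map, hd2]

/-! ### The tetrahedron -/

lemma mem4 {V : Finset ℕ} {x : ℕ} (h : V.card = 4) (hx : x ∈ V) (y : ℕ) (hy : y ∈ V) :
    ∃ T ∈ tet V, x ∈ T ∧ y ∈ T := by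
  obtain ⟨T, h1, h2, h3⟩ := exists_subsuperset_card_eq (s := {x, y}) (t := V) (n := 3)
    (insert_subset hx (singleton_subset_iff.2 hy)) (card_le_two.trans (by norm_num)) (by omega)
  exact ⟨T, mem_tet.2 ⟨h2, h3⟩, h1 (by simp), h1 (by simp)⟩

lemma sp_tet : Sp (nm 4) (tet (nm 4)) := by
  have h4 := card_nm 4
  refine ⟨fun T hT => (mem_tet.1 hT).2, fun T hT => (mem_tet.1 hT).1, fun v hv => ?_, ?_, ?_, ?_, ?_⟩
  · obtain ⟨T, hT, h, -⟩ := mem4 h4 hv v hv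
    exact ⟨T, hT, h⟩
  · rintro e he ⟨T, hT, heT⟩
    exact cnt_tet h4 he (heT.trans (mem_tet.1 hT).1)
  · intro v hv q hq T hT T' hT' hvT hvT' hqT
    obtain ⟨a, ha, hav⟩ : ∃ a ∈ T ∩ T', a ≠ v := by
      refine exists_mem_ne ?_ v
      have h1 := mem_tet.1 hT
      have h2 := mem_tet.1 hT'
      have h3 := card_le_card (union_subset h1.1 h2.1)
      have h5 := card_union_add_card_inter T T'
      omega
    exact hq T hT T' hT' hvT hvT' a hav (mem_inter.1 ha).1 (mem_inter.1 ha).2 hqT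
  · intro p hp a ha b hb hpa
    obtain ⟨T, hT, h1, h2⟩ := mem4 h4 ha b hb
    exact hp T hT a h1 b h2 hpa
  · rw [card_tet h4, card_nm]

lemma good4_base :
    Good 4 [.cons 0 32 64 (.cons 0 32 96 (.cons 0 64 96 (.cons 32 64 96 .nil)))] fun _ _ => True := by
  have hr : Rp 4 (.cons 0 32 64 (.cons 0 32 96 (.cons 0 64 96 (.cons 32 64 96 .nil)))) (tet (nm 4)) := by
    refine rep_mk sp_tet ?_ (by simp [toM])
    decide
  refine ⟨fun t ht => ⟨_, List.mem_singleton.1 ht ▸ hr⟩, fun V S hV hS _ => ⟨_, List.mem_singleton.2 rfl, _, hr, ?_⟩⟩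
  obtain rfl := hS.base hV
  obtain ⟨σ, hσ⟩ : ∃ σ : Equiv.Perm ℕ, V.image σ = nm 4 := by
    have e : {x // x ∈ V} ≃ {x // x ∈ nm 4} := Finset.equivOfCardEq (hV.trans (card_nm 4).symm)
    refine ⟨e.extendSubtype, eq_of_subset_of_card_le (fun x hx => ?_) ?_⟩
    · obtain ⟨y, hy, rfl⟩ := mem_image.1 hx
      exact e.extendSubtype_mem y hy
    · rw [card_image_of_injective _ (Equiv.injective _), hV, card_nm]
  exact ⟨σ, by rw [mv_tet σ.injective, hσ]⟩

/-! ### Data -/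

/-- The boundary of the tetrahedron. -/
def L4 : List TL := [.cons 0 32 64 (.cons 0 32 96 (.cons 0 64 96 (.cons 32 64 96 .nil)))]

/-- Hints for 5 vertices. -/
def hs5 : List ℕ := [
  0x853c97f000569a477f0005b5c717f0005]

/-- Hints for degree four, 5 vertices. -/
def hf5 : ℕ :=
  0x0

/-- The spheres with 5 vertices. -/
noncomputable def L5 : List TL := nextL 4 128 L4 hs5 hf5

/-- Hints for 6 vertices. -/
def hs6 : List ℕ := [
  0x9476b7f000578de97f0005c50137f00044c229ff000498453ff0005]

/-- Hints for degree four, 6 vertices. -/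
def hf6 : ℕ :=
  0x98453ff00057cad1ff0005

/-- The spheres with 6 vertices. -/
noncomputable def L6 : List TL := nextL 5 160 L5 hs6 hf6

/-- Hints for 7 vertices. -/
def hs7 : List ℕ := [
  0x6ffb75fc00536e17dfc0056ffb75fc00136e17dfc0035c8cfbfe002b,
  0x12e00cff001c4998eff001dc319f3f001d2a3247f001caf1c6ff001ce09957f001c9fe24ff001d]

/-- Hints for degree four, 7 vertices. -/
def hf7 : ℕ :=
  0x12e00cff00049dfb0bf00044998eff0005ad879bf00058262ebf0005c319f3f00050f8c8ff00052a3247f0005b0b3b7f00049fe24ff0005c8cfbff000536e2b7f0005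

/-- The spheres with 7 vertices. -/
noncomputable def L7 : List TL := nextL 6 192 L6 hs7 hf7

/-- Hints for 8 vertices. -/
def hs8 : List ℕ := [
  0xc31c6a2dff0004618c30619,
  0x1b768bff0065b768bff0025b768bff0045b768bff0055b768bff0015f,
  0x30a2931831430c,
  0xdff6ebf80269c64fdf80069b715bf8026cdb8adfc003738c9fbf007536e2b7f0075,
  0xc90887f006dad7067f006dafe2e3f006cd130cff006dac885ff006ce08223f006db06e1bf006cdb85f7f006ce23afff006d]

/-- Hints for degree four, 8 vertices. -/
def hf8 : ℕ :=
  0x35ae0cfe001b8fa107e001992110fe001b5ae0cfe0009c6d147e001b5fc5c7e0009a2619fe001b6b315fe001b5910bfe0009c10447e001b89d407e001b60dc37e000b919f7fe001b919f7fe0009c8cfbfe001a7193f7e001a6dc56fe001b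

/-- The spheres with 8 vertices. -/
noncomputable def L8 : List TL := nextL 7 224 L7 hs8 hf8

/-- Hints for 9 vertices. -/
def hs9 : List ℕ := [
  0xe39c7c4e9f0004618618e38619,
  0x71cfb8e7,
  0x3739f43e034b739f43e014b739f43e024b739f43e02cb739f43e00cb739f43e01cbf,
  0x1c53b39f0014e714ece7c07919c53b39f0115b933,
  0x1c71c32e38e38c31,
  0x61c61c8c9f2e03ab71c718618,
  0x61c51c60c51c31850c,
  0x1bcc081f80dabcc081f803a73de6040fc02d6f30207e026b,
  0x71861c61c71c718618,
  0x1c12ce2e00198b9844a2ff01f571c718618,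
  0x323344ae011a7193f7e0119a173cae011a6dc56fe011a545ec2e011b919a257010cd0b9e57010d2a2f617010d36e2b7f010d38c9fbf010d,
  0x71a8b7fc03371a8b7fc07371a8b7fc04b71a8b7fc00b7fc6a2dff018d,
  0xc905a1700adad6d81700adc2e5bef00acd13f50700adc72564700ace0938af00adc2c5d7700acdb8311700adb06281f00ace23afff00ace35d09f00ad,
  0x1664fc0e035b3eaad6e0359664fc0e00d941d47ee00d941d47ee035b198d28e0359b70622e0359c8c9f2e0359b70622e00dbbfedd7f01ad]

/-- Hints for degree four, 9 vertices. -/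
def hf9 : ℕ :=
  0x1bfedd7f000d85298470034db83117000d605458f0014a8874f700356054067001597b85b70034bac4f0700349fc8357000d959f23f00159c63383800adff578b801ae4666cb801a9c64d4b800a6dc2fbf801a9c64fdf800a7233eff801aae73163800ae0f7edb800a3c3f263800ad6b6c0b80026ec3fdb800ae172df780025ab9333800acced233800ae392b2380024b099bf800abd3d8bf800ae162ebb80026273443800ad4a7343800ad83140f8002b03618f800ae467dff80023e0228f800ae3516ff801ad81b0c7c0054e326a5c00566dbfa2e004b

/-- The spheres with 9 vertices. -/
noncomputable def L9 : List TL := nextL 8 256 L8 hs9 hf9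

/-- Hints for 10 vertices. -/
def hs10 : List ℕ := [
  0x1041c8913af0004618618619040619,
  0x41041060c104107,
  0x37991a5e0e0a0de646978182de646978242de646978042de646978342de646978142f99,
  0x1c8346af05850720d1abc06119c8346af0385c8346af0785c8346af0045c133,
  0x104101982082082033,
  0x39041dc82082e19,
  0x41041041038e4104170c,
  0x20820f233edec0316f58a0cc03138e1904c30c,
  0x4106dda1b5c0f16dda1b5c1716e39041b7686d701c4e39,
  0x2083fc107,
  0x716aaebc1a9716aaebc0a9716aaebc129716aaebc169716aaebc069716aaebc0e9716aaebc1e97f,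
  0xc1fe0f,
  0x820820f041040e39,
  0x20820fc1040e39,
  0x8208208304104107,
  0x82099e0c1019c7ffb1f0585,
  0x1c791fef0455071e47fbc01519c791fef0255c791fef0155c791fef0655c199,
  0x104104183041040e39,
  0x82082082082082080cdaff7cb8222e41599b8222,
  0x410410714ece7c13560c1040d565a170095de5fcdb804a,
  0x4106dda173c1311864c30c82030c762d9eb8262,
  0x82070c61c72061831830c,
  0x82081c62072062081c618,
  0x1040c35b2f0ec0756072061861860c,
  0x105e6040fc00d41060de6040fc1f56082f30207e07ab,
  0x783ff,
  0x41bfed8570474e397382081c71c,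
  0x41820c138c998f0475c8cfb7b007504107,
  0x8383b9041b9,
  0x41041041038e4104171c,
  0x1798103f010d798103f050d07bcc081f8306c106f30207e081b,
  0x40c30e6082082081c618,
  0x1bcc058b8046da920378046dc81c62061c618,
  0x1bcc081f8026bcc081f8226f798103f078dcdb8abec1636f30207e031b,
  0xdff6ebf80a60df51258046b91910fc02360820820818618,
  0x1e0c1e0f,
  0xe3516ff8296e3516ff8196e3516ff8056e3516ff8396ff1a8b7fc18b78d45bfe045b,
  0x81c72072072082081c71c,
  0xe38e41040db85a5704ad82081c71c,
  0x71c71c82081c82081c71c,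
  0x1c103a2e0f59c103a2e075b7040e8b80d67040e8b82d6e07040e8b81567040e8b8356b9,
  0x39ac88053026d820dc82081c71c,
  0x1c7c4e9f036dc7c4e9f076dc7c4e9f04edc7c4e9f00edffc7c4e9f066d,
  0xb327d83061d820f820f,
  0x72327cb80ceb9193e5c1a75c8c9f2e053ae464f97009ce464f97071dee464f97051d,
  0xc9054ef059dad6d2ef059dafdc71f059cd15820f059db04d3cf059ce09579f059dad32357059cdb8552f059dac7ad6f059ce23aad7059db060e57059ce35d09f059ce4295af059d,
  0x714ef7bc0e763dd027c1e74d2f127c0e74e906fbc01771c1c65c1e74e906fbc0e7714ef7bc1e74db7dfbc1e76ffb615c0e74e319c1c1e76718ce0e073b,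
  0xe28049780aebcc081f832ebad8eb7832ef14024bc1976eb63ade08bb8a0125e08bb8a0125e04baeb63ade04baf30207e04bb798103f045d,
  0x1c70c417035dc70c417055dc84bf1700ddc84bf17075dc84bf17055dc84bf17035dc70c41704dddff6c2b81aedff6c2b82aef,
  0x26974b5c0b763fbc93c1b7716586bc0b76f0244dc1b7611118bc0773824b97c1b7649c6f7c0b72de5b95c1b72de5b95c0b77198d28e0dbb198d28e05bb]

/-- Hints for degree four, 10 vertices. -/
def hf10 : ℕ :=
  0x6405eff8016c7f78e580065bcb72b80364d2e96b8006c7f792780064d2e92980060f56f7b8016e3df8e78036279218f8016e465f0f8016c9c1d578006704972f800670496ed8006e4e0e8ac00332b94a5c00b610b0ddc00b7233edec003611118bc0037233effc003611116ac003324138ec00338a34b5c01d6ffb615c00b71c3105c00538a3494c01d71c30e4c00538f3354c01d38f3375c01d6fdbc83c0055c0fe49600188ba2cc60019b704a760069a7e4f460019b70b4ae00e9b70b3a600eb919eb9e002b919f6f60029c8cfbfe00eb919f7fe0029c8cfaf600e90ae3156002b7c84f9600a8932a976001b7dbbe56002881e5f1e00ab5f67df600288b93f960018afa68f60029c131d9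6001b7c8509e00a9c8c877600182b2365e00695e3795e006b9198376004b0893bae009a6dc4cae009b919eb9e004b919f6f6004a6dc56fe006b919f7fe004b08945fe006b095ac2e00cb1ee803600c837ce7c6006b90a232e00cb1ee813e00cb90a222600ca697893e00ca697883600c95e37646006b8167f1e00ca86a2b2e00c9c8c8776006af300bde00ca6dbefde00caf300ad600cb919eb9e00caf2facfe00cb919f6f600ca6dbf81e00cb919f7fe00ca6dbeed600cab9de85e004b83df32e0048f10ec5e004b5ada5de0009bb0f72e004b5fb8e3e00096ae8cbe004b33b88be004b609a79e00092c29c9e004af4f989e004b5a646ae0009afe115e004b78b0d5e004b58f5ade0009bba1c1e004b847181e004b60c1cae000ac16989e004b919f7fe0008f899c9e0049b70612600ebbfedcfb0075eab2a866002b3fb8726002ac16989e004b919f6f60029c8cf0a600abbc9f59300655c00d130065bd4f4db8032e30df898032e467dbd8012e467dbd8032de602c5c0115e602a4c0116f30207e008b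

/-- The spheres with 10 vertices. -/
noncomputable def L10 : List TL := nextL 9 288 L9 hs10 hf10

/-- Hints for 11 vertices. -/
def hs11 : List ℕ := [
  0x1249c8adb7f0004618618618619248619,
  0x924924c924924924927,
  0x6f4da17c60149bd3685f2805bd3685f0405bd3685f3805bd3685f1405bd3685f2405bd3685f3405f99,
  0x7228877cb0149c8a21df0c0467228877c7017228877cf017228877c0817c933,
  0x124921992492082492641,
  0x49249249249241049249820,
  0x924ffc927,
  0x64ffc933,
  0x2492493249249249249041,
  0x92493fc9249041,
  0x124926f32348c6c17f233efcc2c164924c1,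
  0x49249bcc8d233b05ef32348cfc17233efccbc17233efccac16492483,
  0x1249326724992433,
  0x19264cfc999,
  0x2492493249249249249041,
  0x41279068c26760bf919f6c6160b249c1,
  0x49248664c906492483,
  0x124933b8619c8cfb633205248619,
  0xe39b88a1472d8466e22851c76176bfdf2e3b09c30cdaff7cb96c292619,
  0x4924124103924921921930c,
  0x724b919ca9cce16e38648e4672a72385248e19,
  0x92093c9049249249041,
  0x924920924824824924920820,
  0x2492492e3924924924970c,
  0x24920e080c82092492080c,
  0xe38e38e38e39249c8cfb631a05248e39,
  0x24824f233ef9c1e16f58a27c1e149249249218641,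
  0x4924924924924924924980c,
  0x9249325c72493248e39,
  0x1041264924924924924820e467db786c2,
  0x1041dc92093239720e467db785c2,
  0x49249fc924927,
  0x193fff,
  0x4927fe4f,
  0x924924f249249249c8cfadf1685c8cfadf1705,
  0x4924927c9249249041,
  0x9249249324924924927,
  0x24924924924924924924c1,
  0x1249249c9c8cfbf3334524124927739f1fe2308c,
  0x124927e0824924cc,
  0x924dce7ccd9a62dce7ccd8a62dce7ccd8662f041249b9cf99b24c5041,
  0x924ffc927,
  0xe3d170f9b62e3d170f8b62e3d170f9362e3d170f9762e3d170f8762e3d170f8f62e3d170f9f62e3d170f80e2ff,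
  0x327fe4f,
  0x2492493f249249041,
  0x92493fc9249041,
  0x24924924f24924927,
  0x924924938b55746404bc8cfbf3002524924927,
  0x24924fe4c927,
  0x4927fe4f,
  0xe422a6f9f1219d9c7598e2e422a6f8f12e422a6f9092e422a6f8092e422a6f8892e422a6f9892ff8fd563e638b,
  0x124927f249249041,
  0x49249249249249249249c8cfadf3685c8cfadf3705,
  0x1249249f24924927,
  0x2492493e467df98992c9249249bc2654f0325de132a79412,
  0x9249249249324924927,
  0x924924c9264924924cc,
  0x49249f83919f7e61a4a4924cc,
  0x924fe0c927739f31e228b,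
  0x24dce7ccd8552dce7ccd8d52dce7ccd9552dce7ccd9d52f064dce7ccd9952dce7ccd8952c1,
  0x4924927c9249248e39,
  0x1249249e082491c920820,
  0x824924dce7d039f52e467df98f5282082471c91c720,
  0x924824820820820924920820,
  0x49248e7c9249248e39,
  0x2492492493919f6de5d4a4824924920720,
  0x2492492493919f7ce5d4a0824924920820,
  0x24924924e482471c91c71c,
  0x924924f24123924930c,
  0x24924dce7ccd9ad2dce7ccd86d2e082071c70c30c,
  0x1249b9cf9831f446720accdcb697905666e3b4a61864930c5f992378fa2,
  0x4926e73e60cbd119f249249c8cfbf32da4619,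
  0x1249f9927233ed8cdd16619,
  0x820824820824824924920820,
  0x2492433264c9249219c824b3f2c05,
  0x49249264c924924927233eb7cc6141,
  0x924924924924924924920d18571f82c2e4168a79902,
  0x824924e4c104926080c,
  0x9249249327233efcc2194104924930c,
  0x924938a7663618cb83041249c53b31b3465041,
  0x9249933264c9271fd92fc72119,
  0x39115d3e34ca4e44574f9532339115d3e74c8ce44574f8332e4c933,
  0x92490cc993249249041,
  0x924924924c924924927233eb7c26141,
  0x4126e73dbbcc3149f26493041,
  0x124924992e49249248e39,
  0x92492492472482471c91c71c,
  0x49241241820820924920820,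
  0x1c91c2ea20e1acb7ac84561f49b1f71a61f4bb9cf9cb0fa4d7f0b730fa5218e4672a70d64d5659c30fa5bcbf9630fa4639,
  0x1241241c9249248e48e39,
  0x924924924924924924920820,
  0x624697a5fd8022918924924624601071ac600898618,
  0x3124991c918918618318618,
  0x4924926492492492492f30207e66cb,
  0x24e4fff,
  0x24c9260e092493041,
  0x9304992f30206609cb919f7e631ca082493041,
  0x49249249249241049249820,
  0x127264fc927,
  0xffff,
  0x49c9fe4f,
  0x124924992493249249041,
  0x82f301f766fca08326f301f762fcb924920820,
  0x24924924924924924924c1,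
  0x24924932499324927,
  0x24c9264f919f7e66fcb24927,
  0x9393f924f,
  0x24924924924c9c8cfbf307e524927,
  0x93264f06492483,
  0x1249264938324927,
  0x393fe4f,
  0x82071c71c92482072472071c,
  0x937fdb0ae6e29c9326082071c71c81c,
  0x3992491c72482471c71c71c,
  0x92e49f249c8cfb6324e5248e39,
  0xdb854273894db854271894e49b6e1509c22536e1509ca2549236e1509cc256e39,
  0x72339539a4ab923919ca9c5255c8ce54e4929c9247233953824a92e39,
  0x104924924e3265ac3c539249249249720,
  0x412418271934e66e2b7fdae566e2a0920924920820,
  0x48e3923826289c0a55c13144e7929c924704c5138e4ac8e39,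
  0x1c7327938399b3c94e49264e0e69c8a549c8cfbf33c94e39,
  0x824920f249249249041,
  0x1238e41844a1f7269572492471c71c71c,
  0x49241064924924924920820,
  0x24924924924924924924e2808e7864a820,
  0x417980fbb0e9506e3904992472081c,
  0x92f301f461d2a0f924b923971c,
  0x71c71c71c71c924e467db1967292471cbad76f39672,
  0x1798103f1995798103f39952e001a70595dc4ffcce532a5c0034e532a4925c0034e132af30207e532ae39,
  0xff924e473,
  0x2f30207e0f2af30207e4f2a0f798103f3b9592492492f30207e372b,
  0x3241bfedc6b0194e7249249248e39,
  0x3249249249249249249041,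
  0xe4f924924924c1,
  0xbcc081f8a2a9249338c9f9b0195bfedd5b019524924924971c,
  0x81891c82092482071861861c,
  0x48c3992471892471861c618,
  0x92492492492492492491881c,
  0xe28030b0c55c3193e70c5445c6d430c5572071881871861861c,
  0x1bcc081f812abcc081f912af24925e6040fcf156492f30207e38ab,
  0x1fffb1,
  0x611289ec6557844a27b0955c1041924920820,
  0x9517ac99aaabcc081f8aaa6f579298aaaca8bd64c5555bd5e4a64aaa545eb264aaaf30207e4aab2492a2f5930555041,
  0xd0b9dd30355685cee98eaa685cee99eaada173ba65aaa545eaf64aaa6dc56ce4aab248d0b9dd30d55041,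
  0x3c9924924924924d8,
  0x6f30206616ab27233efcccd54924924924927,
  0x1bcc081f87aabcc081f97aae4924924924918618,
  0x24924924924924924924648e33f8f4a80278df8f4a713ea3f922a,
  0x820924820824920924920820,
  0x1bfedd7f3f54deaf2533f54d0b9dd33f5582082092061861c618,
  0x126492493264c927,
  0x79327e4f,
  0xffff,
  0x938d45af653aa082083060924920820,
  0x924924924c924924927,
  0x49824924e082493041,
  0x49249249249241049249820,
  0x49c9278324983,
  0x1264e467df99dea93060e3516f399ea924c1d7f168f81ea,
  0x24924924c9838d45ac653aa4924c1,
  0xe4c9f924f,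
  0x38d45bfe246b8d45bfe646a492493f1a8b7fc08d64938d45bfe786b,
  0xffff,
  0x41924924c9c9249041,
  0x49249249249249249248e467cdf19d4e23aedf19d5,
  0x1c924927c6a2de7383592492cc0629f3035,
  0x4992492493c6a2df30535c8cfbf3393524927,
  0x3ff924f,
  0xf249f924f,
  0x48e3923906492492492071c,
  0x7fc9e4b9,
  0xf1f4206c3ad7f23820742c2ad64e467df9995a73,
  0x1238e49e492492491c71c,
  0x48e4103820742c96d7919f7e60b6a4924924920820,
  0x38d45af65b6b8d45af63b6b8d45af67b6be0820924920820,
  0x2c82023b2db5c6a2d633db5f24924924905c,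
  0x38e41038206fac96d5c8cf9a64b6a482492471c81c,
  0x71c82082472492492491c81c,
  0x1271a8b5eceed49060720820924920820,
  0xf264c9e4f,
  0x38f89d3e08eb8f89d3e48eb8f89d3e68eb8f89d3e28ebff1f13a7c61d78f89d3e50eb,
  0x920824824824824924920820,
  0x1041049049248e23af7b1c75924920820,
  0x820820820924920924920820,
  0x36e0c24c29d36e0c24cc9d36e0c24ca9d76dc1849913a6dc1849893ae46dc18499e3a6dc1849813ac1,
  0x20dff5749833ac1924e0924920820,
  0x71f13a7c39d38af5edcc9d38af5f0c39d71f13a4cc9d3824e0acd9d3824e0ac39d7233efccc9d3824e07cc9d723824e0ac59d38af5f0c59d71f13a7c59d41,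
  0x838e4ab6e0ceb8f89d260cea493919f7e60cea4e27db0f833a820924920820,
  0x1c9fff,
  0x64924e4e4c927,
  0xe4fff233efcc85d7,
  0x924820820920824924920820,
  0x8249207232789847ac9820924920820,
  0xdb8309324f4db8309304f5241b6e0c24c63d36e0c24ce3d7236e0c24ca3d49041,
  0x820924920820820924920820,
  0x104924991c8c9df611ea0820924920820,
  0x67d558cc33d49267d558ccb3d6331a4bc13d36e0c1ec13d6083267d558ccd3d49820,
  0x7249fe4f,
  0xe464f9731f572327cb88fab9193e5c87d5c8c9f2e7de9c8c9f2e3debb9193e5cbbd5c8c9f2e1deb,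
  0x2492492493919f6de71ebc9249060,
  0x24924924937fdb9de61ea0824924920820,
  0x8208209246dc18438cfa72327c58cfadff6e778cfae467df98cfa924920820,
  0x1c927f24927,
  0x67d558cc6fd67d558ccafd2cc9f5acefd67d558cc1fd67d558cc9fd7e4cfaab1985facfaab1999fac1,
  0x3249249c1c9249820,
  0x1c8913af300dc8913af080dc8913af180dc8913af280db04d3c3040ccbe55c3380dffc8913af000d,
  0x1bcc02f78e06bcc02f79e0693de6017bcd035e6017bc30364ef300bde281b,
  0x126493088e92e541a4e111d25c2834992493088e92e241b,
  0x2718ce0e6c1a718ce0e2c1a6dbefde6c1b36df7ef160dcdb7dfbc9836ffb615c1834e319c1c9834e319c1c183736df7ef3a0d38c67073a0d,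
  0x24e4f924924f,
  0x24e4fff,
  0x24e4dd6c758ca437140248c2434924925e6040cc6437233efccc437,
  0x1bcc081f9046bcc081f8846ef30207e011b798103f3f0dbcc081f8f86de6040fcbc36f30207e1e1b,
  0x93249939324927,
  0xe493f924f,
  0x37fdb0ae3d1b7fdb0ae7d1bf7fdb0ae5d1bbfed857368dbfed857168dfbfed857068d,
  0xdff6c2b9cc6dff6c2b82c6c9effb615c66377fdb0ae531b7fdb0ae131a4f7fdb0ae631b,
  0x4924924926492492493c84bf17158d,
  0x38f7e39e271b8f7e39e571b8f7e39e171b8f7e39e671bfe3df8e79ec6f8f7e39e5b1b,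
  0x26974b2cce326974b2cde363fbc90cce370888c5e2f1b9383aa32b8d704972995c6f0888c467b1b919f7e67b1b0888c5e771b,
  0x24924932492492492499271bdf1f8d8fef24f1f8d,
  0xc90546b004dad6d26b004dc2e5097004cd15b30b004dac7e9c3004ce09891f004dc87a387004cdb858cb004dafd531b004ce23aef7004dc2c4013004ce35d01b004db060b3f004ce4295af004ce445d7f004d,
  0x38a9bf6e409b90ee726209b90ee726609b90ee726109b8a9bf6e509b8a9bf6e609b8a9bf6e209b8a9bf6e309b7980f37104d7980f37304df,
  0x1c500ccb344d798103f144d75b210b144de2806658a26dd6c842ce137140332ce137140332c1135d6c842c1135d6c842c9136f30207e089b798103f384d,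
  0x37fdb8ee249b7fdb8ee649bfdff6e3b8626dff6e3b9626dff6e3b8e26dff6e3b9e26f,
  0x1bfedc77364dbfedc770e4dfbfedc77164ddff6e3b9d26dff6e3b8d26dff6e3b8326dff6e3b9326f,
  0x177a850e7c9b4457ce67c9977a850e029b4457ce6029b1e63b0e029951d69e6029951d69e67c9b1e63b0e7c99c475dee7c99c8cf9ee7c99c8cf9ee0299c475dee029b8d45bfe029bc6a2dff3e4d,
  0x1c8b9eeb114dc8b9eeb214dc774823094dc774823314dc774823214dc774823114dc8b9eeb294dc774823294dbfedcfb294ddff6e7d88a6dff6e7d90a6f,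
  0xe2f55158ca6e2f55159ca6e2f551582a6e2f551592a6e2f55159aa6e2f55158aa6e2f551596a6e2f551586a6ff,
  0xc66346185a6c66346195a6c66346189a6c66346199a6c66346191a6fe331a30c7536331a30cf536331a30c0d37,
  0x71bb314c6d371c044ac6d371bb314ced37211558ced37211558c6d3720c422c6d371c044ac1d339193e5c1d371bb314c1d35b706126369b7fdb9f63699b706126769ae464f971b4d,
  0xe0f9ab38ba6e0f9ab393a6e3221cd93a6e3221cd8ba6e425f8b9ba6f1910e6cdd3713a7cdc5d3713a7cdc9d3709413ec9d3709413ec5d379097e2e4e9b9097e2e2e9b,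
  0x38bd54565e993d4d2d65e9b8ac3fd65e993c3be565e993d4d2d63e99589c6863e9b270755e3e99c125cbe3e9b8de90263e995dfceee3e9b8bd54563e9aaefe7772f4ce092e5f2f4c9fc7e2f2f4d]

/-- Hints for degree four, 11 vertices. -/
def hf11 : ℕ :=
  0x26a84e56021aac8fda601e92e130d602197d3c04601e8dd824f601e8140e24601e9b28c5a6021894bc85602193f8fc5e0019c8c803e001b270755e0019c125cbe001b89f57b602193fc3456021b89d362e00195dfceee0019c103926021b0888c5e001b919f7fe00195e2d35602196f2dcae01e92e3e0ae01eb198d28e01ea63e784e01e9ba8c05e001abf37d2e02eb84a09f6021b83e6ace006abf37d4602eb8c88736006b9097e2e0219c799b96001b085f85e03e9b9a3ab600188ba2f7e03e9c8c9bb603e9c273d9e001b89cc18e02eb89cc1a602eb89d3e6e006bc2504fb0034e467df3000ce08212b000dc84bf170035c8cbe130175c8cfbff0035c8cbe1f01746a2f6770074a416c6b00d5565cf270075c70112b0114a416c5f00d5c70111f0114ebc8bc300d4ebc8bcf00d5500480b0075bf640130114b796a5b007538c654b015592f75cb007467811b70074ae7b2f3007454615b301554bd4adf0075c8cfb6301153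8c998f00d538c998300d5c8cfbf301158449dd700d5c8cfbff01158449dcb00d574f9cd70175836f30b00b5ad6cc0b00f4d7d6af700551dd0f4f00b48f82eab005481a2fcb00358cc68b7000caf18c8b01742fc63c301f4914a30b00549188e6700b57c3d9a700b5c8cfbf3000c914a2ff0054e4677ab0035c8cfbf301f58cc68b70075c8cfb6300e58cc68c30075c8cfbf300e5c8cfbff0075c8cfbff00e5c8cfbf300746a2f6770174e0e33c70135ad6cd970075c5eaa2b0164e0e33d30135c5eaa1f0164d9462d301d4d9462c701d474db58b0075be4d91301659c632a580cae466425805ad353eab80ba2fe73b7803a46091cf80cacf4dff9803a7233ebd80ea7233eb780eae467db180b2e467df980b27233eff809ae467dff80b27233ef9809adff6e7d80fac21e0cf80ca0df380b803ae45cf7580f2c21e0d580cae45cf6f80f2c08824780cac08824180ca578c645803ae08e6e980f2949dcefc02536e0adac06d39193a3c06d53aaae4c01d149dcecc02540f3616c01d7233ed8c0794e327cbc0654e327cec0657233efcc07961128bcc0657233effc07961128bfc06532421f5c02d3e3a932c0796b5c00ac02d2ef50a1c0290521234c0792ef509ec029207ff32c045599a734c0452d0dc5bc0291d375e4c0795650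ce2c0796ffb5cac02d2f463f8c02936e17b5c02d7233d6ac0293477c26c0790cc4ca6c0797233ed8c0290eb5c1ac04526c62fac0457233efcc0297161b18c0797233effc02946d3d38c0793241382c0393e3a932c0596b5c00ac00d683f90cc06964aa542c059683f909c0690baf03ec0590d893a4c0595b8cfa1c069713a7e5c00d381fcc8c039684e8b5c01539193b8c079596c996c015655108dc06557d4d86c0657233d6ac07152cf0fdc03569a6544c0357233ed8c0717233efcc0715852411c0657233effc07165a51b3c0655e6a06cc049665625ec0496b61b8dc0657172aecc0094db16abc0497172ae9c0095e58b9ac0495e6a069c049714023fc0655441201c0096656261c04939190e2c07926df6e3c01910a9f2ac01931b9dd6c0197233d6ac051339fae8c0197233ed8c0512b1a22ac0050508a9cc0057233efcc0512d4a54cc0197233effc0512f319c8c019215c612c0712b92e1bc0291265522c0396fb77b2c071055ec3ec0296bed195c0711172951c03915f4ef5c0713826511c0392bc149ec02939190e2c0394e3265ac0256ffb5cac0257233062c0215d6bca8c055713f798c0557233d6ac0215e603eec0557233edec0557233ed8c0217233efcc0211cb4d69c0257233effc0216c2c2d9c02571537edc0615c6392ac0311265585c019721dce4c0615c6392dc0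31721dce1c0616e78987c06171537eac061713f78cc055703689ec0616f6c3a7c0313919124c01903b7abec0190c9b030c0197233062c0415e603cdc0617233d94c0315e603cac0617233ed8c0615e6027dc0617233efcc0617233dafc0317233effc0617233d91c031573ccaac021707be4ac0211e22d2ac0216b5b49ac0013761ecac02170b9425c0012d5d284c0216677204c0216b1fa70c001258545fc0215e9f3dfc021721e8e1c001313a036c0216a53fb6c0216bf54c6c00133a5b8dc0216cbfb0dc02170b1004c0012d3d724c02166576a4c0216c182cfc001582f731c0217233effc0011f157b1c0216f0244ac05d3824b94c05d6331a4ec05d70888c4600eb919f7e600ebc7bf1cf0075e386205805aeffb612c02d6ffb612c07527a9dffc0357233efcc0756ffb612c04d6e6890dc0357233efcc04d796946cf0195d852411c0652396528c0453f3a4b4c05919a2cc4c0591a8bcf8c0592de5ad8c0795d6c758c0157798103301959cb4d69c0250449828c0052ee8606c0055b607d8c0055a7b515600c9798ce4600ca9cdd8d600cb73490e600296a52a6600ca9d81616038b3fc2326038ac17b98e010b919f7e6022b7fdb9de02cbc8cfb7b0014e464f130015bfedd670165c8cfbe70015e467df98072e467df980f2f233edec0197233edbc0197919f6c600cb919f7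e600cbc8cfbe70065e3516b780d2cd4052580525de6d538052de5194780a2a9d411f80a2dea9aefc0517189a78c0517233efcc0297233edbc0497233ef9c049583327dc03165ff978c0316ce4885e0189513e95e018b919f7e6038b8d45ade004b968c0bf01855c2c9870185b0a051b80c2cc3931180c2d9e611bc0616803e04c0617233ef9c0217233efcc0517233efcc0317233edbc0617233ef9c0617233edec0117233edbc0117919f6c6008b919f7e6008bc8cfbe70045e467df98042de603eec0415e603ebc0416f30207e020b

/-- The spheres with 11 vertices. -/
noncomputable def L11 : List TL := nextL 10 320 L10 hs11 hf11

/-- Hints for 12 vertices. -/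
def hs12 : List ℕ := [
  0x1451c8c869f0004618618618618619450619,
  0xa28a28d145145145145147,
  0xdeadc3fb002a37ab70ff400b7ab70fe200b7ab70ffc00b7ab70fea00b7ab70ff200b7ab70ffa00b7ab70fe600bf99,
  0x7231c7fdc0151c8c71ffb00467231c7ffc017231c7fc2017231c7fe2017231c7ff2017231c7fd2017d133,
  0x51451451451451449251451924,
  0x5147ffa2899,
  0x1a3ffd133,
  0x28a28a3451451451451451249,
  0xa28a3e893d1451249,
  0x145146f4da17bb017a28f233effab0168a28c9,
  0x51451bd3685e1c05ef4da1780815147233eff9f017233eff9b0168a2893,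
  0x145147fe8a28c9,
  0xa289933a3451a2833,
  0xd1326667d199,
  0x28a28a3451451451451451249,
  0x24a3c8a21d11c05f47919f7e3580b451c9,
  0x51450668d1451268a2893,
  0x1c8a21df9e0547228877c781722887754817228877d7817228877f7817228877cf817e467dfea902d1f228877fb8119,
  0x5145067228877ff8151c8a21df010546893451419c8a21df7e05,
  0x20a26782080c33450619,
  0x28924a3249451451451451249,
  0x5145145145104145145145180c,
  0x1041041041041041451c8cfbf12805451041,
  0x28a28f47d145147,
  0xe4298dfb482a390a637f520b90a637e320b90a637fd20b90a637eb20b90a637f320b90a637e720b90a637fb20bf99,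
  0x5147ff45133,
  0x28a28a3451451451451451c8cfbe51605c8cfbe5dc05,
  0x51451468a3d1451451249,
  0x1451451a28a28c9251451924,
  0x28a28a3451e467dff7a82c9251451264,
  0x28a28ff24945133,
  0xa28a3a3e4928a28c9,
  0x51451451451451c8cfbfed505451451477991a2b1c08c,
  0x51451e467dff4982a3e4928a28cc,
  0x1451bcc8d232b05bcc8d23cb05bcc8d236b05bcc8d23ab05f249451bcc8d234b05249,
  0xa28a3fe8d147,
  0x5147fe8d199,
  0x145147a28f451451249,
  0x51451451451451451451451c8cfbe59605c8cfbe53c05,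
  0xa28a28d1451468a28a2893,
  0x51451e8a3a3919f7fd9e0a8a28c9,
  0x145147fa345147,
  0x145147e467dff2842f268a2833,
  0x28a28e8a3919f7fc010b93919f7fc5e0a8a2899,
  0x1451451451451468a28a28cc,
  0x145147919f7fc710a8a3919f7fc810b93919f7fcde0a8a28cc,
  0xa28ff9345193,
  0x51bcc8d23cc85bcc8d23ac85bcc8d232c85bcc8d23ec85bcc8d236c85f268de64691a642de64691c642c9,
  0x28a28a3451451451451451041,
  0xa28928924924924924a28a24924,
  0x28a288307d1451451041,
  0x51451451451451451451451241,
  0x1241241a28e4928820820820,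
  0x2492493451464924a28a24924,
  0x928a0cd1e4924828a24924,
  0x24a28fe4924820820820,
  0x28a28a28a28a344945145130c,
  0x145146f32348d2a17233effbca16f59069bca16f32348bca1720d751bca16492482080c30c,
  0x41041f83451d1041,
  0x41041f83451c8cfbf18d05451041,
  0x28a28a3451451451451451041,
  0x2892893251464924a28a24924,
  0x28a28a37991a47cd0b7991a462d0b264924a28a24924,
  0x24a28a3449264924a28a24924,
  0x1451451451451c8cfbfe268545145145190c,
  0xa28de64690e18233fa28d133,
  0xa28a0cfe8a28a28c1,
  0x28a28a3451451451451451241,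
  0x24a28a37991a46030b7991a47030b268924a28a24924,
  0x1451451451451c8cfbfefe8545145145130c,
  0x1451419a3a28d1451419c89d293ca05,
  0x391316ff230a8e44c5bf88c23391316fea308ce44c5bfe8c2e44c5bf98c2e44c5bfd8c2e8d199,
  0x51451468a345145145147233ef9538149,
  0xa28a28d145147233effbc6149251451264,
  0x51450668d1464928a2833,
  0x5145145147233eff92615147233eff82614945145130c,
  0x51451c8346a359854720d1a8f6616493249451c8346a39985249,
  0xa289933a28d1a2899,
  0x1a264ccce8d133,
  0x51450668e8a3451451249,
  0x145145145145145145145147233ef9738149,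
  0x4946f323364cc151a3a3468a3249,
  0x6899fc9d199,
  0x1451419a3451a3919f7fd1b0a8a2833,
  0xa28a0cd1c8cfbfe338545193919f7fc9b0a8a2833,
  0x28a28a28a28a28d145145130c,
  0x28a28d1d1264d147233effb16148ee240ef9185,
  0xa39068d47b70a8e41a3519dc2939068d47770b24993c8cfbfe75854720d1a8d6e1720d1a89d6149,
  0x28a28a3451451451451451041,
  0xa28928924924924924a28a24924,
  0x1041ff451d1041,
  0x41041fe8a3451041,
  0x145144993e467dbc1e42d1451451249,
  0x1451451a28d1451451451041,
  0x51451451451451451451451264,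
  0x51451468c9a28a28a2893,
  0x24a28a39068d46808b9068d47808b264924a28a24924,
  0xa28a28a28d1c8cfbfedf8545145145130c,
  0xa28fc1928c1041041,
  0x410720d1a84a6119a383451a3041,
  0x208203306083451c8cfbf18985451041,
  0x1451451a3251451241051041,
  0x928a28928924924924a28a24924,
  0x51451451c8346ad5845251c8cfbfed84525125145130c,
  0x28a2618618e18618619450619,
  0xe49c82b313f8446720acc4c1115ca28a2498e5c71c,
  0x1251a345065145125064c30c,
  0xa28a0c30c70ca2830c30c30c30c,
  0xa2893248e49249249451c8cfbfe7845249,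
  0xa28dc450a34a2233b9451a3450619,
  0x5145066e22851411151c8cfbf20444e51451451451249,
  0x5145146e22851dd116d7fbe5dd1151451451a28a1c30c,
  0x72080c81c728a3919f6c12208c70ca2871ce34ac724882,
  0x39451dc728a3451450e19,
  0x51451451451451451451450619,
  0x145146e3945145125145170c,
  0xa287233953ee22dc72891c8ce54f388a491ca3239,
  0x1451451d1451451451451041,
  0x51451068828928a28a20a20820,
  0x51451451451249451451451924,
  0x14510704124945141906080c,
  0xe38e6edecb1c8915c728a3919f7e20489c71ca2871cddbc22e8122,
  0x924a24a20a24928a28a0c32090c,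
  0x51051a20a20828a28820320820,
  0xa24a28a28a28a28924a28a2490c,
  0x71c71c71c71ca28e467db0288271ca2871c98363622882,
  0x28828d1451451451419450641,
  0x5145145145145145145145180c,
  0xe40e40638e5147233efc449138e19450e39,
  0x1451468d0e51451451450e39,
  0x24924dbb4365b92293251451249451b7686cbb245249,
  0x28a28a28a28a28a24928a28924e467df2d222,
  0x145145171ca28a24928a28dbb4323308271c,
  0xa28a24924928a24924a28a24924,
  0x5147724a24d1439451239,
  0x1041b7686d52a45d125144947233effa29151051049,
  0x28a28a28a28a28a28a28a28924e467db09222,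
  0x145145c728a28a28a28a28ddbd895d62271c,
  0x1451b7686cb9a45924924924924a28a24924,
  0x1451451e8d145145147,
  0xa28ffff,
  0x28a28ffe8f,
  0xa28a28f451449251451249,
  0x28a2893e8a24928a3249,
  0x28a28a28d1451449451451264,
  0x51451451451451451451451924,
  0x514514747233eff905151449251451924,
  0x28a28f268924928a3264,
  0x51451ffd147,
  0x1c81919f2545c81919fc545c81919f4545c81919f6545c81919fa545c81919fe545c81919f1545c81919f5545c81919f9545ff,
  0x1451ffe8f,
  0x145145147451451451451249,
  0x28a28ffd1451249,
  0xa28a3ff233effbf5168a28c9,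
  0x51451ff233eff94d17233eff80d168a2893,
  0xa28a28fa28a345147,
  0x5145147e467dff3da2a28a345147,
  0xa28a28a345145145145147,
  0x145145145145145145145147,
  0x5145147c8cfbfe1745c8cfbfe8745451468a28cc,
  0x28a28ff233effa6d17233eff82d17233eff98d168a28cc,
  0x28a3ffa28f,
  0x147ffd1c9,
  0x145147fa28d147,
  0x28a28ffe8f,
  0x1c8bb85f2cc5c8bb85facc5c8bb85fccc5c8bb85fecc5c8bb85f6cc5c8bb85f1cc5c8bb85f9cc5c8bb85f5cc5c8bb85fdcc5ff,
  0xa28a28e8a3451451451249,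
  0x51451ff919f7e3fa8b451c9,
  0xa28a3e8d1268a2893,
  0x1451451d1451451c8cfbfebcc545147,
  0x28a28fe8a345147,
  0xa28a28e8d1451a28a3e416a6bcba2,
  0x145145145145145145145147,
  0x1451451a28e467dff7562a28a3919f7fdf98a8a28cc,
  0x51451e8f233eff92b151268a28cc,
  0x5147fc9a393,
  0x5145147d1051451451041,
  0x1451451e4924a28a28a24924,
  0xa28a28a28924a28a28a28a24924,
  0x51449464924924924a28a24924,
  0x1451441f041451c8cfbf1c145451041,
  0x145145147919f7e5c38a8928928a28a24924,
  0x145145147919f7fbc38a4928a28a28a24924,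
  0x51451451c8cfbfe89c5c8cfbfe09c5451451451451920,
  0xa28a28f449449451451924,
  0x28a3905a29fd38b905a29f338b905a29e338bc82d14fd9c582030ce619,
  0xa28a3f041451c8cfbf19145451041,
  0x1051fc105147c8cfbfe99c5019,
  0x928928a24a28a28a28a28a24924,
  0x10514783041451d1041,
  0x10410783041451c8cfbf1d145451041,
  0x51451e8d1051451451019,
  0x1251449a3919f7fb238a4a24a28a28a24924,
  0x928a28a28a28a28a28a28a24924,
  0x14514783041451c8cfbf1f145450641,
  0x14510783041451d1019,
  0xa24a3d1451451451451249,
  0x124927c144946099019,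
  0x28a28e8a28a28a28a28a2430c,
  0xa28a28a28a28a28a28a28a24924,
  0x51251a28a28a28a28a28a24924,
  0x5147f041451a2883,
  0xa28a3d1451451451451c8cf62c5785bcc8cc79d05,
  0x1449fa28a28a28a2883,
  0x28a28a3451451451451451c8cfbf2d5c5da9239ff4e2,
  0x28a28a3fd145147,
  0x347fffc89bdf3c545,
  0xa28fff4790214e7598b,
  0x51451451f451451451c8cfbe502c5c8cfbe5e345,
  0x1451451fd1451451249,
  0xa28a28a28a345145145147,
  0x145145145145145145145147,
  0x28a28a28f45145145147,
  0x145145147233eff9d09745145145147,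
  0xa28a28fe467dff4212d125145130c,
  0x51451fe4928a264c,
  0x1451c5aaba3a225c5aaba32225c5aaba36225c5aaba3e225f249451c5aaba3c225249,
  0x28a3ffd147,
  0x1c88d1df1a25c88d1dfea25c88d1df6a25c88d1df5a25c88d1df9a25c88d1dfda25c88d1df3a25c88d1dfba25c88d1df7a25ff,
  0xd1ffe8f,
  0xa28a28ff451451249,
  0x28a28ffd1451249,
  0xa28a28a3f45145147,
  0x28a28a28e3d170f7092fc8cfbfe212545145147,
  0xa28a28a28a345145145147,
  0xa28a3fe8d147,
  0x1451ffe8f,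
  0x119d9c71c312ffff,
  0xa28a28ff451451249,
  0xa28a28a3d1451451451c8cfbe582c5c8cfbe51345,
  0xa28a28a3f45145147,
  0x145145147a345145147,
  0x145145147451c8cfbfe132545145147,
  0xa28a28a3c8cfbfebb25451c8cfbfe932545145147,
  0x51451451c8cfbfe4725c8cfbfe7b25451c8cfbfe532545145147,
  0x1451451fd145145130c,
  0x51451fe4d145064c,
  0x28a3fe4d1478b55745c04b,
  0x51c5aaba320a5c5aaba360a5c5aaba3a0a5c5aaba3e0a5c5aaba310a5f268e2d55d1e052e2d55d1a052c9,
  0x1451451fd1451451041,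
  0x145145147a24a28a28a24924,
  0xa28a28a3e467dff0452a24a28a28a20824,
  0x51451451e467dff6452e467dff4452924928a28a24924,
  0xa28a28a28a28924928a28a24924,
  0x28a28a38b55746d14b8b55747d14b924924a28a24924,
  0xa28a3fd1451451041,
  0x1451451468e8928a28a24824,
  0xa28a28a28a28a28a28a28a24924,
  0x51451451451a28a28a28a20820,
  0x28a28a28fa24a20a2883,
  0x5145145147c8cfbfe44a5449451451824,
  0x28a28a3f24925145190c,
  0x51451c5aaba3cca5c5aaba32ca5c5aaba3aca5e4924828a2490c,
  0x5145147f45145147,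
  0x145147fa28a3c1,
  0xa28a3fd1451c8cfbfe42a583,
  0x924924924a24928928a28a24924,
  0x24a28a24e4928924a28a24924,
  0x928a2893919f7fd554b8b55745554a4a28924a28a24924,
  0x28a28a3e0d1451451041,
  0x1451419fd147233efc79097041,
  0x1041041f068a3919f7e2284b919f7fcf54b041,
  0x928a28928924924924a28a24924,
  0x51451e8e8d145147,
  0x28a28ffa347c8b313364c5,
  0x347fff8ff2e676a8b,
  0xa28a3d1d145145147233ef974b149,
  0x1451451451451451451451449c8cf62c3a85,
  0x5145147468a28928a2893,
  0x145147e8c925147e416a6bca12,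
  0x1451451451468a28a28a28c9,
  0xa28a28d1468a24a28a28cc,
  0xa28a3a3a3919f7fcd34a4928a28cc,
  0x145147f468d147,
  0xe45228ffed219d9c718292e45228fbed2e45228fc1d2e45228f81d2e45228fa1d2e45228fe1d2e45228fd1d2e45228f91d2ffc8220e30525,
  0x51451ff468f,
  0x28a28f451a3451451249,
  0x51451451a28d145145147233ef94cb149,
  0x28a28ff468a3249,
  0x145145145145145145145147,
  0x28a28fd1a345147,
  0xa28a3f233effbde968d1a28a3e416a6bfd92,
  0x28a28a28a28d1c8cfbfedba545145147,
  0x51451468a3468a28a28cc,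
  0xa28a3a28d193919f7fc374a8a28cc,
  0x5147fc9d193,
  0x28a3ffd147,
  0xd1ffe8f,
  0x1451451d1d1a28a2893,
  0x145147fe8a28c9,
  0x28a28a28d1d145145147,
  0xa28a28fe8d1451c8cfbe5b325c8cfbe5d125,
  0xa28a28a28a28a28a28a28a3c8454dfaa65,
  0x51451451451a28a28a28a3908a9bfd4cb,
  0x145147f051451451041,
  0x28a28a28d1451451451451041,
  0xa28a24fa28928828a24824,
  0x5145147c8cfbfe2665924924a28a24924,
  0x28a28a28a28e467dff2332924928a28a24924,
  0x1451451a28c9249451451924,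
  0xa28a3c9924924820a24924,
  0xa28a28e8c1451451451041,
  0x51451fe8a3919f7e2334a8c1c815cf3d2a5,
  0x51451fe467dfe0352d147233efc666951c8cfbfe6e65041,
  0x104107fa28f041,
  0xa28a28a28a28a28a28a28a24924,
  0x24a28a24e4924924a28a24924,
  0x125145147233effa25964a24a28a28a24924,
  0xa28a28f251251451451924,
  0x28a3fa3451451bc2654ce6a4619,
  0x28a28a28d1451451451451249,
  0x928928a24a28a28a28a28a24924,
  0x5144947919f7fb52cb25145145145130c,
  0x28a28fc1a28a343618288eda119,
  0x5147fc5aaba7caa5a28e619,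
  0x28a28fd1a28a28e467dff52b283,
  0xa24a24a24a28928a28a28a24924,
  0x51451c8b2895a8e17068a3919f7e32b4b419b9cf3d51385,
  0x28a28e8a3451451451443a3934e78119,
  0x924a24a28a28a28a28a28a24924,
  0x24928d1468a28a28a28a24924,
  0xa28a3d1834514514182a266d3fd85,
  0x145147e0d147233efc5d696899,
  0x144947451451451451451249,
  0x24928fa344941932430c,
  0x124947468a2892432832430c,
  0x924a3919f7fba6ca8a3919f7fc76ca8a28a28a28a24924,
  0xa24a3919f7e5a6ca8a3919f7fd76ca8a28a28a28a24924,
  0x28a3fa345145147,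
  0x1ff068e467df8e832d1c1,
  0x2493fa345145193,
  0x1249fd1451451451041,
  0xa28a28a28a28a28a28a28a3bcc8cc71d05,
  0xa28a3e8a28a28a28a3747e38ef34b,
  0x28a28a3468a28a28a28a24e467df93cb2d48eda25352,
  0x1451451c8cfbfe18e5468a28a28a28a3c8cfbf26d65,
  0x145147468a28a28a28a38df4fabf842,
  0x1451fa28a28a28a28e4,
  0x51fe0d1468a3b9cf98e09a5,
  0x3fe0d1d183,
  0xa3fd1451451451041,
  0x51451a28a28a28a28a28a3bcc8cc77085,
  0x5147e8a28a28a28a3747e38e5f4b,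
  0x28a3739f33415cbe467dff7972d145145145147,
  0x28a28a3451451451451450e39,
  0xa28a24f451451250e5c924,
  0x5145147c8cfbfe3ae5251449251464924,
  0x24a28a3c8cfbfe06e5c8cfbfebae545144925145c724,
  0x51451451451451449251451924,
  0x824924824828828a24a28820824,
  0x924928924a24a24a24a28a24924,
  0x51449460820828a28820820820,
  0x5145147d1451451450e39,
  0x28a28a28a3451451451450e39,
  0x51451451451451451451451264,
  0x28a28a28e8a28724a28a1c71c,
  0xa28a28f45144925145170c,
  0x51251251a2091ca2871ca2071c,
  0xa28a24a28928928a28a28a24924,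
  0xa28a28f441439451450e41,
  0x924a24a28a28a28a28a28a20924,
  0x49451451820a28a28a28a2080c,
  0x24a28a3a20a1c928a28a1c724,
  0x51451deb1d1fdf72d1451451451451039,
  0x51451468a28a28a28a28a0c80c,
  0x92490cf928a24a28a24924,
  0x1451419c82b33681e5d145127233eff807951450639,
  0xa28a28a28a28a28a28a28a3c82b337e1e5,
  0x28a2833e8a28a3450619,
  0x28a28a3d145127233efc407951451239,
  0x1451451468a28a24928a28924e467df2db72,
  0xa28a28a28a28a28a28a28a3739f40bc3cb,
  0x1451451f233eff92795145127233efc70795145130c,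
  0x514667a5816a745c545147450619,
  0x51450619d1449268a289245f992b424e2,
  0x51250651d145147233eff817951451249,
  0x145147d1451b9438e39,
  0x28a28328d145147233eff89797233effa17951450e39,
  0x51451451451451451451450d5659afe1e5dce7d02d4f2,
  0x51451ee65394c3797233effb57950651dcca7296af230c30c30c,
  0x51451c8cfbfe4de5f233eff8d7950651b5fef6b35e530c30c30c,
  0x28a3f44927451c8cfbfef9e5249,
  0xa28a28a28d1451451451419c8292537005,
  0xa28a28d1a28a24928a3249,
  0x28a28a28a28a28a28a28a28936bfde5f708a4,
  0x51451451a3919f7fd87ca4a24928a330c,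
  0x28a28a346883451c8cfbf103e5451041,
  0x28a28a28a28a28a28a28a2883461638f688a4,
  0x51449449924924924a28a24924,
  0xa24a24e4d1451451451249,
  0x1449449d1451251451451049,
  0x28a28a28a28a28a28a28a28934615c56888a4,
  0xa28a28c9c8cfbfe4be504125145065190c,
  0x51450651a3041451c8cfbf123e5450619,
  0x28a28a28a28a28a28a28a28334615c57f088c,
  0x51451a3060828a3451041,
  0x49251a34514514514514720d191ca6141,
  0xa28a28a28a28a28a28a28a20d1858a1c082da9239fc082,
  0x12494714ecc6e1f968c10512714ecc6c1f951060824,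
  0x1451419a3468d1451471feaf4f68119,
  0x28a2833468d1451451449c7ffab7f385,
  0x145145145145145145145147233d8b2a1149,
  0xa28a28a28a3451451451419e416a6be4c2,
  0x51451451a347233effb5f94925145130c,
  0x51451c791fe3cfe5471e47f8cbf94993249451c791fe34fe5249,
  0x5144c99a3468d1419c823583a585,
  0x1c8ad057bfe54722b415cff919c8ad0577fe46722b415fff919c8ad0570014668d199,
  0x51450668d1a3451451249,
  0x51451451468d1451451449c7ffab77385,
  0x1451451451c88ae9ee015451c8cfbfee01545145147222ba7e40519,
  0x3739bef996ca8e44574f980a339115d3f60290ccde9e36cb9115d3ee02bba3eebb1b6593452d606032d97c88ae9f5015,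
  0xa28a0cd1a3051451451041,
  0x51451451468824a28820a20820,
  0xa28a28a28a28924928a28a24924,
  0x1451251271e47f8ea0549924924820a2430c,
  0x51451468d107233eff04f95147233efc4df97233eb71a1151041,
  0x928a24928924a24924a28a24924,
  0x4147233d6d59f16f5909def997ee8fc89ee5968a3c8cfadcfe65c8cfadcfaa5041,
  0x51451264e4d1451451249,
  0xa28a28d1d1451441451041,
  0x145145145145145145145147233ef60fe149,
  0xa28a28a28d1451451451449e416a6bdfc2,
  0x24a28a38f23fc6682b8f23fc7682b264924a28a24924,
  0x51451451c9c8cfbfe141545145145190c,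
  0x1451451a3451451451450e39,
  0x51451468728a28724a28a1c71c,
  0x51451451451451449251451924,
  0x924a24a20820a1c92482030c70c,
  0x72870ba8830e0adeb213bbcf233b9cfa1779e4e50678a7673fd82b450639,
  0x28a28a28a28a28a28a28a2868cb8979622db0089b9622e416a6b9622,
  0x5105107c8cf643bae5051450e51450e41,
  0xa28a28a28a28a28a28a28a20720,
  0x51449464924924924a28a24924,
  0x828924720624a18a0c71832070c,
  0x51451468a28a28a28a28a2f30207ff82b,
  0xa3a3fff,
  0x51451451451451449251451924,
  0x51d1a3fd147,
  0x3ffff,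
  0x14747fe8f,
  0x28a28a3451451451451451249,
  0x125e6040ce84549268de6040cc8456f302067822ba28a24924,
  0x28d1468a28d1268a28c9,
  0x1468a347de6040c704568a2893,
  0x1468a3451451c8cfbfe5115268a28c9,
  0x51a28d1f233eff92456f302062422b45147,
  0x28d1468e467dff428af233effb2457919f7fd422b45147,
  0x51d1ff451c9,
  0x51451451451451451c8cfbfe811545147,
  0x28d1a3f268a2893,
  0xa28a345147233eff964551c8cfbfe3115268a28c9,
  0xa37fdb8bf662a08307041451bfedc5f5315451041,
  0x93451a28d1251451451249,
  0x49249268a28928924a28a24924,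
  0xa3251a3049449828a20924,
  0x51451451451041451451451820,
  0x51451924924924924a28a24924,
  0x146083e0828a3451041,
  0x928a24c9798103d8b15451451451451249,
  0x49451451451041451451451820,
  0x24a24c9798103d6b15c8cfbf16b15041251828a24920,
  0x1041041041041041451c8cfbf18a15451041,
  0xa3451a28e8d145147,
  0x7a3fff,
  0x51d1a3fa28f,
  0x51451468a28d1451451449c8cfbe5e115,
  0x1464a3451e4a28a3249,
  0x28a28a28a28a28a28a28a28c9,
  0x51451468a3464a28a2893,
  0x28e8d1f249451c9,
  0x51451451451a3919f7fce12a8928a28e4,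
  0xa3468a39324945193,
  0x28a28d147464928a28c9,
  0x28e8ffd147,
  0x3ffff,
  0xf47fe8f,
  0x1451451a28fa28a28c9,
  0x51a28d147e8a2893,
  0xa28a28a28a28d145145147,
  0x28a28a28a28f45145147,
  0x51451451451451c8cfbfede9545145147,
  0x145145145147919f7fd032b45145147,
  0x1468a347f45147,
  0x51d1ff45147,
  0x5145145147d1c8cfbfe769545147,
  0x7ffe8f,
  0xa3468ff45147,
  0x1451468a3f919f7fddd2b45147,
  0x1d1ffa28f,
  0x147468a3e8d147,
  0x51d1a3f468f,
  0x3ffff,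
  0x51a28d1451a3451451249,
  0x1451451451451451451451449c8cfbe51115,
  0xa3451a28f468a2893,
  0xa28a28a28a28a345145147,
  0x28d1468a3c8cfbfec855a345147,
  0xa3a347c9a28f,
  0x51d1fc9a3c9,
  0x51451451451a345145147,
  0x51a3451f268a2893,
  0x1451468a28d193919f7fc60aa8a28c9,
  0x1451451a28a3451451451041,
  0x51451464a28924928820a20824,
  0x924a28a24924924924a28a24924,
  0x51451451451451451451451241,
  0x28a28a28a28e8a28820a20820,
  0x51828d1e4924828a24924,
  0x5145145145e603eece957449441451824,
  0xa3451a28c1a28e467df8b44ad1041,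
  0x837fdb8be4caa083041837fdb8bcf4aa8a3919f7e3d12a8e467dff3d2a820dff6b9af44a,
  0x1468a347d147233efc46255183,
  0x1460a347d147233efc662551c8cfbfee655041,
  0x14608308943bf3cabe112877fb956112877db955146112877eb957041,
  0x1251451a24d1451451451241,
  0xa28a28a24924a28a28a28a24924,
  0x928a28a24c9c8cfbfe7e55449451451924,
  0x28d147f45145147,
  0x1e8fe8a3f,
  0x1e8fe8a3919f7e2f12a8f,
  0x928a28d1d1451451451241,
  0x1451451449a28a28a28a28c9,
  0x24a2892893919f7fd6aaa8a28a28a28a24924,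
  0x49451451d1c8cfbfe5555451451451924,
  0x514519393451451451924,
  0x51d1fd14747,
  0x7ffa3f,
  0x28e8fe8a347233effa7557,
  0x24e4fe8a3919f7fdd6aa8e467dff2eaac9,
  0x28a28a3451451451451451041,
  0x9393f451451451041,
  0x28a28a3d1a28a28a28c1,
  0x5145127c8cfbfeef55468a28a28a3919f7e4bcab,
  0x28a2493c8cfbfebf55c8cfbfe1f55468a28a28a24924,
  0x51451451451451451451451924,
  0x28d1fc8cfbfe4f55a28a28a2893,
  0x147233effa43551fc8cfbfecf55a28a28a28c9,
  0x51d1fd147c1,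
  0xa3a3e0d147233efc79256883,
  0x51451451451a345145147,
  0x28a24924a28a3919f7fb14aa8a28a28a24924,
  0x28d1a28e0d147233efc55255183,
  0x1468d147068a3919f7e3a92a8e467dff7a6ac1,
  0xa3268a28d1451451451041,
  0xa3268a28a28a28a28a28c1,
  0x28c9a28d1a28a28a2883,
  0xa327919f7e3c1abbcc081267aac944947249,
  0x51451451451451451451451924,
  0x1449928a3919f7fd85aa8a28a28a28a24924,
  0x1468d1e0d147233efc532568c1,
  0x3a3f074783,
  0xa3468a383451451441ad8780cf8d5,
  0x1249268a28d1451451451041,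
  0x924928a28a28a28a28a28a24924,
  0x1249268a3464a28a28a24924,
  0x928a28a28d1c8cfbfeced5451451451924,
  0x7ffa3f,
  0xffe8a3a200a4a9846ab,
  0x3fef302079e3ab451e467dff18eaa2c91fa0ca355,
  0x1c9fe8a28a28c9,
  0x393fd1e893,
  0x3451a3d1451451451041,
  0x17981027a3d5798102763d527bcc081391eae8a28820820820,
  0x3451451451451451451451bfedd58af5536e2b58a2d5,
  0x3451451d145145145147,
  0x68a28a3919f7fce7ab451451451451249,
  0x1d1fc8cfbfe63d5a28a28a28c9,
  0x68a28f47233effa0f55145145147,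
  0xd1a3c1a28a28a2893,
  0xa28a28a28e467dff49eaa28a28a28a28c9,
  0x920724724a20a1ca28a28a20724,
  0x24d1451a20a1c71c71c71c71c,
  0xa2492471c82091c72871c72081c,
  0x1451451a3451451451450e39,
  0x51bfedd5b2fd4e397345144923945c71c,
  0x28a28a28a28a28a24928a2891c9c64cf6758a,
  0x5125146e51451928a3249,
  0x28a28a28b945144925145171c,
  0x28a28c9dff6eab97ea928a24928a391c,
  0x1d147d147a28b9,
  0x28a28a28a3451451451451249,
  0xe8a3e8a28d1451249,
  0x1d146db85426c83545147233effa20d68a28c9,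
  0xb6e1509b60d5147233effa60d5b70a84c506a8a28e467dff241ad145171c,
  0x2871ca3b9451a3450e39,
  0x5145127919f7e5dfab451451451451249,
  0x28a28a2e4672a61434e5145127233eff7bf551451249,
  0xd147723394c941aa28f233efc720d687371c,
  0x81c720b8e5147233ed811c538e39450e39,
  0x4145144e3269bddf57233ede1df551451449451051920,
  0x2871ca3b9451d1450e39,
  0x1249449dc924924a28a24924,
  0x51451468a28a28a28a28a3919f7cb286a4e467df2d7ea,
  0x1439451e1128bee70d39451a3450e39,
  0xa28a28d1451451451451464e0e69e88d39,
  0xa28a28a28a28a28a28a28a38a02696bfa9c578ddb9afea,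
  0x28a28dc724a3270734e246a49287325c,
  0x1451441d1451451451451041,
  0xa28920e8a24a28a28a3249,
  0x51441068a28928a28a28a20820,
  0x28a28a28a28a28a28a28a28e27f1ede61a920,
  0x51451464924a28a28a28a20924,
  0x928a20928a28a28a24820a20820,
  0x417980fbbaa3507451451449441451049,
  0x28c1a28820828a28820820820,
  0x28a28a28a28a28a28a28a28bad9383d61a920,
  0xe0fa28b8e39450e39,
  0x125e603ee2a8d41f451451451451249,
  0x124927a2891c71ca2871c724,
  0x49249844a2db9635e467dff331aa28a1c71c72871c71c,
  0x28928d1451451451451451041,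
  0x51451451451451451451451720,
  0x1798103f4e35798103fce35f798103f8e35a28de6040ffd8d68a2f30207eec6b,
  0x3fe8a28d1451249,
  0x68a28a28a28a28a28a28a32e001a70135,
  0x397000d3b09adc4ffcccfc6a5c0034dbc6a8a28bcc081f3f1ae467dff6f1aa28a25c0034e426b,
  0x5e6040fd44d5e6040f984d7919f7fcc26ae27fe66be352e001a6be3545145e6040f8f8d7233eff8f8d5145171c,
  0x3a347a28a345147,
  0x3fe8a3d1b9,
  0x17981033a535249a379810332535924924a28a24924,
  0x1ff451928a3249,
  0xd145147451451251450e39,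
  0x68a28a3c8cfbfecd35451451251450e39,
  0xd145145145145145145147,
  0x1fe8a28f233efc778d514600a371a426b,
  0x3a28f45145125145171c,
  0x7e467dff519af45147919f7e37c6a8a3249,
  0x1a3919f7fc666a8f451449251451249,
  0x514514514514514514514510df4eb99c1a24cc1b9ea1a,
  0x1798103f0735451a3798103ffb35a28a28a28a2f30207ef66b,
  0x1c1ffa3c1,
  0x68a347451451451451249,
  0xd145145145145145145143919c9ccd0d41,
  0xe8f924a28a28a3249,
  0xbcc081fc05aa28a3451249451451451924,
  0x3441bfedc754634e7451451451450e39,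
  0x1798103360b5248e51a24924924728a24724,
  0x1a28a28e467dff305aa24a28a28728a1c824,
  0xa28a28a24924a28a28a28a24924,
  0x3041f451451451451041,
  0xa20924928928924a24820a24820,
  0x7ee5147233efc47cd51451450e41,
  0x64e10d3d62d7e4e10d3da2d39451938434fa8b571ca2e39,
  0x37fdb9aef16b07a28a28a1c71c71c71c,
  0xc927451451451251450e39,
  0xa28a28a28a28a28a28a28a24824,
  0x51449a28a28a24a24a28a24924,
  0x5e6040ce92d7928928924a24a28824920,
  0x2883a28a28a28a28a20820820,
  0x5e6040ff52d5e6040fcd2d39b8e5147233efc402d38e39450e39,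
  0x64a28a28a28a28a28a28a24824,
  0x618728a28a28a28a2871861861c,
  0x324705e9d2d2451d499d2d68a28a28a1c618a28a1c918,
  0x1bcc081fc65abcc081fa65aa3a28a28a28a28a2f30207e196b,
  0x3fa28a3fb1,
  0xf47451464a28a3249,
  0x3d1a28a28a28928a28d8,
  0xde6040facad68e467dff195aa28a28a28928a2893,
  0x1bcc081fb55abcc081ff55ae8a28bcc081fd55ac9251458618,
  0x28a28a28a28a28a28a28a28924713ff19aa5a,
  0x7f45147d147,
  0x7f45147d163,
  0x7a28a28a28a3451451249,
  0xde6040cd7ad5e6040cf7ad792492f3020673d6ba28a24924,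
  0x7a28a28a28a28a28a28c9,
  0x3d1d1451a345147,
  0x7ffe8f,
  0x3ff233eff9a6d7e8f,
  0x7fc8cfbfee5b5c8cfbfee9b5de6040f496d74456438fa0b6b,
  0x3d1a28a3919f7fc236b468a28d8,
  0xf47233effbf6d51451c8cfbfe91b5a345147,
  0xfd1451d1a28a18618,
  0x1d1451451451c8cfbfe01b545145147,
  0x1e467dff35daa28a28a28a3919f7fd036a8a28a2863,
  0x145145145145145145145147,
  0x4e327cbdeed4136e2ae37bb5260820828924828824820,
  0x3f451468928820820818,
  0x611289ee9ed51a28a28a3919f7fcf76a8928828a24820,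
  0x68a28a28a28924928a28a24924,
  0xc22513d8bdad1a28a28824928820a18820,
  0x1bcc081fbbdabcc081ffbdaf798103fb7b5bcc081f9bdad1468a2f30207eaf6b,
  0x7fe8a28820820820,
  0xfd145145145145147,
  0x1bcc081f7fda6f57929203a9517ac9203ae467dff7fdaa28a28a28a28a28e28068dc89a951786ab99a6f576cab99a,
  0x1ff36e2b7c37b5a28d147,
  0x308945cf90ebc225173c43af08945cb9f6b919f7fb9f6a6dc56c89f6a8a28820820820,
  0x3d145145145145145147,
  0xfd145145145145147,
  0x68a28a28a28a28a28a28a00df47b6266b,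
  0x763451460a28e467df8a95ad0c41,
  0x29515cfc28b59517876245ad1451bfedd7c147505147233efc74ad7233effb91d51031,
  0x64a28924928a24924a28a24924,
  0xf924928a24a24618624618,
  0x68624928924a24a24628618918,
  0xa28924928928a28a28a28a24924,
  0x3f451460a28e467df8855aa2c41,
  0xfd1451d147233efc62ad51c8cfbfe1c75041,
  0x1fa28a3a28ec31,
  0x3464928924a24a24a28a24924,
  0x28a24e467df8c63aa28924a28a28a28a24924,
  0x32a2f05ee4b5c8cfbf2cc75a28928928a28618a18618,
  0x2893919f7e494ea8a24928a28a28a28a24924,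
  0xbcc081f553abcc081ff53af233effaa9d51449451451431450c31,
  0x48a3afdba5ae0828a28a28a2872871c720,
  0xa28a28a28d145145145147,
  0x28e8d1fe8f,
  0xf468fff,
  0x51a28a28c9a24a28a3249,
  0x28a24a24a3451449251464924,
  0x51451451451451449251451924,
  0x28a28a28c9a3919f7fc02ea4928a3924,
  0x147468d1e8d147,
  0x3ffff,
  0x28e8d1fe8f,
  0x1451451451a28a3451451249,
  0x28a28a28a28a28a28a28a28c9,
  0x1468a28a347468a2893,
  0x51a28a28d1c8cfbfe3d75a345147,
  0x51d1a3fa28f,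
  0x28a28a28a28a28d1c8cfbfead7545147,
  0x51d1468f268a2893,
  0x28d1c8cfbfe7b75468f268a2893,
  0x51451451a28a3268a28c9,
  0x3a347e4e8f,
  0x51d1a3fd147,
  0x1e8d1fe8f,
  0x3ffff,
  0x28a28a28a3451451451451249,
  0x51a28a28f233efcb4dd7d1451249,
  0x1451451451a3a345147,
  0x1451451451a3c8cfbfe6cf5468a2893,
  0x51451451468e467dff1e7ae467dff767aa345147,
  0x1468a28a3f919f7fba6eb45147,
  0x51451451451451451c8cfbfe54f545147,
  0x7ffd1f,
  0xa3a28ff45147,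
  0x3f919f7fc75ebfd1f,
  0x51a3919f7fcadea8ff45147,
  0xa28a28a3c8cfbfed2f5f919f7fd19eb45147,
  0x3a347fa28f,
  0xa38d45af6f3ea0a20a3464928820a20920,
  0x41820a28a20828928820820820,
  0x7041041f451d1041,
  0xe23aedfb5f4e23aedf35f5051051b88ebb7d57d388ebb7f57d514388ebb7e57d7041,
  0x3919f37c37d60a20a1c8cf9bfebeae467cde85f505143919f37dd7d51c8cfbfe85f5041,
  0x49451251451241451451451824,
  0x28820a20a1b70bcbf9beb041450db85e5f4df5451041,
  0x1251449449d1451451451249,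
  0x51451449268a28a28a28a24924,
  0x28a28a28a28a28a28a28a28dff6eac46fa924,
  0x28a28c9c1928c1441820,
  0x820820820820820a28e467df8e0baa28820dff6b9ae0ba,
  0x10745182083451a3041,
  0x8389d3e3e27eb051c10713a7c7bf7d514713a7c7e8fd51c8cfbfefdf5041,
  0x51c9268a28d1451451249,
  0x147049820828a28820820820,
  0x28e8a3a3451a20820820,
  0x28e467df95efa928a3c8cfbfecbf5041449a28824920,
  0x51451451451451451451451924,
  0xa344992483919f7fde7ea4924a28a24924,
  0x28e467dff6dfaa24c9441c8cfbfe0bf5451451451924,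
  0x1068dacc4effdfaa3041071a8b7f20fd5146d66277defd51afe2d1c83f5041,
  0x24c9c8cfbfd33f5268a28d1451451249,
  0x1468e467dfed5faa3451c6a2dfc4bf5451a20820820,
  0x28c9451451041451451451820,
  0xa24924a28a28a28a28a28a24924,
  0x71f41c7cdfd71f41c7edfd5183060e3e838febfaa28e3e838fabfad1041,
  0x1468a28c183451c8cfbf12175451041,
  0x1449449468a38d45af0f3ea8928a28a24924,
  0x924928a28a20e3516b07cfaa28a28a28dff6eac4dfa920,
  0x38da247c7fd38da247e7fd38da247d7fd38da247f7fd7b8da247dbfd38da247fbfd51438da247ebfd7041,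
  0x1ffd147c8cfbfe6ff5041,
  0x1f47e8a3451041,
  0x725147e8a28a2893,
  0x68928a38d45bccbbea0d1451451451041,
  0x6092083e8a28a28820820,
  0xa28a28a28a28a28a28a28a24924,
  0x1924a28f919f7fc881b451451451049,
  0x68a28a28c1c6a2dfc5df5451451451820,
  0xf4783451e467dff0406a2883,
  0x3451464c1a28a28a2893,
  0x28a28a28a3451451451451924,
  0x1471a8b7ff08351451468f1a8b7fe08368a28a38d45bfe041b,
  0xf468fff,
  0x51a28a28d1d1451451249,
  0x51451451451451451451451249,
  0xe8a28a3e4928a3249,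
  0x1468a28a28f1a8b7f86837233effba8349251451924,
  0xe8a28a3fd147,
  0x3ffff,
  0x1e8d1fe8f,
  0x51451451468f451451249,
  0x1c6a2df3590dc6a2df3d90d249249f8d45be6321ba28a24924,
  0x28a28a28a28a3451451451c8cfbe55cf5c8cfbe59d75,
  0x514514514514745145147,
  0x51451451451451c8cfbfeb90d45145147,
  0x51a28a28f9345147,
  0xa28a28a28a3d1c8cfbfe690d45147,
  0x7ffe8f,
  0x3d147fa28f,
  0x1fc8cfbfe430dfe3516feee86e8f,
  0xe8e467dff4586a3fc6a2dfdd30da28f,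
  0xa28a28a347a345147,
  0xd145147f8d45be2b21b45147,
  0x41a28a28d1d1451451041,
  0x28a2492492493919f6dd73ea8924828a24824,
  0x28a28a28a28a3919f6f373ea8928820a20820,
  0x49249251451924924a28a24924,
  0x1451449264e4924828a24824,
  0x1c6a2dff508ce23aedf508d041040e467cdf508d820a28e467df8cd06a28820711d4dacd06,
  0xe8a28a383451c8cfbf15a0d451041,
  0xdb85e5fa88cdb85e5f288d041b6e1797f223606dc2f2fa446a286dc2f2fc446a3041,
  0x1051449449d1451451451041,
  0xa28a28a28a28a28a28a28a24924,
  0x49451251268a28a28a28a24924,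
  0x1a28a24f8d45bc9881b451451451824,
  0x7233eff9e2351449271a8b7c9e2378d45bc8881b919f6d8881a8924a28a24924,
  0x837fdb8be491b068dff6e2fe246effb717e1236ffb717d1235146ffb717c1237041,
  0x3d1a3e8a3e467dff424683,
  0x28d145147d1451451041,
  0xa28a28928a28a28a28a28a24924,
  0x51451249278d45be3211b919f7fb211a8924a28a24924,
  0x3ffa28e8c1,
  0x3820847eca33820847cca36e08211f528ce08211fd28db820847c4a33820847e4a35143820847f8a37041,
  0x1ffd1468e467dff6e4683,
  0x7ff45145147,
  0xe8a3f451451451041,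
  0x7451fc8cfbfe968d451451451041,
  0x145145145145145145145147,
  0x145145147451451451451249,
  0x28a28a28e467dff1f46d145145145147,
  0x1251449e8a28a28a28a24924,
  0x71a8b7cd86371a8b7cf86371a8b7cc4637f1a8b7cc86364924a28a24924,
  0xf8d45be2231bfa28a28a2893,
  0xd147f233effaba37233eff9da35145145147,
  0xe467dff2cc6a28fe467dff3746e467dff7b46a28a28a28e4,
  0x7a3fa28d183,
  0x3d1fd1468e467dff62c6c1,
  0xe274f8f81c6e274f8fc1c6f89d3e3f7b1bf13a7c7f763713a7c7cf63514713a7c7d7637041,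
  0x7924fd1451451249,
  0x51a289347451451451041,
  0x28d1449a3c8cfbfe338d451451451041,
  0x51451451a28a28a28a28a37233eec7746,
  0x28c9451f451451451249,
  0x51451451451451451451451924,
  0x1471a8b7cc1e351264f1a8b7cdee364924a28a24924,
  0x1451449a3c8cfbfecb8dc8cfbfef38d451451451924,
  0xe8e467dfe82c6fd145145145c6d1431b31a4,
  0x91c720a20924a28a2481c71c820,
  0x1a3fa28a345147,
  0x1ff47d173,
  0x3249f924924a28a24924,
  0xffa3928a3249,
  0xe081d0b384ce081d0bd84db820742e6133820742d613747233effbc133820742bc1349450e081d0b184d249,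
  0xa28a28d1a28a28a28a28dc,
  0x51451468e467dff7c26a28a28a28a2873,
  0x71ca3e8a28a28a28a1c71c,
  0xa28a28a28a28a28a28a28a389d34d8571b,
  0xa28a347451449251451924,
  0x28a3f45144925145125c,
  0x7fa28a3238e5c71c,
  0xa3b2080944b03745147233effb4134945145c71b42363a06,
  0x3451fa28a28d147,
  0xf1f420ec8137f47d1b9,
  0xe081d0bfa4ce081d0b7a4db820742ce933820742ee937438207425c1349c8cfbfd704d450e081d0bda4d249,
  0x5145147a28a28a28a28dc,
  0xa28a28a28a28a28a28a28a246602ef62a066dc2cd60efa,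
  0x1451451d1451451451450e5c,
  0x1451451c8cfbfee64da28a28a28a28a389d34d9571b,
  0x68a3e8a2893919f7e2a09a8a28c9,
  0x78fa102e389bf4514382071e3da368a2e5c,
  0x1451c8cfbfe8e4df451449c8cfbf1d04d45145c71b42365a06,
  0x924924a28924928a24a28a24924,
  0x48e39251924a28a2471c71c71c,
  0x1239440e081d0b814d924928a2871c720820,
  0x928a24a24928a24924a28a24924,
  0x1c6a2d7b414d449051a28a28a28a28a2081c,
  0x1820828e467dff20a6a20a28a28820820820,
  0x32dea8098535a2617be4299a2617bf429ba28a28a2482081c820,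
  0x41468820828a28a28820820820,
  0x3f039451451451450e41,
  0x388ebd5fc53388ebd5dc53388ebd5c2537a28a2872871c71c71c,
  0x3c7d082f614db5989de714db5989df894de467dff38a6a20a28a28820820820,
  0xe3820745705349a1ca28a28a28a28a1c71c,
  0x924928a28a28a28a28a28a20924,
  0xe081d0b294dd64426df8a67040e8524a6e467dff24a6711d7a9f8a6a28928924a28a24924,
  0xa28a28a28a28a28a28a28a1c824,
  0x39820a1ca20a28a28820820820,
  0x1468a28a28a3468d147,
  0x3d1a347e8f,
  0x3ffff,
  0xa38f89d26fa9a492492493264a28a24924,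
  0x1451451451451a28a28a28e4,
  0x51928928a28e4928a3249,
  0x51451451451451449251451924,
  0x28e8d1479345193,
  0x28e8a3919f7fde69a8c99345193,
  0x51a3919f7fc369a8e467dff05a6a3264e3e274ee9a6a28c9e172dea89a6,
  0x28a28a28a28d1938f89d22fa9a8a28c9,
  0x1d1a34793451c9,
  0x38f89d3e9e9b8f89d3f9e9b8f89d3e5e9a8d1a3f1f13a7c3d368a38f89d3fee9b,
  0x3ffff,
  0x51a28a28a28d1d1451249,
  0xa28a28a28a28a28a28a28a38f89d3ee19b,
  0x7451451451f45147,
  0x51a28a28a28a3c7c4e9e30cdc8cfbfed0cd45147,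
  0xfffa28f,
  0x3d1a28fd147233eff8bd37,
  0x1c7c4e9f7ccdc7c4e9ffccdc7c4e9f02cdc7c4e9ee4cdf233effb9337e3e274f9e66d1478f89d3f399b,
  0xe3e274fb166e3e274ff166e3e274f5666a28e467dff5666a3f1f13a7c8b368a3919f7fd5e9bc7c4e9f42cd,
  0x51041441441268a28a28a24820,
  0x1ffd1e8c1,
  0x3dad39825566ff436e0c248cb368e467dff696683,
  0x1441051051e8a28a28a20820,
  0x51051449236e0c24a9b37919f7fc4d9a8a28a28a24924,
  0x1d147e4924a28a24924,
  0x2db8309276cd451c8cfbfe36cdf451451451260,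
  0xe3e2749b766e3e2749f766e3e27498f66fe4924a28a24924,
  0x41041449236e0c1e29b35c8cfbc94d9a8928a28820920,
  0x820a28924928828a28a28a20920,
  0x20d1451264824924a28a24924,
  0x41c2e5b537ecd470b1739dfb349260824924820820820,
  0x79125ae88d9bfb06281c6acdd1e8c1,
  0x51041460a20a28a28a28a20820,
  0x60f1f13a45db3713ed8703b37919f7e32d99c12703bad9b451451451049,
  0x28a28a3a3a3d147,
  0xe8ffe8f,
  0x3ffff,
  0xa28a28a345193451451249,
  0xa249289324993a28a24924,
  0x145145145145145145145147,
  0x34514747e8a3249,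
  0x51451451a28a327233eff80f351451924,
  0x1451451d1a3268a28c9,
  0x3a28ffa28f,
  0xa28a28a28a3919f7fd579a8d1c8cfbfe83cd45147,
  0xa28a28d1c8cfbfe3bcda3268a28c9,
  0x3a3ff451c9,
  0x1a28f919f7fd2f9bfa28f,
  0x51451d1f233eff92f37a28f,
  0x51451451a28a28d145147,
  0x747fff,
  0x3a3ffe467dff1216f,
  0x1451451468a28a28a28a2893,
  0x928a24e8d193919f7e2079a8a3924,
  0x1251449d1c8cfbfee22d464928a3249,
  0x51451451451451449251451249,
  0x928a28d1c8cfbfe722dc8cfbfe922d464928a3924,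
  0x51451268924a32494515993ef68516924,
  0x68a28a3451a3d147,
  0x3ffff,
  0xe8ffe8f,
  0x1451451468a2893451451249,
  0x1451451451451451451451449bfedd65822d,
  0x1a2893a3f919f7fa679a8a3249,
  0x28a28a28d1451f233efc48f351451924,
  0x68a28e8f233effb44b7a28f,
  0x747ff233eff51f35146db830fdfbcd,
  0x145145145145147919f7fc425a8a28a38cc692db7cd,
  0x1a28a347233eff8e4b7919f7fd625bd146a0ea3dd882d,
  0x3451d1c9c9451c9,
  0x347e467dff4a96ff233eff440b5147cfaab4e9016,
  0x1451451a28d1c94514645993ef6fbe6,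
  0x824920920928828928a28820920,
  0x41051464820828a28820820820,
  0x3a20fe8d1451041,
  0x51451441060a28a28a28a20820,
  0x1249241241e8928a28a24924,
  0x7451c1068a28820820820,
  0x5b7061254e5a8a3919f7fd8e5b93451451451920,
  0xa24928924820828a28a28a24920,
  0xfc6634a24d96e0e8d1451041,
  0x64a20828820a28a28a28a20820,
  0x64938cc692ca72cdb83078872d451bfedd70e72d451451451049,
  0x3a28a28d1e8d147,
  0x1d147fe8f,
  0x3ffff,
  0xe464f8b64ad92492472327c59256a3924a28a24924,
  0xa28a28a28d1d1251451c8cfbe5612de467df2c9e6,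
  0xa28a28a28a28a28a28a28a37fdbacb979b7fdbaca445a4,
  0x1451451451a3c8cfbfe94ad45145147,
  0x1d145147d1a28f,
  0xa28a28a28a28d145145147,
  0x7451fc9a28f,
  0x1d147233effa4ab7e472327cae156a28f,
  0x3451451a3c9c8cfbfe64ad451473eaad3bda5a4,
  0x1c8cfbfe3aad451451a3c8e464f8964ad45145664fbda3a5a4,
  0x39193e5c5ab68a28a1c8c9f2ecd59c8c9f2f4d5bb9193e5c9ab68a1c8c9f2f8d5b,
  0x3ffff,
  0x1451451451fd1451249,
  0x1451451451f45145147,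
  0x51451451468d145145147,
  0x51451451439193e58c6b51c8cfbfe31ad451451451bfedd65d4acdb830fdd4ad,
  0x3a28ffa28f,
  0xfffa28f,
  0x1a28a28ff45147,
  0x73eaad689e5a8a36dc188a7596f451c8cfbf1e4adc8cfb6d112dc8cfb6dd3cd041,
  0xa28a28924a24928a28a28a24924,
  0x49049249241468a24a28a24920,
  0x4945125127233edb41cb5c8c9efa0e5a4a24828a24824,
  0xe8ff45145147,
  0x3ffa1c8c9f13655b919f7e2055bc1,
  0x1ffd0e464f8932adc8cfbf182adc8cfbfe0bad83,
  0x51449249451468a28a28a24924,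
  0x1451451251451c8cfbfe17ad451451451060,
  0x4104927e8a28a28a20820,
  0x28a2893e467dff1bd6e8a28a28a24824,
  0x1451449e467dff47d6e467dff5bd6e8a28a28a20820,
  0x24a2893919f7fd5f5b919f7fc9f5b919f7fcef59c8c9f155f59c8c9f149f5a4924a28a24924,
  0x68ff451451451824,
  0x28a2893f451451451924,
  0x1ffd1e8c1,
  0x3feffb75f0c1b7473eaac6520da8e467dff703683,
  0xe4a39f55631bfad451a28a28a28e0,
  0x3451451451451451451451060,
  0x6ffb759d51b6ffb759f51b7dff6eb3ca36effb759c51b68a28820820820,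
  0xf3eaac65a8dbf233effa51b7451451451041,
  0x1cfaab196236a28d1073eaac4d7f5a8a28a28a20820,
  0x68a28a383051451451041,
  0x3249451b6e0c3f2deb68928820a20820,
  0x3251451820a28a28a28a20820,
  0x1249251468dff6eb80b96a28a24a28a20924,
  0x924928a28a28a28a28a28a24824,
  0x92892872327c52136920e467dff2136a24924a28a24924,
  0x7a3468d1e8f,
  0x3912275f54db912275ed4db912275e34db912275fd4db912275eb4db912275f34dbff2244ebf29b7912275e94db,
  0xa24928928928928928a28a24924,
  0x1249251251251450e35d093da6da28a24924,
  0x924924924924a28a24a28a24924,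
  0x711d565c336711d5658336711d565a336711d565e336f711d565bd36711d565fd36e8711d5659d36711d565dd36c9,
  0x938d45196ccdb8d45197ccda4c9a28e4a28a24924,
  0x1b70aa476cd9b70aa466cd99194a948cdb912275c8cdb6dc2a91ab366dc2a91eb36e467dff03366dc2a910336e86dc2a918b366dc2a91cb36c9,
  0x49ad3234a766dc8913aee66d268a3919f7fcccda8dff69913336924a28a24924,
  0x1bcc02f7b736bcc02f7f736a3de6017bd39b5e6017bf39b7de6017be39b6f300bde1cdb,
  0x7451a3e8f47,
  0x28a28a28a28d1451451451264,
  0x49a24c223a4598b693844748b516dc9a28a24924,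
  0x145e6017be25b51468de6017bc25b51451a28a2f300bdfe2db,
  0xa3451451a28928d1451249,
  0x71c1c62ce5b71c1c62f65b4d2f124565b51c70718b996dc70718bb96de4f8e0e31632db8e0e317d2da8c9,
  0xa2f300bdf0ada8a28de6017bc15b51c8cfbfe496d251a28a379805ef796d,
  0x390a23168ada8a38a77bc78ada8e29def1a2b6bcc02f7a2b693249a28a24924,
  0x3d1a3a347f,
  0x1468a3088e92f5ada8e111d25cb5b51a28a28a3088e92f9adb,
  0x49bfed84b9d6d249a3a24924a28a24924,
  0xa274837c53ada4a38a77bc43ada8c223a4b4eb6a3919f7fc3ada4924a28a24924,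
  0xa28a24924924924924a28a24924,
  0x1bfed857436dbfed857c36da3f7fdb0af7adb7fdb0aefadbeffb615cf5b77fdb0afbadb,
  0x28a28a28a28bcc02f7b1b69b6fbf771b6f45145e6017be8db64,
  0x145145145144db7dfbb4db51a28a28a3088e92f26db,
  0x144e319c192db51468effb615dcdb6ffb615fcdb7a28a37fdb0af66db,
  0x138c67065b6dd184474979b6dc223a4bf5b6f088e92f56dba28a3088e92f96db,
  0x7214462eedb7214462dedb4d2f124eedb4d2f124dedb4e906f8eedb4e906f8dedb4db7dfbdedb4db7dfbeedb4e319c1dedb4e319c1eedb7c85118b3b6d3a41be33b6d34bc4933b6d36df7ef3b6d38c67073b6d,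
  0x28e8fa3e8f,
  0x51d1a28d1468d147,
  0x51ffff,
  0x924924a28a24a24928a28a24924,
  0x147140248f83b64928a28a24924a28a24924,
  0xa2eb63ac7a1daeb63ac6a1da4eeb63ac721da8a249345d6c758c43b51249,
  0x51d1e467dff2876d1249268d1249,
  0x2893451449449249a28a24924,
  0xa28a24924924924924a28a24924,
  0x1468928a38a01243c1da4924924a28a24924,
  0x14747fe8f,
  0xa3a3ff47233effa63b7,
  0x3ffff,
  0x1451451451451251d1451264,
  0xa28a28a28a28924928a28a24924,
  0x928a24924928928bcc08197176e467dff7176a28a24924,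
  0x125d6c758ccbb5d6c758f4bb49dd6c758c4bb5d6c758e4bb5d6c758d4bb7a28a24924,
  0x24924938a01246e5dbc500923b2ed451264a28a24924,
  0x51d1f75b1d6192ede8a28c9,
  0x1451451d1c500921b2ed449d1451249,
  0xa28a28f233effaebb51c8cfbfe72ed249d1451249,
  0x5145147233eff91bb7233eff9ebb51c50092172ed249d1451924,
  0x28d1f919f7fc35db75b1d61d2ede8a2893,
  0xa3919f7fdedda8fc8cfbfe9aedc50092dd6ed75b1d6132ede8a28c9,
  0xa3451e8a28a345147,
  0x3ffff,
  0x3d1f451e8f,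
  0x924a28924924924a28a28a24924,
  0x4975b1d6345ed46eb63adb11daeb63ac70bda4a2893c8cfbf188ed45175b1d6305ed264,
  0x928924bad8eb69476e2804909476928a24928a28a24924,
  0x3798103f55ed798103fd5edde6040fe57b6f30207e2bdb798103fe5edbcc081fb2f6de6040fe97b6f30207e4bdb,
  0x7fff47,
  0x127d1451451468a2893,
  0x3ffe8a2893,
  0x5d6c75b52fb7fbcc081f69f6e467dff29f6e8a28c9,
  0x1fd14514745147,
  0x51e8a28a28a28a28a28c9,
  0x28a3451451451451451451924,
  0x1798103f0fed75b1d630fedc5009230feda28924924924a28a24924,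
  0x51d1f47468f,
  0x51a28d1a28e8d147,
  0x7a3fff,
  0xa37fdb097303a493249451924a28a24924,
  0x28c9468d1924d1a24924,
  0x28924a3451449249a28a24924,
  0x924a28a24924924924a28a24924,
  0xa28a39097e2b303a4928a37fdb093303a4924a28a24924,
  0x7a3fff,
  0x51a28ffd147,
  0x3d1fff233eff99077,
  0x28a28a28a3919f7e4083a4928a24a28a24924,
  0x1468a3fe8a28c9,
  0xa37fdb096f43a49326ffb612ee877919f7fd543bdff6c25550ea28a24924,
  0x1451451451a28924e467dfeec0ea28a24924,
  0x28a28a28a28a28924e467dfe820ea28a24924,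
  0x51c84bf0a1a1d451c84bf0b061dc9c8cfbfe1a1d249a28a24924,
  0xa28a28a3928a24d1451264,
  0x51451e425f8a8d0ef7fdb092f43b919f7fcb43b268a28c9,
  0x1c70c40bf61d451c70c40b0e1dc70c40b8e1dc70c40b4e1de493471c3102dd8751924,
  0xf47fe8f,
  0x6ffb615d4476ffb615f4477effb615e44777fdb0afc23b7fdb0aec23beffb615e84777fdb0ae423b,
  0x5145145147bfed855ca1de8a2893,
  0x5145145147c8cfbf2da1dc8cfbf2ca1de467dff048ea28a24924,
  0x1451451451bfed857191ddff6c2b548edff6c2b448ee467dff548ee467dff448ea28a24924,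
  0x28a28a28a3bfed856e91dbfed856291dc8cfbfe191dc8cfbfe691dc8cfbfec91d45147,
  0x7451ff45147,
  0x1468a28ff45147,
  0x1c70c40bed1dc70c40b6d1dc84bf0b1d1dc84bf0b6d1dc84bf0bed1dbfed8579d1ddff6c2bf68edff6c2bb68ef47212fc2eb4771c3102eb476ffb615eb4749,
  0x1bfed857fd1dbfed857031d47bfed8577d1ddff6c2b9e8edff6c2bee8ef451449bfed8575d1d,
  0x6ffb615c4c76ffb615e4c77effb615f8c777fdb0af463b7fdb0ae463beffb615f0c777fdb0ae863b,
  0x28e8d1ff47,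
  0x28a28a28a28a24e467df90c0e928a28a24924,
  0xa3919f7e4ac3a4a347c8cfbf23a1dc8cfbf22a1dc8cfbfda91da28a24924,
  0x28d1468effb6158ec77919f7e2323b919f7fdb63b45147,
  0x7a3f27d1924,
  0xa3451451449928d1451264,
  0x28e386205f78ea39097e17de3a8dff6c2b8f8ec9bfed857ef1d249a28a24924,
  0x3a28fd147f,
  0x7212fc5cc277212fc5f4275147212fc5e4277212fc5d4277a28f9097e2d7e3b919f7fd7e3b9097e2e213b,
  0x924924a28924924a28a28a24924,
  0x3ffff,
  0xa28e3df8e7b24ee3df8e7d24ed1d1e3df8e7a24ee8a38f7e39f093b,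
  0x51249464924928928a28a24924,
  0x2892493198d276a93a4924a3c7bf1cf949da28a24924,
  0x28a28a3451451c7bf1cfb49dc8cfbfe549da28a38f7e39e693b,
  0x26974b26b273824b94cb276e092e53cc9ce092e530c9ce092e538c9ce092e534c9df43824b94fd2751249,
  0x49249268d1e4a28a24924,
  0x12519347233effa72751c9c1d514e4e924a28a24924,
  0x4d2e964964efdc125ca2193be8d1249,
  0xa28a28a28a28a24924a28a24924,
  0x3ffff,
  0x1844462f469d47844462f069d451451e11118bdea768a30888c5f753b,
  0x24924930888c5e4d3a4a28a3844462fc69da28a24924,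
  0x1451451a28a28a30888c42293a4a28a24924,
  0xde0489af14ef16586b78a770888c5ead3b9383aa1429ce092e51429de11118bc5a768d1924,
  0x611118bc3a726974b24da778b2c35a6d3b0888c5fed3b2707542053b919f7fdad39c125ca2053ae092e52d69d844462d029dc8cfbfd029d464e0ea8dda751249,
  0x14514611118be3a749249264924a28a24924,
  0x71efc73fba771efc73e7a751c7bf1cf1e9dd1f1efc73eba77471efc73cba778f7e39f9d3b,
  0x924a24928924924928a28a24924,
  0x722b6dfdfa7722b6dfffa7722b6dfe067722b6dfc0676b1fa70b0673205af090677ffc8adb7fde9d,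
  0x37980f37319d7980f37b19d47bcc079be8cede603cdc4675e603cde46768ef301e6fc33b,
  0x28d1468fa345147,
  0x28e8ffa347,
  0xde603cdfd675e603cdc3677de603cddd676f301e6fab3af301e6e6b3bf7980f37159d,
  0x51451468a28a28a28a28a2f301e6f5b3b,
  0xa28a28e43b9c9cecea28d1468a28a390ee727db3b,
  0x28e8fa28a28a28f,
  0xa3a3fff,
  0x51c500ccbdb9da38a01996b73bc500ccb1b9dc500ccbeb9dc500ccad39d75b210a339dbcc081f19cee467dff69cef8a01997573b,
  0x28e8dd6c842b0e7714033290e75145145145e6040f88e77233effa0e77,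
  0x3798103f979d798103f579dde6040fc5e76f30207fcf3b798103f679dbcc081fd3cede6040fc9e76f30207f8f3b,
  0x28d1468fa28a28f,
  0x1468a3451a345145147,
  0x51d1a3f451f,
  0x7a3fff,
  0xa28a28a28a28a28a28a28a37fdb8ee70bb,
  0x146ffb71de11751468d1bfedc77f85d451451a37fdb8eef0bb,
  0x1e8fe8a3f,
  0x51a28a28d1bfedc763f9d451451c8cfbfedf9d47,
  0x6ffb71ddf176ffb71dff177f7fdb8ee38bb7fdb8ef38bb7fdb8eeb8bb7fdb8efb8bbf7fdb8eed8bb,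
  0x146ffb71df89751a3dff6e3be12edff6e3b912edff6e3b082ea28e467dff082efbfedc77825d,
  0xa3451a3a345145147,
  0x28d1468fa28a28f,
  0x7a3fff,
  0x51d1a3e8d1f,
  0xa28a28a28d145145145147,
  0x1e8fd1d1f,
  0x28d1451d1bfedc76f25d45145147233eff9c977,
  0x37fdb8ee32bb7fdb8ef32bbeffb71dfa5777fdb8ee52bb7fdb8ef92bb7fdb8ef52bb7fdb8eed2bbf7fdb8ef12bb,
  0xa37fdb8ee0aba8d1bfedc77f95ddff6e3bbcaedff6e3bdcaea37fdb8ecdcbb919f7fcdcba8fbfedc77d95d,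
  0xbbd4286155da28a28fa28a28f,
  0x1aef50a19b577fff,
  0x3a28ffa28f,
  0x3451451a28a28d145147,
  0x1bfedcfbab5dbfedcfb6b5d47dff6e7d95aeeffb73ef2d777fdb9f696bb7fdb9f716ba8fbfedcfbf35d,
  0x6ffb73efed76ffb73ec1d77effb73eded777fdb9f776bbbfedcfbdb5dbfedcfb5b5df7fdb9f736bb,
  0x3c8b9eea235d451c774822c35dfdff6e7d21aea28f233effa0d77,
  0xd1451ff45147,
  0x3a28ffa28f,
  0x3ffff,
  0xe8ffd1f,
  0x28a28a28d1a345145147,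
  0x38bd5455deba8a28ff45147233effa3d77,
  0xa28a28a28a345145145147,
  0xa28a28a3e8d145147,
  0xd1474747a28f,
  0x3451d1d1c663461496ed147233eff84b77,
  0x3ffff,
  0xa28a28d145145145145147,
  0xfff451f,
  0xd147468e331a30bcb76331a30a6b75147233eff9ab77233eff8cb77,
  0x34518cc68c211dda3919f7fd43ba8e331a3082b76331a3096b75147233effbab77233effacb77,
  0x3c6634617f6efe467dff6f6ef451f,
  0x3a28ffa28f,
  0x6ffb73ed3776ffb73ef3777effb73ee37777fdb9f61bbbbfedcfb75ddbfedcfbb5ddfbfedcfbd5dd,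
  0x1451451451e8a28a28a3c83108b6ddd,
  0x51c1f356603dda3d1d1d147,
  0x1c1f3566b3ddffff,
  0xa28a28e274f9bcdeee8a28a28a28a389d3e6fd7bb,
  0x1451451c1f35665bddc2504fa5bdd451451c8cfbfe5bdd451451c1f3567dbddc2504fbdbdd,
  0x713a6c5e9f7713a6c5d9f77c4e9b1727ddf13a6c5c1f7713a6c5e1f77e274d8bbdeef89d362e77bb,
  0x28a28a1c8c803f2fb9c8c803fafb9c8c803eafbbe8a28a1c8c803e2fbb,
  0xc90545fb7ddad6d25fb7ddafdc5ffb7dcd15e6d7b7ddc72451fb7dce098e8fb7ddb05e2d7b7dcdb85e47b7ddad62b1fb7dce23af57b7ddc72389bb7dce35d087b7ddac7a9f7b7dce4295a3b7ddb060aebb7dce445d7fb7dce46089fb7dd,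
  0x38b2bd5eefbb91836a7efbb91836a61fbb91836a71fbb8b2bd5e9fbb8b2bd5e1fbb8b2bd5fefbb8b2bd5f9fbb91836a79fbaf30204f9fbb7981027f7dd79810270fddf,
  0x1c5012471fdd798103fefdd75b2687efdde280923f7eedd6c9a1cbf77140491cbf77140491ebf75d6c9a1ebf75d6c9a1dbf77140491dbf75e6040fdbf76f30207f5fbb798103f2fdd,
  0x3ffff,
  0x1c8aad2fd03dc8aad2f883dc8aad2f083dc8aad2f703dc8aad2ff03dc8aad2fb03dc8aad2f303dc8aad2fc83dc8aad2f483dff,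
  0xdff6e6b9c1edff6e6bdc1eff7fdb9ae507b7fdb9af507b7fdb9aed07b7fdb9afd07bf,
  0x6f30204ec87af30204fc87bef30204f487bbcc0813821ebcc0813c21ebcc0813a21ebcc0813e21ef,
  0x6ffb735d30f6ffb735f30f7effb735e30f77fdb9ae687b7fdb9afa87b7fdb9af687b7fdb9aee87bf,
  0x1c8bd3236c3dc8bd323ec3dc8bd3231c3dc8bd3239c3dc876a0f1c3dc876a0f9c3dc876a0fec3dc876a0f6c3dc876a0f5c3de3516f3b61ee3516f3f61ee3516f38e1ee3516f3ce1ef,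
  0x1c831fa33c3dc831fa3dc3dc831fa37c3dc831fa3bc3dc831fa3fc3dc831fa3023dc831fa3823dc831fa3423dc831fa3c23dff,
  0x1c6a2dffe23ce23af57e23ce23af57123dc6a2dff123ce467d57123d7233eabf11eb88ebd5c88f3919f55c88f3919f55e88f388ebd5e88f388ebd5d88f78d45bff447bc6a2dff223d,
  0x1c877963523dc877963923dc877963323dc877963d23dc8bc3cf323dc8bc3cfd23dc8bc3cf923dc8bc3cf523dc877963b23de3516f3a91ee3516f3c91ee3516f3e91ee3516f3991ef,
  0x3ffff,
  0x3ffff,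
  0x18cc692f9e3d8cc692f5e3d8cc692fee3d8cc692f1e3d8cc692f6e3dfc663497a71ec663497e71ec663497971ec663497d71ef,
  0x37fdbacf027b7fdbace827bf7fdbace027bbfedd67fe3ddff6eb39f1edff6eb3ef1edff6eb3df1edff6eb3bf1ef,
  0x39193e2fc4f5c8c9f16e27ae464f8bb13d72327c5e89e72327c5a89ef72327c5d09e72327c5b09ef,
  0x1bfedd67c93cdb830ffc93cdb830ff293d72327cbe49eb6e0c3fd24f39193e5d24f6ffb759d24f5b7061fe127b7fdbace127b7fdbacf1279b7061ff1279c8c9f2f127ae464f97093d,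
  0x390a2317d27b1ee8127d27b90a2316327b90a2317327b1ee8126b27b1ee8127327b088e92f327be111d25fa4f71ee8127527b90a2317527b1ee8126d27b8447497a93d,
  0x3ffff,
  0x7b5249872d3ded49261dd4f6d49261ed4f6d49261fd4f6d49261c34f6d49261e34f6d49261d34f7f,
  0x3918527eba7b918527f3a7b918527e3a7b8b2cfefba7b8b2cfee3a7b8b2cfef3a7b8b2cfef7a7b918527f7a7af3020677a7bc5967f73d3dbcc0819ce9ebcc08198e9ef,
  0x38a01246c67b8a01247c67be280491d19ef140248f0cf7140248d0cf7140248c8cf7e280491fe9ee280491be9ef,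
  0x391836a7267b91836a6267b91836a7a67b91836a6a67b91836a6667b91836a7667b91836a6e67b91836a7e67bff,
  0x7212fc2d6cf7212fc2e6cf7212fc2c6cf7212fc2facf7212fc2dacf7fe425f85e59ee425f85a59ef,
  0x1c8367d3bb3dc8367d37b3dc8367d3fb3dc8367d3073dc8367d3473dc8367d3873dc8367d3c73dc8367d3273dc8367d3a73dff,
  0x1c5b8fd3573dc5b8fd3d73dc5b8fd3173dc5b8fd3973dc5b8fd3e73dc5b8fd3673dc5b8fd3373dc5b8fd3773dc5b8fd3b73dff,
  0x1b5e025fee7b8dfe5c7ee79b5e025e1e7b90889361e7b9088937ee79c79996fee79b70bdafee79b603f47ee79b70bdae1e79c7c7a661e79c8cf9bfee79c7c7a67ee7b8e18817ee7b7fdb097ee7b8e188161e7bc84bf17f73d,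
  0x3ffff,
  0x38f7e39f217b8f7e39e617b8f7e39fa17b8f7e39ea17bfc7bf1cf60bdf1efc73e82f78f7e39e417bc7bf1cfc0bd,
  0x6f0244afc2f7165868c22f7165868fc2f611118be22f7165868f22f611118bd22f7e11118bfc2f77812257617b8b2c347617b7812256e17b844462fb0bd,
  0x34565d77d17b9173dd6d17b4565d76317b4565d76d17b9173dd7317b2707f4f517b2707f4e517b4565d76517b4565d77517bc9c1fd3b45ef9173dd6517b9173dd7517b,
  0x1c5eaa2b38bdc5eaa2bb8bdc5eaa2b78bdc5eaa2bf8bdc5eaa2b04bdc5eaa2b44bdc5eaa2b84bdff8bd5457b17b8bd5456b17b,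
  0x391836a6497b91836a7897b915abef897b915abee497b91836a7c97b915abee297b915abefc97b89d3e6ec97b89d3e6f497b89d3e6fc97bf89d3e6f897b89d3e6e497b]

/-- Hints for degree four, 12 vertices. -/
def hf12 : ℕ :=
  0x38f744f07f596313b60175569cd1f000da9db32707b596313b70175726b6cb07b5c8c1b53000c447732b07f52e2d4e301f525dc68305f4f91592303f445579a701f5a939e3505f5c4e60c505f5c4e9f37000dc4e9f370774e081bf707f4a85eab701f44d8bb8701f4e467d6307f5c8cbe1105f5c8cfbff0775e12827d83dae27d56900bae425f8b83dae27d56980ba3517b3702fac61fbb3823ad6b66c900fad2fadc9839ac61fbb3023ad2fadc9039a6ca316903bae2f551583fa3a6dac1037a8c8e08880fa9c632a301ba703e2a5807ade3dee502fa2fe73b500fa5b3d5af81ba35cea2d837ac66349680fa7233ebd03bae331a2a81cd377a1a6811d6331a2ac1cd377a1a6c11d7233eff800d7233effc15d7233effc00d7233eff815d5770b1160a6837ce02403e9d9c1e260a69770b1140a69d9c1e240a6b022091c06ea54648ac03e9770b1140de9d9c1e240de9f3f3b4606a9c2f98cc04e9c2f98ce04e8d73a8b40de9f3f3b4406aa0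79b0ac03ea7193e7406eb198d1540deb198d1540a6a5443bc403e8d73a8b60a6b198d1560a68d73a8b40a6b7fdb9f406ab0a5119c04eb7fdb9f606ab0a5119e04eae50e2e408eb781226a03e8307380402eb8b2c2500e6b78121600e6b8b2c35a03e90345f8408e95e2c7ae0f6b42e86b408e8a4ef2be0d6b60c44ce0d6830f4e5e0d693c3be4402eb6c569fe0d69c8cef4e0f694bcdac408eb919f6c00e6b0888c4203eb919f7e203eb0888b200e6b1fde4860ceb8b2c346062934ba5960ceb8b2c344062b8f7e39e0ceb919f7fe062b198d28e0ce9c6a7e1e08eae257dde096aa28149402e84e1d6240daae257ddc09684e1d6260dab8f7e39e0be8961c3c20ae9142387c096b4df87540dab4df87560daae46401105748a11c3f04b4e4677a70474a348d8a0275c7bf1ce06f5c8cfb600535c7bf1300535c8cfbfe06f57b9b84b0075c8cfbf10115c8cbe130075c8cfbfe01157b9b85703b5c8cfbff0115c8cbe1f03b4e353f0f0075971ec630435565cb8206749a5d2c902b5971ec6204349a5d23802b481a2fc205b50adc61d01dabf6527c80550b0d59c81750b0d59cc1757233efc415d3f6527cc0553919df2c16d614a233409d7919f6c00c6bc7bf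1c10615c8cfbf20135c8cfbf30135c7bf1ce0615c8cfbfe0335c7bf1cf0615c8cfbff03346c6f1ca02748c56e5304d599d06120274dc2fbb5041570bdb7f04d4e3cccb60415734c88704d48ee527304d4e3cccb70415c6443320274cec7e8a0275b900d1304d4bc7bfba0275c8cc32f04d4e4677b50414e467cde0415c6faab304d4c6abdfa0274e467cdf0415bfeae8704d5c8cfbf10414e464ddb04d44b8781b04d5c8cfbfe0414db8253b04d5c8cfbff0414d352f4b04d4c904e060534f8ea4c205d5ad700270475be1bed106e592a950405d5c5b8fd206e42ebbee404343624b720435c5b8fd306e5c8cfbf10275df0df68813a64f75a8036ac463e4d811ae466197811ae467ad383cae467db003ca690a8a5823adce1bed029a7233eb0036a1bd500e02eae467df88372180681102eae467dff0372e3af386021ae467dff8372dfe0b11021a6482703009a71f2bf580ead6b8013803ae41b3e980f271f2bf500eae41b3e900f26e24375016a6e24375816ae04cb6880f2e128279023aaca19c1019a20b6741023a6dc1283032a140f2e402ea1087de5803a6dc2ce802eae467ad381ca9f55ae5009a71d62ad019aa0e8d63032ae467df880f27233ef9016a7233ef9816ae467dff00f27233eff00eae467dff80f27233eff80ea6482703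039a7c75261036ad6b801383dae05768582cac954a82036ae425f4802cae425f8503ba71e66ea801aaca19c1029aba5f34681ba93ffd99029a6dc128301aa69f93cf039a0e6f251036a123acee036ae467ad382cae467dff03bae467db002ca7233ef8801ab87fca681bae425f8582dae425f858072e425f8502dae425f850072e467dff82dae467dff8072e467dff02da6482703019a7c75261016ad6b801381dae460da983b2c954a82016ae460da903b2223b99583ea223b99503eae09252883b2d650ce0804d117458b812d36e094181552898d82410d36e1695410d5483902c0ed7233d69c065039f6b280cd0468ff1815535f8fb6804d3919f5881f53919f58c1f57233efc41d97233eff81d93855b6480b57233effc1d9366e71f00b508a3428c11504d4ba880f902cb9d4804d2eb4928c0152ae60a840f956b8938c0153079a94804d69c13b8c11509c5ed480cd04d4ba8c0f9283a81480cd64ebeec816d05646aa0055723306180a55212ddd81d50b948a4802d0e86e40802d714a90e816d714033180a54db8ab8005506a5eac80f57233efc4119448208b00f57233eff81190595a7680f57233effc1192ba6f7100f55c4d16fc0a571659fd80991265521802d5c75b3dc0a55e5cf7d40995c75b3d80a53079a94818d5c4d16f80a509c5eec818d71659fdc09939190ed802d05646c8403505646a400355d6bbb8c02526f03dd802d31b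96d9802d5b65b5dc0251242bbb818d5e6040c41a52aafff5818d7233efc40997233ed8c0a57233ed880a57233eff80995e603eec0a57233effc0995e603ee80a56a33cc481e567fd8a381e51265521814d6b734b3816501bea64814d6a33cc4c1e5342f30481cd38263a5812d67fd8a3c1e539190e181cd059950f00552bb636c80556d49261c0e94db897180ad4db8971c0ad6d4926180e97233eff80dd6d486c740e9611289800d543e250d00d511727e680ad7233efc40e911727e6c0ad7233eff80e950a290b00557233effc0e94e743dc8055544d324c0e5544d32481391265521804d6755da4c0656755da441396755da480656a26992407284e2f7640a6aa26992609c9c8c870c06682cca7e809a95db1aa409ab919830c092b1bb572c056b6a9b5960b6b919eb4e09287117d940c6b08944f004a8206ee340c6b08945e60aab08945e40aab919f7e20b4b919f7fc0b4b08945fe0cab919f7fe0b4b08945fc0ca9dd823aa0f4992399540c69dd823ae092b5a06bfe09280d156ae0f4a8d7e7240c680d156ac0f495e375dc06ab5a06bfc0929dd823ac0929c8c870c06ab5b0f10e0f480df520c092b5b0f10c0f4b5b0943c092b5b0943a0f4b5b0943e0928425b1f40c6935abe940c680df520e0928933103601ab919f7e2054837ce76601ab919f7fc054873ed3f601ab9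19f7fe0549771a95601a9923291c0c28a2f357407cb5ad9b6c0c2a5eacafe0aca6ba616407c9ccc0eec0ac90345f8407cacc32b9407cb89ccb8c0c29ccc0eee0ac9c12593c0c2b088d46c04c9b7060f00ba9c8c9f100bab7fdb9c00ba93fc353c04cb919f7e00bab919f6c00a4a9d637e40eaaac9c5480eab919f7e20a49c8c9f16036b919f7e6036b919f7fc0a4b3fd0c540eab919f7fe0a4b3096a280ea85d05af40a2b06deb300fc830738040a2ae36dcfa0e4a6ba60bc0fcb7415ffc0e490345f840bc8f475b080bcaa009004042b7415ffe0e496f2d564042a718ca8c00c896ac1ac0cab7fd51c605c97473b6c0eab788ca0c0ca8a8c2bbc00c9b70b24e05cb919f7ce0c49c8c9e0e0c4b919f7cc0c4b919f7e2044b919f6c20c4b919f7fc0449c8c9e220c4b919f7fe0449c8c9e0c0c49664fbf00a6b06deba809c83073fe40c2934ba36e02ca6ba616409c886e3e5c02c90345f8409c8f475b0809c8e9b6b040c2886e3e5e02cb198d1500a6a718ca8c0f4b7fd5cf0082b9199b10082b919f7e2086a71932ce0f4b7fdb9c2086b919f6c0004b7fdbace04ab7fdbacc04ab919f7e2004b9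19f7e40eab919f7e60eab919f7fc004b919f7fe04ab919f7fe004b919f7fc04aae9f3a44022b06de6080dcb5ad980c0629afad62c074a6ba59840dc91f05d7e07490345f8401cb198d15200695e3190c022941d47d006aa718ca8c074ae99ca140dcaf87b3b80dcb919f7e2006a71932ce0749c8cef4e01cb7fdb9c006ab198d25c0c6b919f6c00b8b198d25e0c6b919f7e6016b919f7e4016b919f7e20b8b919f7fc0b8b919f7fe0c6b919f7fe0b8b919f7fc0c68d45ed84022b06de60803caacb9ee40c285338d6e0cca6ba598403c85338d6c0cc90345f840ec8f475b080ec95e3190c0c2b2b3e0fc0ccb198d1500e6a718ca8c0b4b91990be0dc9c8c9f100dab812c17c0569c8cef4e09cb7fdb9c002ab6128f480aab873b8e40aab919f6c0098b919f7e407ab919f7e607ab919f7e2098b919f7fc098b32c38280cab919f7fe098b41fda540caa00a35dc0e2b06deb3005cb5ad980c0a2ad205a6a014a6ba60bc05cabb2e76c01490345f8406c8f475b0806c95e3190c042abb2e76e014b198d1680c6a718ca8c034b7fd5cf0002b7fd517e002b598d28c0aaa71932ce0349c8cf15e06cb7fdb9c004ab919f7ce0d8b919f6de078b919f7cc0d8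b919f7e2058b919f6c20d8b919f7fc058b919f6f2078b919f7fe058b919f6dc078b5274332074b83df2420b4b33afe4c0b2b7e6fd18068aed13a840b4b9033a1a06896ae43a208c8f113f1408cb917879c068b5e600e40b4aa147e420b4b917879e068a9bcaa640b2b32e8f32074b380653a07491560cb402cac887eda074a910ec5a0b4b584698c0b4b919f6c0068924f329408c9bbf3a1a08cb919f7e2068b919f7fc068ae72c4ba0b4b919f7fe068b77d47a40b4992110c60dc9f1d4984004b5ae004e0dcb7dbbd840e88290932c0049452cb520e8903ff9840a4accd3b2c0a4b35243520e88e9bb0ac004ab286704004b7fdae4e0dcb919830c0e89b70bec60dcb919eb4e0288a78d56a0f48a9ba36a0f4b919f6c00288bfb420a04c8b3ebb8a04cb919f7e2028b3f498c204c8ba501c204cb919f7fc028ae67e45a0f4b919f7fe02881193ada0f499209f6c0589f1d49840d8b5ae004e09cb9063f460c8b2552a080d8b9063f440c8a35155040c4a26450880c4b8129d420c889b17688078ab286704078b7fdb8e6072b7fe4fc00c89b704d6c0d88b1aea7609cb3f5526c0d8948d7aa40589a3ba7c40788732eb28078b919f6c00c8a3e365f80c4b714ab040c4b919f7e20c8b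919f7fc0c89760d6340d8b919f7fe0c8966d34080d899209c0c0789f1d4984058b5ae0ab6032b7de4998088b2552a08058b8fa869a088904001640448f4d2da8044b90ed41c08889b17c28058ab286ee4058b7fdb8e6032b90ed41e0889b704d6c07896299db402c94ad622407894f00d6c078a456cdc4058b919f6c008887f25828058b919f7e2088aff73904044a1881df8044b919f7fc088b2f46308058b919f7fe088b3e8053405899209c0c0b89f1d4984098b5ae004e01cb7fa1aa2068b2552a08098b595c25006885d7835009886c49eac098b916344a068b84a095401c9c0fe7740b8ad03b32a0749c8c9ef4004b7cd3a92074b2bcd26a092ac13079c092b919eb4e070a4f6943c05287efd18a052b919f6c0070950686bc0528b968142052b919f7e2070b919f7fc070ac299d5a092b919f7fe070b2d30b4409290ae386404883552d1c0a88932a90c0d8b7dbbd8404883552d1e0a8b8fe9808048af2c614a048ad41cfa8048b8a0123c04cb916344a048aa1d55460a89c8c8a6c0d8a8ecbe7605cb798b5be05cb919830c060aea51424018b908b26c01888dd5b440f8b919f6c00d0867c31a80f8b919f7e20d0a6fb2c4c024b07f7e40024b919f7fc0d0968181880f8b919f7fe0d0977523b40f890ae30840c880c423500c8b5b088f40b4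b7fa1aa2088a6d8b6a20c8b595c250088af2c5cca0c8ad41ca080c8b8a0123c0b4b916344a0889d4a98ac0c89c8c870c004b08945c6014a71932ce014b79349ea034b919eb4e0e0ae886a1c034b919f6c00e089ae7a8a00c931e76bc00cb919f7e20e0adb0ae4200cb7aed23c00cb919f7fc0e0b2e758c4034b919f7fe0e0ac3deada034b9155a5e010ae9d645c0308932ac6c018af91065e090ae9d645e030af91065c090b7a7e75a010b9155a5c010aeb63abc00cae23935a090b821b85a0309c8c870c0f8a719331606485cb9a6400cb919830c020850ec23c0f8ab99e354020a745dbcc018b919f7ce090b919f6de030b919f7cc090b919f7e2010b919f6c2090b919f7fc010b919f6f2030b919f7fe010b919f6dc030aa9fd9c6008aa2608c40488932ac6c058b4242dc60f0b3aa5cc2048b4242dc40f0af2c5cca008aa9fd9c4008aeb6420c052b916344a0f0aa2608c60489c8c870c078b088debe014a963a8f606cb919830c0c088f661240389c21ccec0f888aef344038b919f6c00a0864dc9a8038b919f7e20a095e2860408482d9dbf8084b919f7fc0a0969e8288018b919f7fe0a0979224b401890ae308407095c972200288932a90c0b8b7dbbd8407082af6322028b5f68e1c07088b94ba40b88afa7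91c0709c1329a40b895e0a6220289c8c870c0b8a71932ce054b7fdae4e054b919830c040b919f59e012b919f7e2012b919eb4e040b919f6de0d2af301f5e0d2b919f6c0040aeb5f03a012aeb5f246012b919f7e2040b919f7fc0408e5a6d3e054b919f7fe040b61618be054b8b2bd5e0c0ae3ac75c0608932ac6c038b91836a60c0ae3ac75e060b91836a40c0b7454a5a0c0b8b2bd5c0c0af301f5a0d2b82494a20c0b7bf1b5a0609c8c870c038a7193316094a718caec094b919830c0808162f3cc03884e05a3c038b919eb4e080af30204e0c0b919f6de060af30204c0c0b919f7e20c0af301f420c0b919f7fc0c0b919f6f2060b919f7fe0c0b919f6dc060ab9e72da040b83df2420408f1176da040b5ada4be0009bb0f642040b5fb8bfe00096ae94ea040b33b90ea040b8e48a3e00092c2a3aa040af4f9faa040b60bc5ae0009afe174a040b78b134a040b5ac563e0009b404fea040b7cd4bea040b8e471360009bb2198a040b83f158a040b58f53ee00092c0adea040af4da9ea040b60c15d6000ac18365a040b919f7fe0008f8b3a5a0409c8c803e0aeb9383aae0175e274d8b833af212fc5809d71910e6809d7233eff809d784a09f408eb9097e2c08ebe467dff02dafc8cfbe502b5c8cf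be500d5c83107102b5981df9803d55eeedc201eae049fbe015acd8706901eacff431503aab8a4b30805567be59281756331a30812d36bd93d005528238e2810d2a0af6f010d7233eff80ad6331a3081cd65d739f0175733022880daba11d91206d58cc68c205358cc68c20135e467dff019af919f7fc0c6bd51371f409ab919f7fc0bab8bd54540da941fcfc809ab919f7fc086b8e513d205558ca3e2602d5c35a15e02aae467dff03eaf233eff80f57233eff80b56141b4400b57919f7fc03abd07f695032af32c38280cabe467dff00aadff6e7d032adff6e7d03aae467dff032adff6e7d02aaf233eff81557c8cfbfe0255f1f4f8cc07c8ad9fca204ca76a38e009c9b70bec60f2b193df8c09cae67e45a0f4aefa91380ec99ccfdd408ca95917e00ec926d953803c994febaa08c8ccc1be003cb543a90c0ecb3bba9ea0b4b919f7fc0b298b6ad0c03cac95d6d40b4995c9f380dc8d39ae0c0dc9c8cf058082b7fdb8ec0f2a9eaff860295c8cfbfe01952b2df08814ae467dff01caf2d30b44092bb0a6756824a23a519801e2888618e011201b372e01e24bb24e303123a90ea3011232a2875031260f353501e2138bf830162e28064b824a622392e03124c914f801625bcb6f8036238fabf5036235cec0303622a30b1983d22a2f63d03d26c86146000a0894550000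acc0218c02f2dcd41088032b7b7c980172a81da8c03f2b8aa0430032dff5f9801b2d6c3761024ae3c482301b2b0f7ab680d204c5cd5800addc91a30172cb9d63100d24bb231502927e74ae602623345b06026238fabf5026235cea3500122a30b1981d2bad9085014ade6040f80a56eb5ef76012af30207c092b6a49424074a72d369f02a5ad86e3e01a538c6a6f04a568d74de01a5081588100e255a41b700e2aaa021702125f2719102121197ab1009251d592c00e25b5890602122234c4203e2aeb5da980d226034cd03e25e4892d0062a73ac8c00620dc922600925a7a0a20062aa4947b01c2cff6a0301c2b060d968102c6634a2808ac7f7921838aef0244a80c570888c5c0a2b919f7fc0a2b8f7e39a0c2b0888c440a2bc7bf1ce0115c7bf1ce0615e3df8e7010ae467dff010af1efc7080857919f7fc082bc8cfbf30015c8cfbf20015bfed85506e5c8cfbfd0015e467df903b2dff6c2a83b2dff6c2583f2dff6c2503f2e467dfe81f2dff6c2b83f2f233eff80f97233efc80797919f7e60bcb7fdb0960bcb919f7fa03cb919f7fa0bcbc8cfbfe06e5c8cfbf204e5e467df98172e467df90172f233efc40b97233eff80b97233eff41397233eff40b979097e1401cbc8cfbf30365c8cfbf20365e467df881b2e467dff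01b2f233eff40d96eb63ac40acb8a012440ccaeb63ada0cca2d4b4320e4868d32300e4b29b36290724de332e90725c50092201656bbbfec0052714f84c8052a2cb30f802936c1c4a40295d6c75b40e925a42d9802923c856400297233eff81197233eff80995e6040c81697919f7e600cb919f7e400cbc8cfbf10065c8cfbfe0065798103d05a5c8cfbfd0065e467dff01d2e467dff03d2f233efcc0697233efc80697919f7e2034b919f7fc034bc8cfbfd01a5e467df903929c6338283929c6337d8352f233eff80a97088e92c094b919f7fc094af300bda014b088e914094b79805ee00a5bcc02f18192bcc02f10192de6017bc0c97353eb20068b3526d90028977c282a028b7952bfc0e0b87b4f4c0e0ae8a212a068af55ae320e0b8c5b3ac0e0b919f7fc0a4b919f7e40c4b919f7fa0c49c8c9f160249c8c9f14024ae464f970125dff6e708262e467dff0112f233efcc1097233efc81097919f7e2084b919f7fc084b7fdbae0098b919f7fa084bc8cfbfe0025c8cfbf203c5c8cfbfd03c5c8cfbf307c5c8cfbf207c5c8cfbfd06c5c8cfbf107c5c8cfbfe07c5e467dfe83e2f233eff81717233eff40b17233efcc0717233efc80717919f7e2038b919f7fc038bc8cfbfd01c5e467dff0262e467dff0362e467d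ff0162f233efcc0317233efc80317919f7e2018b919f7fc018bc8cfbfd00c571ae80083a26d2c5d8032270fae5283223e50b30834259ea00c0342a0be63c41a102935fe41a17233eff80d1702e572011138f749b81916f1d21781415bc33f60141584feb741115d081ba41416f96ec801416f4f12f20a0b8bf186c0a0b919f7fa028b919f6c20c8b8d45be40a8b0b30450048b1a6a63a04894128ad20308acb1c40030a514599e01849ead0180185c8cfbf006445cb11b60184a8315790185c8cfbfe01458f1c8e6024560d511103059807ac80305b3969d0818254542108182e467dfe81c2e467dff0322e467df90122e467df90022e467dfe8122cb0eccf0042addf5cc0042e467dfe8022b0691548042cc026300042d9ca94e402167e875d80217233eff81117233efc81e17233eff41e1585758a41216623ff8012172d51a3c090ab893e30090ba02d0f6048567b58b90485c8cfbfe0385cb4a4230302ae1ad200302d8524544181661eec201816cf427c20c0b403183c0c0b919f7fa0e0b919f6c20a0b919f7e4090b919f7fa030b919f7e60b0b919f7e40b0b919f7fa090b919f7e20b0b919f7fc0b0b919f7e00a0b919f7fa0b0bc8cfbfe0685c8cfbfe0185c8cfbf20085c8cfbfd0085c8cfbf30285c8cfbf20285e467df88142e467dff0142f233eff40a17919f7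fc0e0bc116c91010574f41080105b892d030082dea41800082df244878041722cf2840417233eff40817233eff81417233eff80c17233efc81817233eff41817233efcc0417233efc80417919f7e2020b919f7fc020bc8cfbfd0105e467dff0102de6040cc1015e6040c81016f30207e080b

/-- The spheres with 12 vertices. -/
noncomputable def L12 : List TL := nextL 11 352 L11 hs12 hf12

/-- Mask for 11 vertices. -/
def mk11 : ℕ := 0x1000000000000000000000000000000000000000000000000000000000000000000000000000000000000000000000000000000000000000000000000000000000000000000000000000000000000000000000000000000000000000000000000000000000000000000000000000000000000000000000000000000000000000000000000000000000000000000000000000000000000000000000000000000000000000000000000000000000000000000000000000000000000000000000000000000000000000000000000000000000000000000000000000000000000000000000000000000000000000000000000000000000000000000000000000000000000000000000000000000000000000000000000000000000000000000000000000000000000000000000000000000000000000000000000000000000000000000000000000000000000000000000000000000000000000000000000000000000000000000000000000000000000000000000000000000000000000000000000000000000000000000000000000000000000000000000000000000000000000000000000000000000000000000000000000000000000000000000000000000000000000000000000000000000000000000000000000000000000000000000000000000000000000000000000000000000000000000000000000000000000000000000000000000000000000000000000000000000000000000000000000000000000000000000000000000000000000000000000000000000000000000000000000000000000000000000000000000000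0000000000000000000000000000001000000000000000000000000000000000000000000000000000000000000000000000000000000000000000000000000000000000000000000000000000000000000000000000000000000000000000000000000000000000000000000000000000000000000000000000000000000000000000000000000000000000000000000000000000000000000000000000000000000010000000000000000000000000000000000000000000000000000000000000000000000000000000000000000000000000000000000000000000000000000000000000000000000000000000000000000000000000000000000000000000000000000000000000000000000000000000000000000000000000000000000000000000000000000000000000000

/-- Mask for 12 vertices. -/
def mk12 : ℕ := 0x1000000000000000000000100000000000000000000000000000000000000000000000000000000000000000000000000000000000000000000000000000000000000000000000000000000000000000000000000000000000000000000000000000000000000000000000000000000000000000000000000000000000000000000000000000000000000000000000000000000000000000000000000000000000000000000000000000000000000000000000000000000000000000000000000000000000000000000000100000000000000000000000000000000000000000000000000000000000000000000000000000000000000000000000000000000000000000000000000000000000000000000000000000000000000000000000000000000000000000000000100000000000000000000000000000000000000000000000100000000000000000000000000000000000000000000000000000000000000000000000000000000000000000000000000000000000000000000000000000000000000000010000000000000000000000000000000000000000000000000000000000000000000000000000000000000000000000000000000000000000000000000000000000000000000000000000000000000000000000000000001000000000000000000000000000000000000000000000000000000000000000000000000000000000000000000000000000000000000000000000000000000000000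0000000000000000000000000000000000000000000000000000000000000000010000000000000000000000000000000000000000000000000000000000000000000000000000000000010000000000000000000000000000000000000000000000000000000000000000000000000000000000000000000000000000000000010000000000000000000000000000000000000000000000000000000000000000000000000000000000000000000000000000000000000000000000000000000000000000000000000000000000000000000000000000000000000000000000000000000000000000000000000000000000000000000000000000000000000000000000000000000000000000000000000000000000000000000000000000000000000000000000000000000000000000000000000000000000000000000000000000000000000000000000000000000000000000000000000000000000000000000000000000000000000000000000000000000000000000000000000000000000000000000000000000000000000000000000000000000000000000000000000000000000000001

theorem d5 : chk 4 128 0 0 L4 hs5 hf5 = true := by decide +kernel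
theorem d6 : chk 5 160 0 0 L5 hs6 hf6 = true := by decide +kernel
theorem d7 : chk 6 192 2 0 L6 hs7 hf7 = true := by decide +kernel
theorem d8 : chk 7 224 4 1 L7 hs8 hf8 = true := by decide +kernel
theorem d9 : chk 8 256 6 3 L8 hs9 hf9 = true := by decide +kernel
theorem d10 : chk 9 288 8 4 L9 hs10 hf10 = true := by decide +kernel
theorem d11 : chk 10 320 11 6 L10 hs11 hf11 = true := by decide +kernel
theorem e11 : dist 11 mk11 1249 L11 = true := by decide +kernel

theorem d12 : chk 11 352 13 8 L11 hs12 hf12 = true := by decide +kernel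

theorem e12 : dist 12 mk12 7595 L12 = true := by decide +kernel

theorem good11 : Good 11 L11 fun _ _ => True :=
  good_step (n := 10) (good_step (n := 9) (good_step (n := 8) (good_step (n := 7) (good_step (n := 6)
    (good_step (n := 5) (good_step (n := 4) good4_base d5) d6) d7) d8) d9) d10) d11

theorem good12 : Good 12 L12 fun _ _ => True := good_step (n := 11) good11 d12


/-- There are exactly 1249 triangulated 2-spheres (χ = 2) with 11 vertices
and exactly 7595 with 12 vertices. -/
theorem num_spheres_11_12 :
    numClasses 11 (fun S => IsCombSurface 11 S ∧ eulerChar 11 S = 2) = 1249 ∧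
    numClasses 12 (fun S => IsCombSurface 12 S ∧ eulerChar 12 S = 2) = 7595 := by
  exact ⟨count (by norm_num) (by norm_num) good11 e11, count (by norm_num) (by norm_num) good12 e12⟩
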